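/- Let G be a connected, locally finite simple graph that is vertex transitive (for any two vertices u, v there is a graph automorphism of G sending u to v) and has polynomial growth: there exist c > 0 and k such that β(G, v, r) ≤ c·r^k for all r ≥ 1. Then the growth degree of G is an integer: there exist d ∈ ℕ and constants A, B > 0 and r₀ such that A·r^d ≤ β(G, v, r) ≤ B·r^d for every vertex v and all r ≥ r₀; in particular lim_{r→∞} log β(G, v, r)/log r = d. -/

import Mathlib

open Filter

/-- The growth function of a graph: the number of vertices within graph distance `r`
of the vertex `v`. -/
noncomputable def graphGrowth {V : Type*} (G : SimpleGraph V) (v : V) (r : ℕ) : ℕ :=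
  {w : V | G.dist v w ≤ r}.ncard

namespace PolyGrowth

section Walk

variable {X : Type*} (G : SimpleGraph X) [G.LocallyFinite]

/-- Connected vertex-transitive graphs without isolated vertices. -/
structure TransGraph : Prop where
  conn : G.Connected
  trans : ∀ u v : X, ∃ φ : G ≃g G, φ u = v
  deg_pos : ∀ v, 0 < G.degree v

/-- The averaging operator of the lazy simple random walk. -/
noncomputable def lazyWalk : Module.End ℝ (X → ℝ) where
  toFun f x := f x / 2 + (∑ y ∈ G.neighborFinset x, f y) / (2 * G.degree x)
  map_add' f g := by
    funext x
    simp only [Pi.add_apply, Finset.sum_add_distrib]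
    ring
  map_smul' c f := by
    funext x
    simp only [Pi.smul_apply, smul_eq_mul, ← Finset.mul_sum, RingHom.id_apply]
    ring

open Classical in
/-- The `n`-step transition probabilities of the lazy walk. -/
noncomputable def heatKer (n : ℕ) (x y : X) : ℝ := (lazyWalk G ^ n) (Pi.single y 1) x

variable {G}

theorem lazyWalk_apply (f : X → ℝ) (x : X) :
    lazyWalk G f x = f x / 2 + (∑ y ∈ G.neighborFinset x, f y) / (2 * G.degree x) := rfl

theorem lazyWalk_pow_succ (n : ℕ) (f : X → ℝ) :
    (lazyWalk G ^ (n + 1)) f = lazyWalk G ((lazyWalk G ^ n) f) := by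
  rw [pow_succ']; rfl

theorem lazyWalk_pow_succ' (n : ℕ) (f : X → ℝ) :
    (lazyWalk G ^ (n + 1)) f = (lazyWalk G ^ n) (lazyWalk G f) := by
  rw [pow_succ]; rfl

theorem lazyWalk_mono {f g : X → ℝ} (h : f ≤ g) : lazyWalk G f ≤ lazyWalk G g := by
  intro x
  rw [lazyWalk_apply, lazyWalk_apply]
  have := h x
  gcongr
  exact h _

theorem lazyWalk_pow_mono (n : ℕ) {f g : X → ℝ} (h : f ≤ g) :
    (lazyWalk G ^ n) f ≤ (lazyWalk G ^ n) g := by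
  induction n with
  | zero => simpa using h
  | succ n ih => rw [lazyWalk_pow_succ, lazyWalk_pow_succ]; exact lazyWalk_mono ih

theorem heatKer_nonneg (n : ℕ) (x y : X) : 0 ≤ heatKer G n x y := by
  classical
  have := lazyWalk_pow_mono (G := G) n (f := 0) (g := Pi.single y 1)
    (fun z => by by_cases h : z = y <;> simp [h]) x
  simpa [heatKer] using this

theorem degree_iso (φ : G ≃g G) (x : X) : G.degree (φ x) = G.degree x := by
  rw [← SimpleGraph.card_neighborFinset_eq_degree, ← SimpleGraph.card_neighborFinset_eq_degree]
  symm
  refine Finset.card_bij (fun y _ => φ y) ?_ ?_ ?_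
  · intro y hy; simpa [φ.map_adj_iff] using hy
  · intro a _ b _ h; exact φ.injective h
  · intro b hb
    refine ⟨φ.symm b, ?_, by simp⟩
    rw [SimpleGraph.mem_neighborFinset] at hb ⊢
    rw [← φ.map_adj_iff]; simpa using hb

theorem lazyWalk_comp_iso (φ : G ≃g G) (f : X → ℝ) :
    lazyWalk G (f ∘ φ) = lazyWalk G f ∘ φ := by
  funext x
  simp only [lazyWalk_apply, Function.comp_apply, degree_iso]
  congr 2
  refine Finset.sum_bij (fun y _ => φ y) ?_ ?_ ?_ (fun _ _ => rfl)
  · intro y hy; simpa [φ.map_adj_iff] using hy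
  · intro a _ b _ h; exact φ.injective h
  · intro b hb
    refine ⟨φ.symm b, ?_, by simp⟩
    rw [SimpleGraph.mem_neighborFinset] at hb ⊢
    rw [← φ.map_adj_iff]; simpa using hb

theorem lazyWalk_pow_comp_iso (φ : G ≃g G) (n : ℕ) (f : X → ℝ) :
    (lazyWalk G ^ n) (f ∘ φ) = (lazyWalk G ^ n) f ∘ φ := by
  induction n with
  | zero => simp
  | succ n ih => rw [lazyWalk_pow_succ, lazyWalk_pow_succ, ih, lazyWalk_comp_iso]

theorem heatKer_iso (φ : G ≃g G) (n : ℕ) (x y : X) :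
    heatKer G n (φ x) (φ y) = heatKer G n x y := by
  classical
  have h := congrFun (lazyWalk_pow_comp_iso φ n (Pi.single (φ y) 1)) x
  have hs : (Pi.single (φ y) 1 : X → ℝ) ∘ φ = Pi.single y 1 := by
    funext z
    simp [Pi.single_apply]
  rw [hs] at h
  exact h.symm

namespace TransGraph

variable (h : TransGraph G)
include h

theorem degree_eq (x y : X) : G.degree x = G.degree y := by
  obtain ⟨φ, rfl⟩ := h.trans y x
  exact degree_iso φ y

theorem dist_iso (φ : G ≃g G) (x y : X) : G.dist (φ x) (φ y) = G.dist x y := by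
  have key : ∀ (ψ : G ≃g G) (a b : X), G.dist (ψ a) (ψ b) ≤ G.dist a b := by
    intro ψ a b
    obtain ⟨p, hp⟩ := h.conn.exists_walk_length_eq_dist a b
    rw [← hp]
    have := SimpleGraph.dist_le (p.map ψ.toHom)
    simpa using this
  refine le_antisymm (key φ x y) ?_
  simpa using key φ.symm (φ x) (φ y)

theorem exists_adj_of_dist_eq_succ {x y : X} {n : ℕ} (hxy : G.dist x y = n + 1) :
    ∃ z, G.Adj x z ∧ G.dist z y = n := by
  obtain ⟨p, hp⟩ := h.conn.exists_walk_length_eq_dist x y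
  cases p with
  | nil => simp at hxy
  | @cons _ z _ ha q =>
    refine ⟨z, ha, ?_⟩
    rw [SimpleGraph.Walk.length_cons] at hp
    have h1 := SimpleGraph.dist_le q
    have h2 := h.conn.dist_triangle (u := x) (v := z) (w := y)
    have h3 := SimpleGraph.dist_eq_one_iff_adj.mpr ha
    omega

theorem finite_ball (v : X) (r : ℕ) : {w | G.dist v w ≤ r}.Finite := by
  induction r generalizing v with
  | zero =>
    refine (Set.finite_singleton v).subset ?_
    intro w hw
    have : G.dist v w = 0 := by simpa using hw
    rw [h.conn.dist_eq_zero_iff] at this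
    simp [this]
  | succ r ih =>
    refine ((ih v).union ((G.neighborFinset v).finite_toSet.biUnion (fun z _ => ih z))).subset ?_
    intro w hw
    simp only [Set.mem_ofPred_eq] at hw
    rcases hw.lt_or_eq with h1 | h1
    · left; simp only [Set.mem_ofPred_eq]; omega
    · right
      obtain ⟨z, hz, hz'⟩ := h.exists_adj_of_dist_eq_succ h1
      simp only [Set.mem_iUnion]
      exact ⟨z, by simpa using hz, by simp [hz']⟩

/-- Balls as finite sets. -/
noncomputable def ball (v : X) (r : ℕ) : Finset X := (h.finite_ball v r).toFinset

@[simp] theorem mem_ball {v w : X} {r : ℕ} : w ∈ h.ball v r ↔ G.dist v w ≤ r := by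
  simp [ball]

theorem lazyWalk_one : lazyWalk G (1 : X → ℝ) = 1 := by
  funext x
  have : (G.degree x : ℝ) ≠ 0 := by exact_mod_cast (h.deg_pos x).ne'
  rw [lazyWalk_apply]
  simp
  field_simp
  norm_num

theorem lazyWalk_pow_one (n : ℕ) : (lazyWalk G ^ n) (1 : X → ℝ) = 1 := by
  induction n with
  | zero => simp
  | succ n ih => rw [lazyWalk_pow_succ, ih, h.lazyWalk_one]

theorem lazyWalk_pow_congr (n : ℕ) (x : X) {f g : X → ℝ}
    (hfg : ∀ y, G.dist x y ≤ n → f y = g y) : (lazyWalk G ^ n) f x = (lazyWalk G ^ n) g x := by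
  induction n generalizing x with
  | zero => simpa using hfg x (by simp)
  | succ n ih =>
    rw [lazyWalk_pow_succ, lazyWalk_pow_succ, lazyWalk_apply, lazyWalk_apply,
      ih x (fun y hy => hfg y (by omega))]
    congr 2
    refine Finset.sum_congr rfl fun z hz => ih z fun y hy => hfg y ?_
    have h2 := h.conn.dist_triangle (u := x) (v := z) (w := y)
    have h3 := SimpleGraph.dist_eq_one_iff_adj.mpr ((G.mem_neighborFinset x z).mp hz)
    omega

theorem heatKer_eq_zero {n : ℕ} {x y : X} (hn : n < G.dist x y) : heatKer G n x y = 0 := by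
  classical
  rw [heatKer, h.lazyWalk_pow_congr n x (g := 0)]
  · simp
  · intro z hz
    have : z ≠ y := by rintro rfl; omega
    simp [this]

theorem lazyWalk_pow_eq_sum (n : ℕ) (x : X) (f : X → ℝ) {S : Finset X} (hS : h.ball x n ⊆ S) :
    (lazyWalk G ^ n) f x = ∑ y ∈ S, heatKer G n x y * f y := by
  classical
  rw [h.lazyWalk_pow_congr n x (g := ∑ y ∈ S, f y • Pi.single y 1)]
  · rw [map_sum, Finset.sum_apply]
    refine Finset.sum_congr rfl fun y _ => ?_
    rw [map_smul, Pi.smul_apply, smul_eq_mul, heatKer, mul_comm]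
  · intro y hy
    have : y ∈ S := hS (by simpa using hy)
    simp [Finset.sum_apply, Pi.single_apply, this]

theorem sum_heatKer (n : ℕ) (x : X) {S : Finset X} (hS : h.ball x n ⊆ S) :
    ∑ y ∈ S, heatKer G n x y = 1 := by
  have := h.lazyWalk_pow_eq_sum n x 1 hS
  rw [h.lazyWalk_pow_one] at this
  simpa using this.symm

theorem sum_heatKer_le (n : ℕ) (x : X) (S : Finset X) :
    ∑ y ∈ S, heatKer G n x y ≤ 1 := by
  classical
  rw [← h.sum_heatKer n x (S := S ∪ h.ball x n) Finset.subset_union_right]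
  exact Finset.sum_le_sum_of_subset_of_nonneg Finset.subset_union_left
    fun _ _ _ => heatKer_nonneg _ _ _

theorem lazyWalk_single [DecidableEq X] (y : X) :
    lazyWalk G (Pi.single y 1) =
      (1 / 2 : ℝ) • Pi.single y 1 + ∑ z ∈ G.neighborFinset y, (1 / (2 * G.degree y) : ℝ) •
        Pi.single z 1 := by
  funext x
  rw [lazyWalk_apply]
  simp only [Pi.add_apply, Pi.smul_apply, Finset.sum_apply, Pi.single_apply, smul_eq_mul,
    mul_ite, mul_one, mul_zero, h.degree_eq x y]
  rw [Finset.sum_ite_eq', Finset.sum_ite_eq]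
  have hadj : y ∈ G.neighborFinset x ↔ x ∈ G.neighborFinset y := by
    rw [SimpleGraph.mem_neighborFinset, SimpleGraph.mem_neighborFinset, G.adj_comm]
  congr 1
  · split_ifs <;> norm_num
  · by_cases hx : x ∈ G.neighborFinset y
    · rw [if_pos hx, if_pos (hadj.mpr hx)]
    · rw [if_neg hx, if_neg (fun hy => hx (hadj.mp hy)), zero_div]

theorem heatKer_symm (n : ℕ) (x y : X) : heatKer G n x y = heatKer G n y x := by
  classical
  induction n generalizing x y with
  | zero => simp [heatKer, Pi.single_apply, eq_comm]
  | succ n ih =>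
    have h1 : heatKer G (n + 1) x y = heatKer G n x y / 2 +
        (∑ z ∈ G.neighborFinset x, heatKer G n z y) / (2 * G.degree x) := by
      rw [heatKer, lazyWalk_pow_succ, lazyWalk_apply]; rfl
    have h2 : heatKer G (n + 1) y x = heatKer G n y x / 2 +
        (∑ z ∈ G.neighborFinset x, heatKer G n y z) / (2 * G.degree x) := by
      rw [heatKer, lazyWalk_pow_succ', h.lazyWalk_single, map_add, map_sum, map_smul]
      simp only [map_smul, Pi.add_apply, Pi.smul_apply, Finset.sum_apply, smul_eq_mul,
        ← Finset.mul_sum]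
      simp only [heatKer]
      ring
    rw [h1, h2, ih x y]
    congr 2
    exact Finset.sum_congr rfl fun z _ => ih z y

theorem heatKer_add (m n : ℕ) (x y : X) {S : Finset X} (hS : h.ball x m ⊆ S) :
    heatKer G (m + n) x y = ∑ z ∈ S, heatKer G m x z * heatKer G n z y := by
  classical
  rw [heatKer, pow_add, Module.End.mul_apply, h.lazyWalk_pow_eq_sum m x _ hS]
  rfl

theorem heatKer_self (n : ℕ) (x y : X) : heatKer G n x x = heatKer G n y y := by
  obtain ⟨φ, rfl⟩ := h.trans y x
  exact heatKer_iso φ n y y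

theorem le_heatKer_one {x y : X} (hxy : G.dist x y ≤ 1) :
    1 / (2 * G.degree x : ℝ) ≤ heatKer G 1 x y := by
  classical
  have hd : (1 : ℝ) ≤ G.degree x := by exact_mod_cast h.deg_pos x
  rw [heatKer, pow_one, lazyWalk_apply]
  rcases Nat.le_one_iff_eq_zero_or_eq_one.mp hxy with h0 | h0
  · rw [h.conn.dist_eq_zero_iff] at h0
    subst h0
    simp only [Pi.single_apply, Finset.sum_ite_eq', if_true, SimpleGraph.mem_neighborFinset,
      SimpleGraph.irrefl, if_false, zero_div, add_zero]
    rw [div_le_div_iff₀ (by positivity) (by norm_num)]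
    linarith
  · rw [SimpleGraph.dist_eq_one_iff_adj] at h0
    simp [Pi.single_apply, Finset.sum_ite_eq', h0, h0.ne]

theorem card_ball_iso (φ : G ≃g G) (x : X) (n : ℕ) :
    (h.ball (φ x) n).card = (h.ball x n).card := by
  symm
  refine Finset.card_bij (fun y _ => φ y) ?_ ?_ ?_
  · intro y hy; simpa [h.dist_iso] using hy
  · intro a _ b _ h; exact φ.injective h
  · intro b hb
    refine ⟨φ.symm b, ?_, by simp⟩
    rw [mem_ball] at hb ⊢
    rw [← h.dist_iso φ]; simpa using hb

theorem card_ball_eq (x y : X) (n : ℕ) : (h.ball x n).card = (h.ball y n).card := by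
  obtain ⟨φ, rfl⟩ := h.trans y x
  exact h.card_ball_iso φ y n

theorem lazyWalk_pow_abs_le (n : ℕ) {f : X → ℝ} {M : ℝ} (hf : ∀ x, |f x| ≤ M) (x : X) :
    |(lazyWalk G ^ n) f x| ≤ M := by
  have h1 := lazyWalk_pow_mono (G := G) n (f := f) (g := M • 1)
    (fun y => by simpa using (abs_le.mp (hf y)).2) x
  have h2 := lazyWalk_pow_mono (G := G) n (f := (-M) • 1) (g := f)
    (fun y => by simpa using (abs_le.mp (hf y)).1) x
  rw [map_smul, h.lazyWalk_pow_one] at h1 h2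
  rw [abs_le]
  constructor
  · simpa using h2
  · simpa using h1

end TransGraph

end Walk

end PolyGrowth

namespace PolyGrowth

theorem hellinger_le_entropy {a b : ℝ} (ha : 0 ≤ a) (hb : 0 ≤ b) (hab : b = 0 → a = 0) :
    (√a - √b) ^ 2 + a - b ≤ -Real.negMulLog a - a * Real.log b := by
  rcases ha.eq_or_lt with rfl | ha'
  · simp [Real.sq_sqrt hb]
  · have hb' : 0 < b := lt_of_le_of_ne hb fun h => ha'.ne' (hab h.symm)
    have hsa := Real.sqrt_pos.mpr ha'
    have hsb := Real.sqrt_pos.mpr hb'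
    have h1 := Real.log_le_sub_one_of_pos (div_pos hsb hsa)
    rw [Real.log_div hsb.ne' hsa.ne', Real.log_sqrt hb, Real.log_sqrt ha] at h1
    have h2 := Real.sq_sqrt ha
    have h3 := Real.sq_sqrt hb
    rw [Real.negMulLog]
    have h4 : a * (√b / √a) = √a * √b := by
      field_simp
      rw [h2]
    nlinarith [mul_le_mul_of_nonneg_left h1 ha]

theorem frequently_increment_le {E : ℕ → ℝ} {c : ℝ} {k : ℕ}
    (hE : ∀ n : ℕ, 1 ≤ n → E n ≤ c + k * Real.log n) :
    ∃ᶠ n : ℕ in atTop, E (n + 1) - E n ≤ (k + 1) / n := by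
  by_contra hcon
  rw [not_frequently, eventually_atTop] at hcon
  obtain ⟨n0, hn0⟩ := hcon
  set n1 := n0 + 1
  have mono : ∀ j : ℕ, E n1 - (k + 1) * Real.log n1 ≤
      E (n1 + j) - (k + 1) * Real.log (n1 + j : ℕ) := by
    intro j
    induction j with
    | zero => simp
    | succ j ih =>
      refine ih.trans ?_
      have h1 := hn0 (n1 + j) (by omega)
      push Not at h1
      have hpos : (0 : ℝ) < (n1 + j : ℕ) := by positivity
      have h2 := Real.log_le_sub_one_of_pos (x := ((n1 + (j + 1) : ℕ) : ℝ) / (n1 + j : ℕ))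
        (by positivity)
      rw [Real.log_div (by positivity) hpos.ne'] at h2
      have h3 : ((n1 + (j + 1) : ℕ) : ℝ) / (n1 + j : ℕ) - 1 = 1 / (n1 + j : ℕ) := by
        field_simp
        push_cast
        ring
      rw [h3] at h2
      have h4 : ((k : ℝ) + 1) / (n1 + j : ℕ) = (k + 1) * (1 / (n1 + j : ℕ)) := by ring
      rw [h4] at h1
      have h5 : (0 : ℝ) ≤ (k : ℝ) + 1 := by positivity
      have h6 := mul_le_mul_of_nonneg_left h2 h5
      rw [← add_assoc] at h6 ⊢
      linarith
  have ht : Tendsto (fun j : ℕ => Real.log ((n1 + j : ℕ) : ℝ)) atTop atTop :=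
    Real.tendsto_log_atTop.comp (tendsto_natCast_atTop_atTop.comp
      (tendsto_atTop_mono (fun j => Nat.le_add_left j n1) tendsto_id))
  obtain ⟨j, hj⟩ := (ht.eventually_gt_atTop (c - (E n1 - (k + 1) * Real.log n1))).exists
  have h1 := mono j
  have h2 := hE (n1 + j) (by omega)
  linarith

namespace TransGraph

variable {X : Type*} {G : SimpleGraph X} [G.LocallyFinite] (h : TransGraph G)
include h

/-- Entropy of the `n`-step distribution. -/
noncomputable def entropy (o : X) (n : ℕ) : ℝ :=
  ∑ z ∈ h.ball o n, Real.negMulLog (heatKer G n o z)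

theorem entropy_eq_sum {o : X} {n : ℕ} {S : Finset X} (hS : h.ball o n ⊆ S) :
    h.entropy o n = ∑ z ∈ S, Real.negMulLog (heatKer G n o z) := by
  refine Finset.sum_subset hS fun z _ hz => ?_
  rw [h.heatKer_eq_zero (by simpa using hz), Real.negMulLog_zero]

theorem entropy_eq (o x : X) (n : ℕ) : h.entropy o n = h.entropy x n := by
  obtain ⟨φ, rfl⟩ := h.trans o x
  refine Finset.sum_bij (fun y _ => φ y) ?_ ?_ ?_ ?_
  · intro y hy; simpa [h.dist_iso] using hy
  · intro a _ b _ h; exact φ.injective h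
  · intro b hb
    refine ⟨φ.symm b, ?_, by simp⟩
    rw [mem_ball] at hb ⊢
    rw [← h.dist_iso φ]; simpa using hb
  · intro a _
    rw [heatKer_iso]

theorem entropy_le (o : X) (n : ℕ) : h.entropy o n ≤ Real.log (h.ball o n).card := by
  have hc : (0 : ℝ) < (h.ball o n).card := by
    exact_mod_cast Finset.card_pos.mpr ⟨o, by simp⟩
  set N := ((h.ball o n).card : ℝ) with hN
  have key : ∀ z ∈ h.ball o n, Real.negMulLog (heatKer G n o z) ≤
      heatKer G n o z * Real.log N + (1 / N - heatKer G n o z) := by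
    intro z _
    rcases (heatKer_nonneg (G := G) n o z).eq_or_lt with h0 | h0
    · rw [← h0]; simp [hc.le]
    · have h1 := Real.log_le_sub_one_of_pos (x := 1 / (N * heatKer G n o z)) (by positivity)
      rw [one_div, Real.log_inv, Real.log_mul hc.ne' h0.ne'] at h1
      have h2 := mul_le_mul_of_nonneg_left h1 h0.le
      rw [Real.negMulLog]
      have h3 : heatKer G n o z * ((N * heatKer G n o z)⁻¹ - 1) = 1 / N - heatKer G n o z := by
        field_simp
      rw [h3] at h2
      linarith
  refine (Finset.sum_le_sum key).trans ?_
  rw [Finset.sum_add_distrib, ← Finset.sum_mul, Finset.sum_sub_distrib,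
    h.sum_heatKer n o (le_refl _), Finset.sum_const, nsmul_eq_mul, ← hN]
  field_simp
  linarith

theorem hellinger_le_increment (n : ℕ) {x w : X} (hw : G.dist x w ≤ 1) (S : Finset X) :
    ∑ z ∈ S, (√(heatKer G n w z) - √(heatKer G (n + 1) x z)) ^ 2 ≤
      2 * G.degree x * (h.entropy x (n + 1) - h.entropy x n) := by
  classical
  set T := S ∪ h.ball x (n + 2) with hT
  set B := h.ball x 1 with hB
  set b := fun z => heatKer G (n + 1) x z with hb
  have hsub : ∀ w ∈ B, h.ball w n ⊆ T := by
    intro w hw z hz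
    refine Finset.mem_union_right _ ?_
    rw [mem_ball] at hz hw ⊢
    have := h.conn.dist_triangle (u := x) (v := w) (w := z)
    omega
  have hsubx : h.ball x (n + 1) ⊆ T := by
    intro z hz
    refine Finset.mem_union_right _ ?_
    rw [mem_ball] at hz ⊢
    omega
  have hbsum : ∀ z, b z = ∑ w ∈ B, heatKer G 1 x w * heatKer G n w z := by
    intro z
    rw [hb, add_comm n 1]
    exact h.heatKer_add 1 n x z (le_refl _)
  have hmass : ∑ w ∈ B, heatKer G 1 x w = 1 := h.sum_heatKer 1 x (le_refl _)
  have hb0 : ∀ z, 0 ≤ b z := fun z => heatKer_nonneg _ _ _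
  have hp1 : ∀ w ∈ B, 0 < heatKer G 1 x w := fun w hw =>
    lt_of_lt_of_le (by have := h.deg_pos x; positivity) (h.le_heatKer_one (by simpa [hB] using hw))
  have habs : ∀ w ∈ B, ∀ z, b z = 0 → heatKer G n w z = 0 := by
    intro w hw z hz
    rw [hbsum z, Finset.sum_eq_zero_iff_of_nonneg
      (fun w _ => mul_nonneg (heatKer_nonneg _ _ _) (heatKer_nonneg _ _ _))] at hz
    exact (mul_eq_zero.mp (hz w hw)).resolve_left (hp1 w hw).ne'
  have hinc : h.entropy x (n + 1) - h.entropy x n = ∑ w ∈ B, heatKer G 1 x w *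
      ∑ z ∈ T, (-Real.negMulLog (heatKer G n w z) - heatKer G n w z * Real.log (b z)) := by
    have e1 : ∀ w ∈ B, heatKer G 1 x w *
        ∑ z ∈ T, (-Real.negMulLog (heatKer G n w z) - heatKer G n w z * Real.log (b z)) =
        - (heatKer G 1 x w * h.entropy x n) -
          ∑ z ∈ T, heatKer G 1 x w * heatKer G n w z * Real.log (b z) := by
      intro w hw
      rw [Finset.sum_sub_distrib, Finset.sum_neg_distrib, ← h.entropy_eq_sum (hsub w hw),
        h.entropy_eq w x n, mul_sub, Finset.mul_sum]
      simp only [mul_assoc, mul_neg]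
    rw [Finset.sum_congr rfl e1, Finset.sum_sub_distrib, Finset.sum_neg_distrib,
      ← Finset.sum_mul, hmass, Finset.sum_comm, h.entropy_eq_sum hsubx]
    have e2 : ∀ z ∈ T, ∑ w ∈ B, heatKer G 1 x w * heatKer G n w z * Real.log (b z) =
        - Real.negMulLog (heatKer G (n + 1) x z) := by
      intro z _
      rw [← Finset.sum_mul, ← hbsum z, Real.negMulLog]
      ring
    rw [Finset.sum_congr rfl e2, Finset.sum_neg_distrib]
    ring
  have hlow : ∀ w ∈ B, ∑ z ∈ T, (√(heatKer G n w z) - √(b z)) ^ 2 ≤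
      ∑ z ∈ T, (-Real.negMulLog (heatKer G n w z) - heatKer G n w z * Real.log (b z)) := by
    intro w hw
    have := Finset.sum_le_sum (s := T) fun z _ =>
      hellinger_le_entropy (heatKer_nonneg (G := G) n w z) (hb0 z) (habs w hw z)
    rw [Finset.sum_sub_distrib, Finset.sum_add_distrib, h.sum_heatKer n w (hsub w hw),
      h.sum_heatKer (n + 1) x hsubx] at this
    linarith
  have hwB : w ∈ B := by simpa [hB] using hw
  have hstep : heatKer G 1 x w * ∑ z ∈ T, (√(heatKer G n w z) - √(b z)) ^ 2 ≤
      h.entropy x (n + 1) - h.entropy x n := by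
    rw [hinc]
    refine (mul_le_mul_of_nonneg_left (hlow w hwB) (hp1 w hwB).le).trans ?_
    refine Finset.single_le_sum (f := fun w => heatKer G 1 x w *
      ∑ z ∈ T, (-Real.negMulLog (heatKer G n w z) - heatKer G n w z * Real.log (b z)))
      (fun w hw => mul_nonneg (hp1 w hw).le ?_) hwB
    exact (Finset.sum_nonneg fun z _ => sq_nonneg _).trans (hlow w hw)
  have hST : ∑ z ∈ S, (√(heatKer G n w z) - √(b z)) ^ 2 ≤
      ∑ z ∈ T, (√(heatKer G n w z) - √(b z)) ^ 2 :=
    Finset.sum_le_sum_of_subset_of_nonneg Finset.subset_union_left fun _ _ _ => sq_nonneg _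
  have hD : (0 : ℝ) < G.degree x := by exact_mod_cast h.deg_pos x
  have hk := h.le_heatKer_one hw
  have h0 : 0 ≤ ∑ z ∈ T, (√(heatKer G n w z) - √(b z)) ^ 2 :=
    Finset.sum_nonneg fun z _ => sq_nonneg _
  have h2 := (mul_le_mul_of_nonneg_right hk h0).trans hstep
  rw [one_div, inv_mul_le_iff₀ (by positivity)] at h2
  exact hST.trans h2

/-- Polynomial growth of the balls. -/
def Growth (k : ℕ) : Prop :=
  ∃ c : ℝ, 0 < c ∧ ∀ (v : X) (r : ℕ), 1 ≤ r → ((h.ball v r).card : ℝ) ≤ c * (r : ℝ) ^ k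

theorem frequently_hellinger_le {k : ℕ} (hk : h.Growth k) : ∃ C : ℝ, 0 < C ∧
    ∃ᶠ n : ℕ in atTop, ∀ x y : X, G.Adj x y → ∀ S : Finset X,
      ∑ z ∈ S, (√(heatKer G n x z) - √(heatKer G n y z)) ^ 2 ≤ C / n := by
  obtain ⟨c, hc, hg⟩ := hk
  have := h.conn.nonempty
  obtain ⟨o⟩ := this
  have hD : (0 : ℝ) < G.degree o := by exact_mod_cast h.deg_pos o
  refine ⟨8 * G.degree o * (k + 1), by positivity, ?_⟩
  have hE := frequently_increment_le (E := h.entropy o) (c := Real.log c) (k := k) (by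
    intro n hn
    refine (h.entropy_le o n).trans ?_
    have h1 : (0 : ℝ) < (h.ball o n).card := by
      exact_mod_cast Finset.card_pos.mpr ⟨o, by simp⟩
    have h2 := Real.log_le_log h1 (hg o n hn)
    have hn' : (0 : ℝ) < n := by exact_mod_cast hn
    rwa [Real.log_mul hc.ne' (by positivity), Real.log_pow] at h2)
  refine hE.mono fun n hn x y hxy S => ?_
  have h1 := h.hellinger_le_increment n (x := x) (w := x) (by simp) S
  have h2 := h.hellinger_le_increment n (x := x) (w := y)
    (by rw [SimpleGraph.dist_eq_one_iff_adj.mpr hxy]) S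
  rw [h.entropy_eq x o, h.entropy_eq x o, h.degree_eq x o] at h1 h2
  have h3 : ∑ z ∈ S, (√(heatKer G n x z) - √(heatKer G n y z)) ^ 2 ≤
      ∑ z ∈ S, (2 * (√(heatKer G n x z) - √(heatKer G (n + 1) x z)) ^ 2 +
        2 * (√(heatKer G n y z) - √(heatKer G (n + 1) x z)) ^ 2) := by
    refine Finset.sum_le_sum fun z _ => ?_
    nlinarith [sq_nonneg ((√(heatKer G n x z) - √(heatKer G (n + 1) x z)) +
      (√(heatKer G n y z) - √(heatKer G (n + 1) x z)))]
  rw [Finset.sum_add_distrib, ← Finset.mul_sum, ← Finset.mul_sum] at h3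
  have h4 := mul_le_mul_of_nonneg_left hn (show (0 : ℝ) ≤ 8 * G.degree o by positivity)
  have h5 : 8 * (G.degree o : ℝ) * (k + 1) / n = 8 * G.degree o * ((k + 1) / n) := by ring
  rw [h5]
  linarith

end TransGraph

end PolyGrowth

namespace PolyGrowth

theorem exists_ultrafilter_of_frequently {p : ℕ → Prop} (hp : ∃ᶠ n in atTop, p n) :
    ∃ ω : Ultrafilter ℕ, (ω : Filter ℕ) ≤ atTop ∧ ∀ᶠ n in (ω : Filter ℕ), p n := by
  have : NeBot (atTop ⊓ 𝓟 {n | p n}) := by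
    rw [← frequently_mem_iff_neBot]
    exact hp
  refine ⟨Ultrafilter.of (atTop ⊓ 𝓟 {n | p n}), (Ultrafilter.of_le _).trans inf_le_left, ?_⟩
  exact (Ultrafilter.of_le _).trans inf_le_right (mem_principal_self _)

theorem exists_ultralimit (ω : Ultrafilter ℕ) {u : ℕ → ℝ} {M : ℝ} (hu : ∀ n, |u n| ≤ M) :
    ∃ l, Tendsto u ω (nhds l) := by
  have hc : IsCompact (Set.Icc (-M) M) := isCompact_Icc
  obtain ⟨l, _, hl⟩ := hc.ultrafilter_le_nhds (ω.map u) (by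
    rw [le_principal_iff]
    have : ∀ᶠ n in (ω : Filter ℕ), u n ∈ Set.Icc (-M) M :=
      Filter.Eventually.of_forall fun n => abs_le.mp (hu n)
    exact this)
  exact ⟨l, hl⟩

theorem tendsto_limUnder_ultra (ω : Ultrafilter ℕ) {u : ℕ → ℝ} {M : ℝ} (hu : ∀ n, |u n| ≤ M) :
    Tendsto u ω (nhds (limUnder (ω : Filter ℕ) u)) :=
  tendsto_nhds_limUnder (exists_ultralimit ω hu)

namespace TransGraph

variable {X : Type*} {G : SimpleGraph X} [G.LocallyFinite] (h : TransGraph G)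

/-- Harmonic functions for the lazy walk. -/
def Harm (G : SimpleGraph X) [G.LocallyFinite] (f : X → ℝ) : Prop := lazyWalk G f = f

/-- Functions whose increments along edges are at most `L`. -/
def Lip (G : SimpleGraph X) (L : ℝ) (f : X → ℝ) : Prop := ∀ x y, G.Adj x y → |f x - f y| ≤ L

theorem Harm.pow {f : X → ℝ} (hf : Harm G f) (n : ℕ) : (lazyWalk G ^ n) f = f := by
  induction n with
  | zero => simp
  | succ n ih => rw [lazyWalk_pow_succ, ih, hf]

include h

theorem abs_sub_le_dist {f : X → ℝ} {L : ℝ} (hf : Lip G L f) (x y : X) :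
    |f x - f y| ≤ L * G.dist x y := by
  obtain ⟨n, hn⟩ : ∃ n, G.dist x y = n := ⟨_, rfl⟩
  rw [hn]
  induction n generalizing x with
  | zero =>
    rw [h.conn.dist_eq_zero_iff] at hn
    simp [hn]
  | succ n ih =>
    obtain ⟨z, hz, hzn⟩ := h.exists_adj_of_dist_eq_succ hn
    have h1 := ih z hzn
    have h2 := hf x z hz
    have h3 := abs_sub_le (f x) (f z) (f y)
    push_cast
    linarith

theorem eq_of_adj_eq {f : X → ℝ} (hf : ∀ x y, G.Adj x y → f x = f y) (x y : X) : f x = f y := by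
  have := h.abs_sub_le_dist (f := f) (L := 0) (fun x y hxy => by simp [hf x y hxy]) x y
  rw [zero_mul] at this
  linarith [abs_nonpos_iff.mp this]

theorem sq_sub_le {f : X → ℝ} (hf : Harm G f) {n : ℕ} {δ : ℝ} {x y : X}
    (hδ : ∀ S : Finset X, ∑ z ∈ S, (√(heatKer G n x z) - √(heatKer G n y z)) ^ 2 ≤ δ) (c : ℝ) :
    (f x - f y) ^ 2 ≤ 2 * δ * ((lazyWalk G ^ n) (fun z => (f z - c) ^ 2) x +
      (lazyWalk G ^ n) (fun z => (f z - c) ^ 2) y) := by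
  classical
  set T := h.ball x n ∪ h.ball y n
  have hx : h.ball x n ⊆ T := Finset.subset_union_left
  have hy : h.ball y n ⊆ T := Finset.subset_union_right
  have e1 : f x - f y = ∑ z ∈ T, (√(heatKer G n x z) - √(heatKer G n y z)) *
      ((√(heatKer G n x z) + √(heatKer G n y z)) * (f z - c)) := by
    have a1 := h.lazyWalk_pow_eq_sum n x f hx
    have a2 := h.lazyWalk_pow_eq_sum n y f hy
    rw [hf.pow] at a1 a2
    have e : ∀ z ∈ T, (√(heatKer G n x z) - √(heatKer G n y z)) *
        ((√(heatKer G n x z) + √(heatKer G n y z)) * (f z - c)) =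
        heatKer G n x z * f z - heatKer G n y z * f z -
          (heatKer G n x z * c - heatKer G n y z * c) := by
      intro z _
      have s1 := Real.sq_sqrt (heatKer_nonneg (G := G) n x z)
      have s2 := Real.sq_sqrt (heatKer_nonneg (G := G) n y z)
      have : ∀ s t : ℝ, (s - t) * ((s + t) * (f z - c)) = (s ^ 2 - t ^ 2) * (f z - c) := by
        intros; ring
      rw [this, s1, s2]
      ring
    rw [Finset.sum_congr rfl e, Finset.sum_sub_distrib, Finset.sum_sub_distrib,
      Finset.sum_sub_distrib, ← Finset.sum_mul, ← Finset.sum_mul, h.sum_heatKer n x hx,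
      h.sum_heatKer n y hy, ← a1, ← a2]
    ring
  have hcs := Finset.sum_mul_sq_le_sq_mul_sq T
    (fun z => √(heatKer G n x z) - √(heatKer G n y z))
    (fun z => (√(heatKer G n x z) + √(heatKer G n y z)) * (f z - c))
  rw [← e1] at hcs
  have hb : ∑ z ∈ T, ((√(heatKer G n x z) + √(heatKer G n y z)) * (f z - c)) ^ 2 ≤
      2 * ((lazyWalk G ^ n) (fun z => (f z - c) ^ 2) x +
      (lazyWalk G ^ n) (fun z => (f z - c) ^ 2) y) := by
    rw [h.lazyWalk_pow_eq_sum n x _ hx, h.lazyWalk_pow_eq_sum n y _ hy, ← Finset.sum_add_distrib,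
      Finset.mul_sum]
    refine Finset.sum_le_sum fun z _ => ?_
    have s1 := Real.sq_sqrt (heatKer_nonneg (G := G) n x z)
    have s2 := Real.sq_sqrt (heatKer_nonneg (G := G) n y z)
    rw [mul_pow, ← add_mul, ← mul_assoc]
    refine mul_le_mul_of_nonneg_right ?_ (sq_nonneg _)
    nlinarith [sq_nonneg (√(heatKer G n x z) - √(heatKer G n y z))]
  have hδ0 : 0 ≤ δ := by simpa using hδ ∅
  calc (f x - f y) ^ 2 ≤ _ := hcs
    _ ≤ δ * (2 * ((lazyWalk G ^ n) (fun z => (f z - c) ^ 2) x +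
      (lazyWalk G ^ n) (fun z => (f z - c) ^ 2) y)) :=
        mul_le_mul (hδ T) hb (Finset.sum_nonneg fun _ _ => sq_nonneg _) hδ0
    _ = _ := by ring

theorem eq_of_harm_of_bounded {k : ℕ} (hk : h.Growth k) {f : X → ℝ} (hf : Harm G f) {M : ℝ}
    (hM : ∀ x, |f x| ≤ M) (x y : X) : f x = f y := by
  refine h.eq_of_adj_eq (fun x y hxy => ?_) x y
  obtain ⟨C, hC, hfr⟩ := h.frequently_hellinger_le hk
  have hM0 : 0 ≤ M := (abs_nonneg _).trans (hM x)
  have key : ∃ᶠ n : ℕ in atTop, (f x - f y) ^ 2 ≤ (4 * C * M ^ 2) / n := by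
    refine hfr.mono fun n hn => ?_
    have h1 := h.sq_sub_le hf (hn x y hxy) 0
    have h2 : ∀ w, (lazyWalk G ^ n) (fun z => (f z - 0) ^ 2) w ≤ M ^ 2 := fun w =>
      (le_abs_self _).trans (h.lazyWalk_pow_abs_le n (fun z => by
        rw [sub_zero, abs_pow]
        exact pow_le_pow_left₀ (abs_nonneg _) (hM z) 2) w)
    refine h1.trans ?_
    have h3 : (0 : ℝ) ≤ 2 * (C / n) := by positivity
    refine (mul_le_mul_of_nonneg_left (add_le_add (h2 x) (h2 y)) h3).trans (le_of_eq ?_)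
    ring
  have ht : Tendsto (fun n : ℕ => (4 * C * M ^ 2) / (n : ℝ)) atTop (nhds 0) :=
    tendsto_const_div_atTop_nhds_zero_nat _
  have h0 : (f x - f y) ^ 2 ≤ 0 := by
    by_contra hcon
    push Not at hcon
    exact key ((ht.eventually (gt_mem_nhds hcon)).mono fun n hn => not_le.mpr hn)
  have := pow_eq_zero_iff (two_ne_zero) |>.mp (le_antisymm h0 (sq_nonneg _))
  linarith

/-- The carré du champ of two functions. -/
noncomputable def energy (f g : X → ℝ) : X → ℝ :=
  let _ := h
  lazyWalk G (f * g) - f * g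

theorem energy_eq {f g : X → ℝ} (hf : Harm G f) (hg : Harm G g) (x : X) :
    h.energy f g x = ∑ y ∈ h.ball x 1, heatKer G 1 x y * ((f y - f x) * (g y - g x)) := by
  have a0 := h.lazyWalk_pow_eq_sum 1 x (f * g) (le_refl _)
  have a1 := h.lazyWalk_pow_eq_sum 1 x f (le_refl _)
  have a2 := h.lazyWalk_pow_eq_sum 1 x g (le_refl _)
  have a3 := h.sum_heatKer 1 x (le_refl _)
  rw [hf.pow] at a1
  rw [hg.pow] at a2
  rw [pow_one] at a0
  have e : ∀ y ∈ h.ball x 1, heatKer G 1 x y * ((f y - f x) * (g y - g x)) =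
      heatKer G 1 x y * (f * g) y - heatKer G 1 x y * f y * g x - heatKer G 1 x y * g y * f x +
        heatKer G 1 x y * (f x * g x) := by
    intro y _
    simp only [Pi.mul_apply]
    ring
  rw [Finset.sum_congr rfl e, Finset.sum_add_distrib, Finset.sum_sub_distrib,
    Finset.sum_sub_distrib, ← Finset.sum_mul, ← Finset.sum_mul, ← Finset.sum_mul, ← a0, ← a1, ← a2,
    a3]
  simp only [energy, Pi.sub_apply, Pi.mul_apply]
  ring

theorem Lip.abs_le_of_mem_ball {f : X → ℝ} {L : ℝ} (hL : 0 ≤ L) (hf : Lip G L f) {x y : X}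
    (hy : y ∈ h.ball x 1) : |f y - f x| ≤ L := by
  refine (h.abs_sub_le_dist hf y x).trans ?_
  rw [mem_ball, SimpleGraph.dist_comm] at hy
  have : (G.dist y x : ℝ) ≤ 1 := by exact_mod_cast hy
  nlinarith

theorem energy_abs_le {f g : X → ℝ} (hf : Harm G f) (hg : Harm G g) {L M : ℝ} (hL : 0 ≤ L)
    (hM : 0 ≤ M) (hfL : Lip G L f) (hgM : Lip G M g) (x : X) : |h.energy f g x| ≤ L * M := by
  rw [h.energy_eq hf hg]
  refine (Finset.abs_sum_le_sum_abs _ _).trans ?_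
  have : ∀ y ∈ h.ball x 1, |heatKer G 1 x y * ((f y - f x) * (g y - g x))| ≤
      heatKer G 1 x y * (L * M) := by
    intro y hy
    rw [abs_mul, abs_mul, abs_of_nonneg (heatKer_nonneg _ _ _)]
    exact mul_le_mul_of_nonneg_left (mul_le_mul (hfL.abs_le_of_mem_ball h hL hy)
      (hgM.abs_le_of_mem_ball h hM hy) (abs_nonneg _) hL) (heatKer_nonneg _ _ _)
  refine (Finset.sum_le_sum this).trans ?_
  rw [← Finset.sum_mul, h.sum_heatKer 1 x (le_refl _), one_mul]

/-- Sum of the expected energies over the first `n` steps. -/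
noncomputable def energySum (f g : X → ℝ) (n : ℕ) : X → ℝ :=
  ∑ k ∈ Finset.range n, (lazyWalk G ^ k) (h.energy f g)

theorem energySum_eq (f g : X → ℝ) (n : ℕ) :
    h.energySum f g n = (lazyWalk G ^ n) (f * g) - f * g := by
  rw [energySum]
  induction n with
  | zero => simp
  | succ n ih =>
    rw [Finset.sum_range_succ, ih, energy, map_sub, ← lazyWalk_pow_succ']
    abel

theorem pow_sq_sub_eq {f : X → ℝ} (hf : Harm G f) (n : ℕ) (c : ℝ) (x : X) :
    (lazyWalk G ^ n) (fun z => (f z - c) ^ 2) x = h.energySum f f n x + (f x - c) ^ 2 := by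
  have e : (fun z => (f z - c) ^ 2) = f * f - (2 * c) • f + c ^ 2 • 1 := by
    funext z
    simp only [Pi.add_apply, Pi.sub_apply, Pi.mul_apply, Pi.smul_apply, smul_eq_mul, Pi.one_apply]
    ring
  rw [e, map_add, map_sub, map_smul, map_smul, h.lazyWalk_pow_one, hf.pow, h.energySum_eq]
  simp only [Pi.add_apply, Pi.sub_apply, Pi.mul_apply, Pi.smul_apply, smul_eq_mul, Pi.one_apply]
  ring

theorem energySum_div_abs_le {f g : X → ℝ} (hf : Harm G f) (hg : Harm G g) {L M : ℝ} (hL : 0 ≤ L)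
    (hM : 0 ≤ M) (hfL : Lip G L f) (hgM : Lip G M g) (n : ℕ) (x : X) :
    |h.energySum f g n x / n| ≤ L * M := by
  rcases Nat.eq_zero_or_pos n with rfl | hn
  · simp; positivity
  have hn' : (0 : ℝ) < n := by exact_mod_cast hn
  rw [abs_div, abs_of_pos hn', div_le_iff₀ hn', energySum, Finset.sum_apply]
  refine (Finset.abs_sum_le_sum_abs _ _).trans ?_
  refine (Finset.sum_le_sum fun k _ => h.lazyWalk_pow_abs_le k
    (h.energy_abs_le hf hg hL hM hfL hgM) x).trans ?_
  rw [Finset.sum_const, Finset.card_range, nsmul_eq_mul, mul_comm]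

theorem mean_energy_eq {k : ℕ} (hk : h.Growth k) {ω : Ultrafilter ℕ} (hω : (ω : Filter ℕ) ≤ atTop)
    {f g : X → ℝ} (hf : Harm G f) (hg : Harm G g) {L M : ℝ} (hL : 0 ≤ L)
    (hM : 0 ≤ M) (hfL : Lip G L f) (hgM : Lip G M g) (x y : X) :
    limUnder (ω : Filter ℕ) (fun n => h.energySum f g n x / n) =
      limUnder (ω : Filter ℕ) (fun n => h.energySum f g n y / n) := by
  set m : X → ℝ := fun x => limUnder (ω : Filter ℕ) (fun n => h.energySum f g n x / n) with hm
  have hlim : ∀ x, Tendsto (fun n => h.energySum f g n x / n) ω (nhds (m x)) := fun x =>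
    tendsto_limUnder_ultra ω fun n => h.energySum_div_abs_le hf hg hL hM hfL hgM n x
  have hbd : ∀ x, |m x| ≤ L * M := fun x => by
    have := (hlim x).abs
    exact le_of_tendsto this (Filter.Eventually.of_forall fun n =>
      h.energySum_div_abs_le hf hg hL hM hfL hgM n x)
  have hharm : Harm G m := by
    funext x
    have l1 : Tendsto (fun n : ℕ => lazyWalk G (h.energySum f g n) x / n) ω
        (nhds (lazyWalk G m x)) := by
      have s : ∀ u : X → ℝ, lazyWalk G u x = ∑ y ∈ h.ball x 1, heatKer G 1 x y * u y := by
        intro u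
        have := h.lazyWalk_pow_eq_sum 1 x u (le_refl _)
        rwa [pow_one] at this
      simp only [s, Finset.sum_div, mul_div_assoc]
      exact tendsto_finsetSum _ fun y _ => (hlim y).const_mul _
    have l2 : Tendsto (fun n : ℕ => lazyWalk G (h.energySum f g n) x / n -
        h.energySum f g n x / n) ω (nhds 0) := by
      have e : ∀ n : ℕ, lazyWalk G (h.energySum f g n) x / n - h.energySum f g n x / n =
          ((lazyWalk G ^ n) (h.energy f g) x - h.energy f g x) / n := by
        intro n
        rw [← sub_div]
        congr 1
        rw [energySum_eq, map_sub, ← lazyWalk_pow_succ, energy, map_sub, ← lazyWalk_pow_succ']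
        simp only [Pi.sub_apply]
        ring
      simp only [e]
      refine Tendsto.mono_left ?_ hω
      have hC := tendsto_const_div_atTop_nhds_zero_nat (𝕜 := ℝ) (2 * (L * M))
      refine squeeze_zero_norm (fun n => ?_) hC
      rw [Real.norm_eq_abs, abs_div, abs_of_nonneg (a := (n : ℝ)) (by positivity)]
      gcongr
      have b0 := h.energy_abs_le hf hg hL hM hfL hgM
      have b1 := h.lazyWalk_pow_abs_le n b0 x
      have b2 := abs_sub ((lazyWalk G ^ n) (h.energy f g) x) (h.energy f g x)
      linarith [b0 x]
    have l3 := l1.sub (hlim x)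
    have := tendsto_nhds_unique l2 l3
    linarith
  exact h.eq_of_harm_of_bounded hk hharm hbd x y

end TransGraph

end PolyGrowth

namespace PolyGrowth

theorem exists_orthonormal_family {V : Type*} [AddCommGroup V] [Module ℝ V]
    (B : LinearMap.BilinForm ℝ V) (hs : ∀ x y, B x y = B y x) (hpos : ∀ x, x ≠ 0 → 0 < B x x)
    {s : Finset V} (hli : LinearIndependent ℝ (fun i : s => (i : V))) :
    ∃ v : Fin s.card → V, ∀ i j, B (v i) (v j) = if i = j then 1 else 0 := by
  classical
  let W := Submodule.span ℝ (s : Set V)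
  have hW : Module.finrank ℝ W = s.card := finrank_span_finset_eq_card hli
  have : FiniteDimensional ℝ W := FiniteDimensional.span_finset ℝ s
  let B' : LinearMap.BilinForm ℝ W := B.restrict W
  obtain ⟨v, hv⟩ := LinearMap.BilinForm.exists_orthogonal_basis (B := B')
    ⟨fun x y => by simpa [B'] using hs x y⟩
  have hvpos : ∀ i, 0 < B (v i) (v i) := fun i => hpos _ (by
    have := v.ne_zero i
    simpa using this)
  refine ⟨fun i => (√(B (v (Fin.cast hW.symm i)) (v (Fin.cast hW.symm i))))⁻¹ •
    (v (Fin.cast hW.symm i) : V), fun i j => ?_⟩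
  simp only [map_smul, LinearMap.smul_apply, smul_eq_mul]
  split_ifs with hij
  · subst hij
    set a := B (v (Fin.cast hW.symm i)) (v (Fin.cast hW.symm i)) with ha
    have h1 : 0 < a := hvpos _
    have h2 : 0 < √a := Real.sqrt_pos.mpr h1
    field_simp
    rw [Real.sq_sqrt h1.le]
  · have := hv (i := Fin.cast hW.symm i) (j := Fin.cast hW.symm j) (by simpa using hij)
    have h0 : B (v (Fin.cast hW.symm i)) (v (Fin.cast hW.symm j)) = 0 := by
      simpa [B', Function.onFun] using this
    rw [h0]
    simp

theorem sum_sq_le_of_orthonormal {V : Type*} [AddCommGroup V] [Module ℝ V]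
    (B : LinearMap.BilinForm ℝ V) {n : ℕ} {v : Fin n → V}
    (hv : ∀ i j, B (v i) (v j) = if i = j then 1 else 0) (l : V →ₗ[ℝ] ℝ) {C : ℝ}
    (hC : 0 ≤ C) (hl : ∀ f, l f ^ 2 ≤ C * B f f) : ∑ i, l (v i) ^ 2 ≤ C := by
  set f := ∑ i, l (v i) • v i
  have h1 : l f = ∑ i, l (v i) ^ 2 := by
    simp only [f, map_sum, map_smul, smul_eq_mul, sq]
  have h2 : B f f = ∑ i, l (v i) ^ 2 := by
    simp only [f, map_sum, map_smul, LinearMap.sum_apply, LinearMap.smul_apply, hv, smul_eq_mul]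
    simp [sq]
  have h3 := hl f
  rw [h1, h2] at h3
  have h4 : 0 ≤ ∑ i, l (v i) ^ 2 := Finset.sum_nonneg fun i _ => sq_nonneg _
  rcases h4.eq_or_lt with h5 | h5
  · rwa [← h5]
  · nlinarith

namespace TransGraph

variable {X : Type*} {G : SimpleGraph X} [G.LocallyFinite] (h : TransGraph G)

omit [G.LocallyFinite] in
theorem Lip.add {f g : X → ℝ} {L M : ℝ} (hf : Lip G L f) (hg : Lip G M g) :
    Lip G (L + M) (f + g) := fun x y hxy => by
  have := abs_add_le (f x - f y) (g x - g y)
  have e : (f + g) x - (f + g) y = (f x - f y) + (g x - g y) := by simp only [Pi.add_apply]; ring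
  rw [e]
  linarith [hf x y hxy, hg x y hxy]

omit [G.LocallyFinite] in
theorem Lip.smul {f : X → ℝ} {L : ℝ} (hf : Lip G L f) (c : ℝ) : Lip G (|c| * L) (c • f) :=
  fun x y hxy => by
    simp only [Pi.smul_apply, smul_eq_mul]
    rw [← mul_sub, abs_mul]
    exact mul_le_mul_of_nonneg_left (hf x y hxy) (abs_nonneg c)

/-- Lipschitz harmonic functions vanishing at `o`. -/
def lhf (G : SimpleGraph X) [G.LocallyFinite] (o : X) : Submodule ℝ (X → ℝ) where
  carrier := {f | Harm G f ∧ (∃ L, 0 ≤ L ∧ Lip G L f) ∧ f o = 0}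
  zero_mem' := ⟨map_zero _, ⟨0, le_rfl, fun x y _ => by simp⟩, rfl⟩
  add_mem' := by
    rintro f g ⟨hf, ⟨L, hL, hfL⟩, hf0⟩ ⟨hg, ⟨M, hM, hgM⟩, hg0⟩
    exact ⟨by rw [Harm, map_add, hf, hg], ⟨L + M, by positivity, hfL.add hgM⟩, by
      rw [Pi.add_apply, hf0, hg0, add_zero]⟩
  smul_mem' := by
    rintro c f ⟨hf, ⟨L, hL, hfL⟩, hf0⟩
    exact ⟨by rw [Harm, map_smul, hf], ⟨|c| * L, by positivity, hfL.smul c⟩, by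
      rw [Pi.smul_apply, hf0, smul_zero]⟩

include h

theorem energySum_abs_le (o : X) (f g : lhf G o) : ∃ M, ∀ n, |h.energySum f g n o / n| ≤ M := by
  obtain ⟨hf, ⟨L, hL, hfL⟩, -⟩ := f.2
  obtain ⟨hg, ⟨M, hM, hgM⟩, -⟩ := g.2
  exact ⟨L * M, fun n => h.energySum_div_abs_le hf hg hL hM hfL hgM n o⟩

theorem tendsto_energySum (ω : Ultrafilter ℕ) (o : X) (f g : lhf G o) :
    Tendsto (fun n : ℕ => h.energySum f g n o / n) ω
      (nhds (limUnder (ω : Filter ℕ) (fun n : ℕ => h.energySum f g n o / n))) := by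
  obtain ⟨M, hM⟩ := h.energySum_abs_le o f g
  exact tendsto_limUnder_ultra ω hM

/-- The asymptotic mean energy form on Lipschitz harmonic functions. -/
noncomputable def meanForm (ω : Ultrafilter ℕ) (o : X) : LinearMap.BilinForm ℝ (lhf G o) :=
  LinearMap.mk₂ ℝ (fun f g => limUnder (ω : Filter ℕ) (fun n : ℕ => h.energySum f g n o / n))
    (fun f f' g => by
      refine Tendsto.limUnder_eq (((h.tendsto_energySum ω o f g).add
        (h.tendsto_energySum ω o f' g)).congr fun n => ?_)
      simp only [energySum_eq, Submodule.coe_add, add_mul, map_add, Pi.sub_apply, Pi.add_apply]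
      ring)
    (fun c f g => by
      refine Tendsto.limUnder_eq (((h.tendsto_energySum ω o f g).const_mul c).congr fun n => ?_)
      simp only [energySum_eq, Submodule.coe_smul, smul_mul_assoc, map_smul, Pi.sub_apply,
        Pi.smul_apply, smul_eq_mul]
      ring)
    (fun f g g' => by
      refine Tendsto.limUnder_eq (((h.tendsto_energySum ω o f g).add
        (h.tendsto_energySum ω o f g')).congr fun n => ?_)
      simp only [energySum_eq, Submodule.coe_add, mul_add, map_add, Pi.sub_apply, Pi.add_apply]
      ring)
    (fun c f g => by
      refine Tendsto.limUnder_eq (((h.tendsto_energySum ω o f g).const_mul c).congr fun n => ?_)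
      simp only [energySum_eq, Submodule.coe_smul, mul_smul_comm, map_smul, Pi.sub_apply,
        Pi.smul_apply, smul_eq_mul]
      ring)

theorem meanForm_apply (ω : Ultrafilter ℕ) (o : X) (f g : lhf G o) :
    h.meanForm ω o f g = limUnder (ω : Filter ℕ) (fun n : ℕ => h.energySum f g n o / n) := rfl

theorem meanForm_symm (ω : Ultrafilter ℕ) (o : X) (f g : lhf G o) :
    h.meanForm ω o f g = h.meanForm ω o g f := by
  simp only [meanForm_apply, energySum_eq, mul_comm]

theorem exists_sq_le_meanForm {k : ℕ} (hk : h.Growth k) (o : X) :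
    ∃ (ω : Ultrafilter ℕ) (C : ℝ), (ω : Filter ℕ) ≤ atTop ∧ 0 < C ∧
      ∀ (f : lhf G o) (x y : X), G.Adj x y →
        ((f : X → ℝ) y - (f : X → ℝ) x) ^ 2 ≤ C * h.meanForm ω o f f := by
  obtain ⟨C, hC, hfr⟩ := h.frequently_hellinger_le hk
  obtain ⟨ω, hω, hgood⟩ := exists_ultrafilter_of_frequently hfr
  refine ⟨ω, 4 * C, hω, by positivity, fun f x y hxy => ?_⟩
  obtain ⟨hf, ⟨L, hL, hfL⟩, -⟩ := f.2
  have hx : Tendsto (fun n : ℕ => h.energySum f f n x / n) ω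
      (nhds (h.meanForm ω o f f)) := by
    rw [meanForm_apply, h.mean_energy_eq hk hω hf hf hL hL hfL hfL o x]
    exact tendsto_limUnder_ultra ω fun n => h.energySum_div_abs_le hf hf hL hL hfL hfL n x
  have hy : Tendsto (fun n : ℕ => h.energySum f f n y / n) ω
      (nhds (h.meanForm ω o f f)) := by
    rw [meanForm_apply, h.mean_energy_eq hk hω hf hf hL hL hfL hfL o y]
    exact tendsto_limUnder_ultra ω fun n => h.energySum_div_abs_le hf hf hL hL hfL hfL n y
  have hz : Tendsto (fun n : ℕ => L ^ 2 / (n : ℝ)) ω (nhds 0) :=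
    (tendsto_const_div_atTop_nhds_zero_nat (L ^ 2)).mono_left hω
  have hlim := ((hx.add hy).add hz).const_mul (2 * C)
  have e : 2 * C * (h.meanForm ω o f f + h.meanForm ω o f f + 0) =
    4 * C * h.meanForm ω o f f := by ring
  rw [e] at hlim
  refine ge_of_tendsto hlim (hgood.mono fun n hn => ?_)
  have h1 := h.sq_sub_le hf (hn x y hxy) ((f : X → ℝ) x)
  rw [h.pow_sq_sub_eq hf, h.pow_sq_sub_eq hf] at h1
  have h2 : ((f : X → ℝ) y - (f : X → ℝ) x) ^ 2 ≤ L ^ 2 := by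
    rw [← sq_abs, abs_sub_comm]
    exact pow_le_pow_left₀ (abs_nonneg _) (hfL x y hxy) 2
  have e1 : ((f : X → ℝ) y - (f : X → ℝ) x) ^ 2 = ((f : X → ℝ) x - (f : X → ℝ) y) ^ 2 := by ring
  have hCn : 0 ≤ 2 * (C / (n : ℝ)) := by positivity
  rw [e1]
  refine h1.trans ?_
  have e2 : 2 * C * (h.energySum f f n x / n + h.energySum f f n y / n + L ^ 2 / n) =
    2 * (C / n) * (h.energySum f f n x + h.energySum f f n y + L ^ 2) := by ring
  rw [e2]
  refine mul_le_mul_of_nonneg_left ?_ hCn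
  rw [sub_self]
  linarith

theorem finite_lhf {k : ℕ} (hk : h.Growth k) (o : X) : Module.Finite ℝ (lhf G o) := by
  obtain ⟨ω, C, hω, hC, hle⟩ := h.exists_sq_le_meanForm hk o
  have hpos : ∀ f : lhf G o, f ≠ 0 → 0 < h.meanForm ω o f f := by
    intro f hf
    by_contra hcon
    push Not at hcon
    apply hf
    have hadj : ∀ x y, G.Adj x y → (f : X → ℝ) x = (f : X → ℝ) y := by
      intro x y hxy
      have h1 := hle f x y hxy
      have h2 : ((f : X → ℝ) y - (f : X → ℝ) x) ^ 2 ≤ 0 := h1.trans (by nlinarith)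
      have h3 := pow_eq_zero_iff (two_ne_zero) |>.mp (le_antisymm h2 (sq_nonneg _))
      linarith
    ext x
    rw [h.eq_of_adj_eq hadj x o, f.2.2.2]
    rfl
  have hcard : ∀ s : Finset (lhf G o), LinearIndependent ℝ (fun i : s => (i : lhf G o)) →
      s.card ≤ ⌈C⌉₊ := by
    intro s hs
    obtain ⟨v, hv⟩ := exists_orthonormal_family (h.meanForm ω o) (h.meanForm_symm ω o) hpos hs
    have hdiff : ∀ x, ∀ y ∈ h.ball x 1,
        ∑ i, ((v i : X → ℝ) y - (v i : X → ℝ) x) ^ 2 ≤ C := by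
      intro x y hy
      rw [mem_ball] at hy
      rcases Nat.le_one_iff_eq_zero_or_eq_one.mp hy with h0 | h0
      · rw [h.conn.dist_eq_zero_iff] at h0
        subst h0
        simpa using hC.le
      · let l : lhf G o →ₗ[ℝ] ℝ :=
          ((LinearMap.proj (R := ℝ) (φ := fun _ : X => ℝ) y) -
            LinearMap.proj (R := ℝ) (φ := fun _ : X => ℝ) x).comp (lhf G o).subtype
        exact sum_sq_le_of_orthonormal (h.meanForm ω o) hv l hC.le
          (fun f => hle f x y (SimpleGraph.dist_eq_one_iff_adj.mp h0))
    have hen : ∀ x, ∑ i, h.energy (v i) (v i) x ≤ C := by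
      intro x
      have e : ∀ i ∈ Finset.univ, h.energy (v i) (v i) x = _ := fun i _ =>
        h.energy_eq (v i).2.1 (v i).2.1 x
      rw [Finset.sum_congr rfl e, Finset.sum_comm]
      have e2 : ∀ y ∈ h.ball x 1, ∑ i, heatKer G 1 x y *
          (((v i : X → ℝ) y - (v i : X → ℝ) x) * ((v i : X → ℝ) y - (v i : X → ℝ) x)) ≤
          heatKer G 1 x y * C := by
        intro y hy
        rw [← Finset.mul_sum]
        refine mul_le_mul_of_nonneg_left ?_ (heatKer_nonneg _ _ _)
        simpa [sq] using hdiff x y hy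
      refine (Finset.sum_le_sum e2).trans ?_
      rw [← Finset.sum_mul, h.sum_heatKer 1 x (le_refl _), one_mul]
    have hsum : ∀ n : ℕ, ∑ i, h.energySum (v i) (v i) n o / n ≤ C := by
      intro n
      rcases Nat.eq_zero_or_pos n with rfl | hn
      · simpa using hC.le
      have hn' : (0 : ℝ) < n := by exact_mod_cast hn
      rw [← Finset.sum_div, div_le_iff₀ hn']
      simp only [energySum, Finset.sum_apply]
      rw [Finset.sum_comm]
      have e3 : ∀ k ∈ Finset.range n,
          ∑ i, (lazyWalk G ^ k) (h.energy (v i) (v i)) o ≤ C := by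
        intro k _
        have := lazyWalk_pow_mono (G := G) k (f := ∑ i, h.energy (v i) (v i)) (g := C • 1)
          (fun x => by simpa using hen x) o
        rw [map_sum, map_smul, h.lazyWalk_pow_one] at this
        simpa using this
      refine (Finset.sum_le_sum e3).trans ?_
      rw [Finset.sum_const, Finset.card_range, nsmul_eq_mul, mul_comm]
    have hlim : Tendsto (fun n : ℕ => ∑ i, h.energySum (v i) (v i) n o / n) ω
        (nhds (∑ i, h.meanForm ω o (v i) (v i))) :=
      tendsto_finsetSum _ fun i _ => h.tendsto_energySum ω o (v i) (v i)
    have := le_of_tendsto hlim (Filter.Eventually.of_forall hsum)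
    simp only [hv, if_true, Finset.sum_const, Finset.card_univ, Fintype.card_fin, nsmul_eq_mul,
      mul_one] at this
    exact_mod_cast this.trans (Nat.le_ceil C)
  rw [← Module.rank_lt_aleph0_iff]
  exact (rank_le hcard).trans_lt Cardinal.natCast_lt_aleph0

end TransGraph

end PolyGrowth

namespace PolyGrowth

namespace TransGraph

variable {X : Type*} {G : SimpleGraph X} [G.LocallyFinite] (h : TransGraph G)
include h

theorem heatKer_pos {n : ℕ} {x y : X} (hxy : G.dist x y ≤ n) : 0 < heatKer G n x y := by
  classical
  have hp1 : ∀ {x y : X}, G.dist x y ≤ 1 → 0 < heatKer G 1 x y := by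
    intro x y hxy
    have hd : (0 : ℝ) < G.degree x := by exact_mod_cast h.deg_pos x
    exact lt_of_lt_of_le (by positivity) (h.le_heatKer_one hxy)
  induction n generalizing x with
  | zero =>
    have : x = y := (h.conn.dist_eq_zero_iff).mp (Nat.le_zero.mp hxy)
    subst this
    simp [heatKer]
  | succ n ih =>
    rw [add_comm, h.heatKer_add 1 n x y (le_refl _)]
    obtain ⟨w, hw, hwy⟩ : ∃ w, G.dist x w ≤ 1 ∧ G.dist w y ≤ n := by
      rcases hxy.lt_or_eq with h1 | h1
      · exact ⟨x, by simp, by omega⟩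
      · obtain ⟨z, hz, hz'⟩ := h.exists_adj_of_dist_eq_succ h1
        exact ⟨z, (SimpleGraph.dist_eq_one_iff_adj.mpr hz).le, hz'.le⟩
    refine Finset.sum_pos' (fun z _ => mul_nonneg (heatKer_nonneg _ _ _) (heatKer_nonneg _ _ _))
      ⟨w, by simpa using hw, mul_pos (hp1 hw) (ih hwy)⟩

theorem sum_heatKer_mul (m n : ℕ) (x y : X) {S : Finset X} (hS : h.ball x m ⊆ S) :
    ∑ z ∈ S, heatKer G m x z * heatKer G n y z = heatKer G (m + n) x y := by
  rw [h.heatKer_add m n x y hS]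
  exact Finset.sum_congr rfl fun z _ => by rw [h.heatKer_symm n y z]

/-- The Cauchy-Schwarz inequality for differences of transition probabilities. -/
theorem heatKer_cauchy_schwarz (m n k : ℕ) (x x' y y' : X) :
    (heatKer G (m + k) x y - heatKer G (m + k) x y' - heatKer G (n + k) x' y +
      heatKer G (n + k) x' y') ^ 2 ≤
    (heatKer G (m + m) x x - 2 * heatKer G (m + n) x x' + heatKer G (n + n) x' x') *
    (heatKer G (k + k) y y - 2 * heatKer G (k + k) y y' + heatKer G (k + k) y' y') := by
  classical
  set S := h.ball x m ∪ h.ball x' n ∪ h.ball y k ∪ h.ball y' k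
  have s1 : h.ball x m ⊆ S := fun z hz => by simp only [S, Finset.mem_union]; tauto
  have s2 : h.ball x' n ⊆ S := fun z hz => by simp only [S, Finset.mem_union]; tauto
  have s3 : h.ball y k ⊆ S := fun z hz => by simp only [S, Finset.mem_union]; tauto
  have s4 : h.ball y' k ⊆ S := fun z hz => by simp only [S, Finset.mem_union]; tauto
  have hcs := Finset.sum_mul_sq_le_sq_mul_sq S
    (fun z => heatKer G m x z - heatKer G n x' z) (fun z => heatKer G k y z - heatKer G k y' z)
  have e1 : ∑ z ∈ S, (heatKer G m x z - heatKer G n x' z) * (heatKer G k y z - heatKer G k y' z) =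
      heatKer G (m + k) x y - heatKer G (m + k) x y' - heatKer G (n + k) x' y +
      heatKer G (n + k) x' y' := by
    rw [← h.sum_heatKer_mul m k x y s1, ← h.sum_heatKer_mul m k x y' s1,
      ← h.sum_heatKer_mul n k x' y s2, ← h.sum_heatKer_mul n k x' y' s2,
      ← Finset.sum_sub_distrib, ← Finset.sum_sub_distrib, ← Finset.sum_add_distrib]
    exact Finset.sum_congr rfl fun z _ => by ring
  have e2 : ∑ z ∈ S, (heatKer G m x z - heatKer G n x' z) ^ 2 =
      heatKer G (m + m) x x - 2 * heatKer G (m + n) x x' + heatKer G (n + n) x' x' := by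
    rw [← h.sum_heatKer_mul m m x x s1, ← h.sum_heatKer_mul m n x x' s1,
      ← h.sum_heatKer_mul n n x' x' s2, Finset.mul_sum,
      ← Finset.sum_sub_distrib, ← Finset.sum_add_distrib]
    exact Finset.sum_congr rfl fun z _ => by ring
  have e3 : ∑ z ∈ S, (heatKer G k y z - heatKer G k y' z) ^ 2 =
      heatKer G (k + k) y y - 2 * heatKer G (k + k) y y' + heatKer G (k + k) y' y' := by
    rw [← h.sum_heatKer_mul k k y y s3, ← h.sum_heatKer_mul k k y y' s3,
      ← h.sum_heatKer_mul k k y' y' s4, Finset.mul_sum,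
      ← Finset.sum_sub_distrib, ← Finset.sum_add_distrib]
    exact Finset.sum_congr rfl fun z _ => by ring
  rw [e1, e2, e3] at hcs
  exact hcs

theorem heatKer_sq_diff_nonneg (m n : ℕ) (x x' : X) :
    0 ≤ heatKer G (m + m) x x - 2 * heatKer G (m + n) x x' + heatKer G (n + n) x' x' := by
  classical
  set S := h.ball x m ∪ h.ball x' n
  have s1 : h.ball x m ⊆ S := Finset.subset_union_left
  have s2 : h.ball x' n ⊆ S := Finset.subset_union_right
  rw [← h.sum_heatKer_mul m m x x s1, ← h.sum_heatKer_mul m n x x' s1,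
      ← h.sum_heatKer_mul n n x' x' s2, Finset.mul_sum,
      ← Finset.sum_sub_distrib, ← Finset.sum_add_distrib]
  refine Finset.sum_nonneg fun z _ => ?_
  nlinarith [sq_nonneg (heatKer G m x z - heatKer G n x' z)]

theorem heatKer_le_self (m : ℕ) (o x y : X) : heatKer G (m + m) x y ≤ heatKer G (m + m) o o := by
  have := h.heatKer_sq_diff_nonneg m m x y
  rw [h.heatKer_self _ x o, h.heatKer_self _ y o] at this
  linarith

theorem return_sub_eq (m r : ℕ) (o x : X) :
    heatKer G (m + m) o o - heatKer G (r + (m + m)) o o = ∑ y ∈ h.ball x r,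
      heatKer G r x y * (heatKer G (m + m) o o - heatKer G (m + m) y x) := by
  simp only [mul_sub]
  rw [Finset.sum_sub_distrib, ← Finset.sum_mul, h.sum_heatKer r x (le_refl _), one_mul,
    ← h.heatKer_add r (m + m) x x (le_refl _), h.heatKer_self (r + (m + m)) x o]

theorem return_sub_ge (m r : ℕ) (o x y : X) (hy : G.dist x y ≤ r) :
    heatKer G r x y * (heatKer G (m + m) o o - heatKer G (m + m) y x) ≤
      heatKer G (m + m) o o - heatKer G (r + (m + m)) o o := by
  rw [h.return_sub_eq m r o x]
  exact Finset.single_le_sum (f := fun y => heatKer G r x y *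
    (heatKer G (m + m) o o - heatKer G (m + m) y x)) (fun z _ => mul_nonneg (heatKer_nonneg _ _ _)
    (by linarith [h.heatKer_le_self m o z x])) (by simpa using hy)

theorem return_antitone (o : X) : Antitone fun m => heatKer G (m + m) o o := by
  refine antitone_nat_of_succ_le fun m => ?_
  have := h.return_sub_ge m 2 o o o (by simp)
  rw [sub_self, mul_zero] at this
  have e : m + 1 + (m + 1) = 2 + (m + m) := by ring
  rw [e]
  linarith

theorem return_tendsto_zero [Infinite X] (o : X) :
    Tendsto (fun m => heatKer G (m + m) o o) atTop (nhds 0) := by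
  have hbdd : BddBelow (Set.range fun m => heatKer G (m + m) o o) :=
    ⟨0, by rintro _ ⟨m, rfl⟩; exact heatKer_nonneg _ _ _⟩
  have hlim := tendsto_atTop_ciInf (h.return_antitone o) hbdd
  set α := ⨅ m, heatKer G (m + m) o o
  have hα0 : 0 ≤ α := le_ciInf fun m => heatKer_nonneg _ _ _
  have hy : ∀ y, Tendsto (fun m => heatKer G (m + m) o y) atTop (nhds α) := by
    intro y
    set r := G.dist o y with hr
    have hpos : 0 < heatKer G (r + r) o y := h.heatKer_pos (by omega)
    have hshift : Tendsto (fun m => heatKer G (r + r + (m + m)) o o) atTop (nhds α) := by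
      have := hlim.comp (tendsto_add_atTop_nat r)
      refine this.congr fun m => ?_
      simp only [Function.comp_apply]
      congr 1
      ring
    have h0 := ((hlim.sub hshift).div_const (heatKer G (r + r) o y))
    rw [sub_self, zero_div] at h0
    have h1 : Tendsto (fun m => heatKer G (m + m) o o - heatKer G (m + m) o y) atTop (nhds 0) := by
      refine squeeze_zero (fun m => by linarith [h.heatKer_le_self m o o y]) (fun m => ?_) h0
      rw [le_div_iff₀ hpos, mul_comm, h.heatKer_symm (m + m) o y]
      exact h.return_sub_ge m (r + r) o o y (by omega)
    simpa using hlim.sub h1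
  have hle : ∀ S : Finset X, S.card * α ≤ 1 := by
    intro S
    have : Tendsto (fun m => ∑ y ∈ S, heatKer G (m + m) o y) atTop (nhds (∑ y ∈ S, α)) :=
      tendsto_finsetSum _ fun y _ => hy y
    rw [Finset.sum_const, nsmul_eq_mul] at this
    exact le_of_tendsto this (Filter.Eventually.of_forall fun m => h.sum_heatKer_le _ o S)
  have : α = 0 := by
    by_contra hne
    have hpos : 0 < α := lt_of_le_of_ne hα0 (Ne.symm hne)
    obtain ⟨N, hN⟩ := exists_nat_gt (1 / α)
    obtain ⟨S, hS⟩ := Infinite.exists_subset_card_eq X N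
    have := hle S
    rw [hS] at this
    rw [div_lt_iff₀ hpos] at hN
    linarith
  rwa [this] at hlim

theorem return_ge (o : X) (m : ℕ) : 1 ≤ (h.ball o m).card * heatKer G (m + m) o o := by
  have h1 := Finset.sum_mul_sq_le_sq_mul_sq (h.ball o m) (fun _ => (1 : ℝ)) (heatKer G m o)
  simp only [one_mul, one_pow, Finset.sum_const, nsmul_eq_mul, mul_one] at h1
  rw [h.sum_heatKer m o (le_refl _), one_pow] at h1
  rw [← h.sum_heatKer_mul m m o o (le_refl _)]
  simpa [sq] using h1

/-- The decrement of the return probability at time `2 * m`. -/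
noncomputable def decr (o : X) (m : ℕ) : ℝ :=
  let _ := h
  heatKer G (m + m) o o - heatKer G (2 + (m + m)) o o

theorem decr_nonneg (o : X) (m : ℕ) : 0 ≤ h.decr o m := by
  have := h.return_sub_ge m 2 o o o (by simp)
  rw [sub_self, mul_zero] at this
  exact this

theorem decr_sub (o : X) (m : ℕ) : h.decr o m - h.decr o (m + 1) =
    heatKer G (m + m) o o - 2 * heatKer G (m + (m + 2)) o o +
      heatKer G ((m + 2) + (m + 2)) o o := by
  have e1 : m + (m + 2) = 2 + (m + m) := by ring
  have e2 : m + 1 + (m + 1) = 2 + (m + m) := by ring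
  have e3 : m + 2 + (m + 2) = 2 + (2 + (m + m)) := by ring
  rw [decr, decr, e1, e2, e3]
  ring

theorem exists_decr_small [Infinite X] {k : ℕ} (hk : h.Growth k) (o : X) {ε : ℝ} (hε : 0 < ε)
    (hε1 : ε < 1) : ∃ m, 0 < h.decr o m ∧ h.decr o m - h.decr o (m + 1) ≤ ε * h.decr o m := by
  by_contra hcon
  push Not at hcon
  have hstep : ∀ m, h.decr o (m + 1) ≤ (1 - ε) * h.decr o m := by
    intro m
    rcases (h.decr_nonneg o m).eq_or_lt with h0 | h0
    · have h1 := h.heatKer_sq_diff_nonneg m (m + 2) o o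
      rw [← h.decr_sub, ← h0] at h1
      rw [← h0]
      linarith
    · linarith [hcon m h0]
  have hexp : ∀ j m, h.decr o (m + j) ≤ (1 - ε) ^ j * h.decr o m := by
    intro j m
    induction j with
    | zero => simp
    | succ j ih =>
      rw [← add_assoc, pow_succ']
      refine (hstep _).trans ?_
      rw [mul_assoc]
      exact mul_le_mul_of_nonneg_left ih (by linarith)
  have htail : ∀ m M, heatKer G (m + m) o o - heatKer G ((m + M) + (m + M)) o o ≤
      h.decr o m / ε := by
    intro m M
    have e : heatKer G (m + m) o o - heatKer G ((m + M) + (m + M)) o o ≤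
        (h.decr o m - (1 - ε) ^ M * h.decr o m) / ε := by
      induction M with
      | zero => simp
      | succ M ih =>
        have h1 := hexp M m
        have e2 : h.decr o (m + M) = heatKer G ((m + M) + (m + M)) o o -
            heatKer G (m + (M + 1) + (m + (M + 1))) o o := by
          rw [decr]
          congr 2
          ring
        have h3 : (h.decr o m - (1 - ε) ^ (M + 1) * h.decr o m) / ε =
            (h.decr o m - (1 - ε) ^ M * h.decr o m) / ε + (1 - ε) ^ M * h.decr o m := by
          field_simp
          ring
        rw [h3]
        linarith
    refine e.trans ?_
    gcongr
    have := mul_nonneg (pow_nonneg (by linarith : (0 : ℝ) ≤ 1 - ε) M) (h.decr_nonneg o m)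
    linarith
  have hret : ∀ m, heatKer G (m + m) o o ≤ h.decr o 0 / ε * (1 - ε) ^ m := by
    intro m
    have h1 : Tendsto (fun M => heatKer G (m + m) o o - heatKer G ((m + M) + (m + M)) o o) atTop
        (nhds (heatKer G (m + m) o o - 0)) := by
      refine tendsto_const_nhds.sub ?_
      refine ((h.return_tendsto_zero o).comp (tendsto_add_atTop_nat m)).congr fun M => ?_
      simp only [Function.comp_apply, add_comm M m]
    rw [sub_zero] at h1
    refine (le_of_tendsto h1 (Filter.Eventually.of_forall (htail m))).trans ?_
    have := hexp m 0
    rw [zero_add] at this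
    rw [div_mul_eq_mul_div, mul_comm]
    gcongr
  obtain ⟨c, hc, hg⟩ := hk
  have hlim : Tendsto (fun m : ℕ => c * (h.decr o 0 / ε) * ((m : ℝ) ^ k * (1 - ε) ^ m)) atTop
      (nhds 0) := by
    have := (tendsto_pow_const_mul_const_pow_of_lt_one k (r := 1 - ε) (by linarith)
      (by linarith)).const_mul (c * (h.decr o 0 / ε))
    rwa [mul_zero] at this
  obtain ⟨m, hm, hm1⟩ := ((hlim.eventually (gt_mem_nhds one_pos)).and
    (eventually_ge_atTop 1)).exists
  have h1 := h.return_ge o m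
  have h2 := hg o m hm1
  have h3 := hret m
  have h4 : ((h.ball o m).card : ℝ) * heatKer G (m + m) o o ≤
      c * m ^ k * (h.decr o 0 / ε * (1 - ε) ^ m) :=
    mul_le_mul h2 h3 (heatKer_nonneg _ _ _) (by positivity)
  nlinarith

theorem heatKer_two_ge {x y : X} (hxy : G.dist x y ≤ 2) (o : X) :
    1 / (4 * (G.degree o : ℝ) ^ 2) ≤ heatKer G 2 x y := by
  obtain ⟨w, hw, hwy⟩ : ∃ w, G.dist x w ≤ 1 ∧ G.dist w y ≤ 1 := by
    rcases hxy.lt_or_eq with h1 | h1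
    · exact ⟨x, by simp, by omega⟩
    · obtain ⟨z, hz, hz'⟩ := h.exists_adj_of_dist_eq_succ h1
      exact ⟨z, (SimpleGraph.dist_eq_one_iff_adj.mpr hz).le, hz'.le⟩
  have h1 := h.le_heatKer_one hw
  have h2 := h.le_heatKer_one hwy
  rw [h.degree_eq x o] at h1
  rw [h.degree_eq w o] at h2
  have e := h.heatKer_add 1 1 x y (le_refl _)
  rw [show (1 + 1 : ℕ) = 2 from rfl] at e
  rw [e]
  have h3 := Finset.single_le_sum (f := fun z => heatKer G 1 x z * heatKer G 1 z y)
    (fun z _ => mul_nonneg (heatKer_nonneg _ _ _) (heatKer_nonneg _ _ _))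
    (show w ∈ h.ball x 1 by simpa using hw)
  refine le_trans ?_ h3
  refine le_trans (le_of_eq ?_) (mul_le_mul h1 h2 (by positivity) (heatKer_nonneg _ _ _))
  rw [div_mul_div_comm]
  congr 1 <;> ring

theorem exists_almost_harmonic [Infinite X] {k : ℕ} (hk : h.Growth k) (o : X) {ε : ℝ} (hε : 0 < ε)
    (hε1 : ε < 1) : ∃ F : X → ℝ, F o = 0 ∧ Lip G (8 * (G.degree o : ℝ) ^ 2) F ∧
      (∀ x, (F x - (lazyWalk G ^ 2) F x) ^ 2 ≤ 8 * (G.degree o : ℝ) ^ 2 * ε) ∧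
      ∃ y ∈ h.ball o 2, 2 ≤ F y := by
  obtain ⟨m, hm, hle⟩ := h.exists_decr_small hk o hε hε1
  set c := h.decr o m with hcdef
  set D : ℝ := (G.degree o : ℝ) with hDdef
  have hD : 0 < D := by
    rw [hDdef]; exact_mod_cast h.deg_pos o
  set a := heatKer G (m + m) o o
  have hself : ∀ x, heatKer G (m + m) x x = a := fun x => h.heatKer_self _ x o
  have hclose : ∀ x y, G.dist x y ≤ 2 → a - heatKer G (m + m) y x ≤ 4 * D ^ 2 * c := by
    intro x y hxy
    have h1 := h.return_sub_ge m 2 o x y hxy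
    have h2 := h.heatKer_two_ge hxy o
    have h3 : 0 ≤ a - heatKer G (m + m) y x := by linarith [h.heatKer_le_self m o y x]
    have h4 := (mul_le_mul_of_nonneg_right h2 h3).trans h1
    rwa [one_div, inv_mul_le_iff₀ (by positivity)] at h4
  obtain ⟨y1, hy1, hy1c⟩ : ∃ y ∈ h.ball o 2, c ≤ a - heatKer G (m + m) y o := by
    have h1 : ∑ y ∈ h.ball o 2, heatKer G 2 o y * c ≤ ∑ y ∈ h.ball o 2,
        heatKer G 2 o y * (a - heatKer G (m + m) y o) := by
      rw [← h.return_sub_eq m 2 o o, ← Finset.sum_mul, h.sum_heatKer 2 o (le_refl _), one_mul,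
        hcdef, decr]
    obtain ⟨y, hy, hyc⟩ := Finset.exists_le_of_sum_le ⟨o, by simp⟩ h1
    exact ⟨y, hy, le_of_mul_le_mul_left hyc (h.heatKer_pos (by simpa using hy))⟩
  have hy1d : heatKer G (m + m) y1 y1 - 2 * heatKer G (m + m) y1 o + a ≤ 8 * D ^ 2 * c := by
    rw [hself]
    linarith [hclose o y1 (by simpa using hy1)]
  set f : X → ℝ := fun x => heatKer G (m + m) x y1 - heatKer G (m + m) x o with hf
  have hfl : ∀ x x', G.Adj x x' → |f x - f x'| ≤ 8 * D ^ 2 * c := by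
    intro x x' hxx
    refine abs_le_of_sq_le_sq ?_ (by positivity)
    have h1 := h.heatKer_cauchy_schwarz m m m x x' y1 o
    have h2 : heatKer G (m + m) x x - 2 * heatKer G (m + m) x x' + heatKer G (m + m) x' x' ≤
        8 * D ^ 2 * c := by
      rw [hself, hself]
      have := hclose x' x (by
        rw [SimpleGraph.dist_comm, SimpleGraph.dist_eq_one_iff_adj.mpr hxx]; norm_num)
      linarith
    have h3 := h1.trans (mul_le_mul h2 hy1d (h.heatKer_sq_diff_nonneg m m y1 o) (by positivity))
    rw [← sq] at h3
    refine le_trans (le_of_eq ?_) h3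
    simp only [hf]
    ring
  have hP : ∀ x, (lazyWalk G ^ 2) f x =
      heatKer G (m + 2 + m) x y1 - heatKer G (m + 2 + m) x o := by
    intro x
    rw [h.lazyWalk_pow_eq_sum 2 x f (le_refl _)]
    have e : m + 2 + m = 2 + (m + m) := by ring
    rw [e, h.heatKer_add 2 (m + m) x y1 (le_refl _), h.heatKer_add 2 (m + m) x o (le_refl _),
      ← Finset.sum_sub_distrib]
    exact Finset.sum_congr rfl fun z _ => by simp only [hf]; ring
  have hharm : ∀ x, (f x - (lazyWalk G ^ 2) f x) ^ 2 ≤ ε * c * (8 * D ^ 2 * c) := by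
    intro x
    have h1 := h.heatKer_cauchy_schwarz m (m + 2) m x x y1 o
    rw [h.heatKer_self _ x o, h.heatKer_self _ x o, h.heatKer_self _ x o, ← h.decr_sub] at h1
    have h2 : 0 ≤ h.decr o m - h.decr o (m + 1) := by
      rw [h.decr_sub]
      exact h.heatKer_sq_diff_nonneg m (m + 2) o o
    have h3 := h1.trans (mul_le_mul hle hy1d (h.heatKer_sq_diff_nonneg m m y1 o) (by positivity))
    refine le_trans (le_of_eq ?_) h3
    rw [hP]
    simp only [hf]
    ring
  refine ⟨c⁻¹ • (f - f o • 1), by simp, fun x y hxy => ?_, fun x => ?_, y1, hy1, ?_⟩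
  · simp only [Pi.smul_apply, Pi.sub_apply, smul_eq_mul, Pi.one_apply, mul_one]
    have e : c⁻¹ * (f x - f o) - c⁻¹ * (f y - f o) = (f x - f y) / c := by ring
    rw [e, abs_div, abs_of_pos hm, div_le_iff₀ hm]
    exact hfl x y hxy
  · rw [map_smul, map_sub, map_smul, h.lazyWalk_pow_one]
    simp only [Pi.smul_apply, Pi.sub_apply, smul_eq_mul, Pi.one_apply, mul_one]
    have e : (c⁻¹ * (f x - f o) - c⁻¹ * ((lazyWalk G ^ 2) f x - f o)) ^ 2 =
      (f x - (lazyWalk G ^ 2) f x) ^ 2 / c ^ 2 := by field_simp; ring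
    rw [e, div_le_iff₀ (by positivity)]
    refine (hharm x).trans (le_of_eq ?_)
    ring
  · simp only [Pi.smul_apply, Pi.sub_apply, smul_eq_mul, Pi.one_apply, mul_one]
    rw [inv_mul_eq_div, le_div_iff₀ hm]
    simp only [hf]
    rw [hself, h.heatKer_symm (m + m) o y1]
    linarith

theorem eq_zero_of_lazyWalk_eq_neg {g : X → ℝ} (hg : lazyWalk G g = -g) {M : ℝ}
    (hM : ∀ x, |g x| ≤ M) : g = 0 := by
  have hstep : ∀ {N : ℝ}, (∀ x, |g x| ≤ N) → ∀ x, |g x| ≤ N / 3 := by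
    intro N hN x
    have h1 := congrFun hg x
    have hd : (0 : ℝ) < G.degree x := by exact_mod_cast h.deg_pos x
    rw [lazyWalk_apply, Pi.neg_apply] at h1
    have h2 : |∑ y ∈ G.neighborFinset x, g y| ≤ G.degree x * N := by
      refine (Finset.abs_sum_le_sum_abs _ _).trans ((Finset.sum_le_sum fun y _ => hN y).trans ?_)
      rw [Finset.sum_const, nsmul_eq_mul, SimpleGraph.card_neighborFinset_eq_degree]
    have h3 : g x = -((∑ y ∈ G.neighborFinset x, g y) / G.degree x) / 3 := by
      have : (∑ y ∈ G.neighborFinset x, g y) / (2 * G.degree x) =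
        ((∑ y ∈ G.neighborFinset x, g y) / G.degree x) / 2 := by field_simp
      rw [this] at h1
      linarith
    rw [h3, abs_div, abs_neg, abs_div, abs_of_pos hd, abs_of_pos (by norm_num : (0 : ℝ) < 3)]
    gcongr
    rw [div_le_iff₀ hd]
    linarith
  have hpow : ∀ n : ℕ, ∀ x, |g x| ≤ M / 3 ^ n := by
    intro n
    induction n with
    | zero => simpa using hM
    | succ n ih =>
      rw [pow_succ, ← div_div]
      exact hstep ih
  funext x
  have hlim : Tendsto (fun n : ℕ => M / (3 : ℝ) ^ n) atTop (nhds 0) :=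
    tendsto_const_nhds.div_atTop (tendsto_pow_atTop_atTop_of_one_lt (by norm_num))
  exact abs_nonpos_iff.mp (ge_of_tendsto hlim (Filter.Eventually.of_forall fun n => hpow n x))

theorem exists_lhf_ne_zero [Infinite X] {k : ℕ} (hk : h.Growth k) (o : X) :
    ∃ f : lhf G o, f ≠ 0 := by
  set L : ℝ := 8 * (G.degree o : ℝ) ^ 2
  have hL : 0 ≤ L := by positivity
  choose F hF0 hFL hFH y hy hFy using fun j : ℕ =>
    h.exists_almost_harmonic hk o (ε := 1 / (j + 2 : ℝ)) (by positivity) (by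
      rw [div_lt_one (by positivity)]
      have : (0 : ℝ) ≤ j := by positivity
      linarith)
  let ω : Ultrafilter ℕ := Ultrafilter.of atTop
  have hω : (ω : Filter ℕ) ≤ atTop := Ultrafilter.of_le _
  have hbd : ∀ x j, |F j x| ≤ L * G.dist x o := fun x j => by
    have := h.abs_sub_le_dist (hFL j) x o
    rwa [hF0, sub_zero] at this
  set f : X → ℝ := fun x => limUnder (ω : Filter ℕ) fun j => F j x
  have hlim : ∀ x, Tendsto (fun j => F j x) ω (nhds (f x)) := fun x =>
    tendsto_limUnder_ultra ω (hbd x)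
  have hf0 : f o = 0 := by
    refine tendsto_nhds_unique (hlim o) ?_
    simp only [hF0]
    exact tendsto_const_nhds
  have hfL : Lip G L f := fun x y hxy =>
    le_of_tendsto ((hlim x).sub (hlim y)).abs (Filter.Eventually.of_forall fun j => hFL j x y hxy)
  have hfP : (lazyWalk G ^ 2) f = f := by
    funext x
    have l1 : Tendsto (fun j => (lazyWalk G ^ 2) (F j) x) ω (nhds ((lazyWalk G ^ 2) f x)) := by
      simp only [h.lazyWalk_pow_eq_sum 2 x _ (le_refl _)]
      exact tendsto_finsetSum _ fun z _ => (hlim z).const_mul _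
    have l2 := ((hlim x).sub l1).pow 2
    have l3 : Tendsto (fun j : ℕ => L * (1 / ((j : ℝ) + 2))) ω (nhds 0) := by
      have : Tendsto (fun j : ℕ => L * (1 / ((j : ℝ) + 2))) atTop (nhds (L * 0)) := by
        refine Tendsto.const_mul L ?_
        refine tendsto_const_nhds.div_atTop ?_
        exact tendsto_atTop_add_const_right _ _ tendsto_natCast_atTop_atTop
      rw [mul_zero] at this
      exact this.mono_left hω
    have l4 := le_of_tendsto_of_tendsto l2 l3 (Filter.Eventually.of_forall fun j => hFH j x)
    have l5 := pow_eq_zero_iff (two_ne_zero) |>.mp (le_antisymm l4 (sq_nonneg _))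
    linarith
  have hfH : Harm G f := by
    have hg : f - lazyWalk G f = 0 := by
      refine h.eq_zero_of_lazyWalk_eq_neg (M := L) ?_ fun x => ?_
      · rw [map_sub, ← Module.End.mul_apply, ← sq, hfP]
        abel
      · have e : (f - lazyWalk G f) x = ∑ z ∈ h.ball x 1, heatKer G 1 x z * (f x - f z) := by
          have a1 := h.lazyWalk_pow_eq_sum 1 x f (le_refl _)
          rw [pow_one] at a1
          simp only [mul_sub]
          rw [Finset.sum_sub_distrib, ← Finset.sum_mul, h.sum_heatKer 1 x (le_refl _), one_mul,
            ← a1, Pi.sub_apply]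
        rw [e]
        refine (Finset.abs_sum_le_sum_abs _ _).trans ?_
        have : ∀ z ∈ h.ball x 1, |heatKer G 1 x z * (f x - f z)| ≤ heatKer G 1 x z * L := by
          intro z hz
          rw [abs_mul, abs_of_nonneg (heatKer_nonneg _ _ _), abs_sub_comm]
          exact mul_le_mul_of_nonneg_left (hfL.abs_le_of_mem_ball h hL hz) (heatKer_nonneg _ _ _)
        refine (Finset.sum_le_sum this).trans ?_
        rw [← Finset.sum_mul, h.sum_heatKer 1 x (le_refl _), one_mul]
    rw [Harm]
    exact (sub_eq_zero.mp hg).symm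
  refine ⟨⟨f, hfH, ⟨L, hL, hfL⟩, hf0⟩, fun hzero => ?_⟩
  have hz : ∀ x, f x = 0 := fun x => congrFun (congrArg Subtype.val hzero) x
  have l1 : Tendsto (fun j => ∑ z ∈ h.ball o 2, |F j z|) ω (nhds (∑ z ∈ h.ball o 2, |f z|)) :=
    tendsto_finsetSum _ fun z _ => (hlim z).abs
  have l2 := ge_of_tendsto l1 (Filter.Eventually.of_forall fun j => show (2 : ℝ) ≤ _ from
    ((hFy j).trans (le_abs_self _)).trans
      (Finset.single_le_sum (f := fun z => |F j z|) (fun z _ => abs_nonneg _) (hy j)))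
  simp only [hz, abs_zero, Finset.sum_const_zero] at l2
  norm_num at l2

end TransGraph

end PolyGrowth

namespace PolyGrowth

open scoped Pointwise commutatorElement

theorem finite_pow {Γ : Type*} [Monoid Γ] {S : Set Γ} (hS : S.Finite) (n : ℕ) : (S ^ n).Finite := by
  induction n with
  | zero => simp
  | succ n ih => rw [pow_succ]; exact ih.mul hS

/-- Every finite subset of the group grows polynomially, with a uniform exponent. -/
def GroupGrowth (Γ : Type*) [Group Γ] : Prop :=
  ∃ k : ℕ, ∀ S : Set Γ, S.Finite → ∃ c : ℝ, ∀ n : ℕ, 1 ≤ n → ((S ^ n).ncard : ℝ) ≤ c * (n : ℝ) ^ k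

theorem GroupGrowth.of_injective {Γ Δ : Type*} [Group Γ] [Group Δ] (hΓ : GroupGrowth Γ)
    (f : Δ →* Γ) (hf : Function.Injective f) : GroupGrowth Δ := by
  obtain ⟨k, hk⟩ := hΓ
  refine ⟨k, fun S hS => ?_⟩
  obtain ⟨c, hc⟩ := hk (f '' S) (hS.image f)
  refine ⟨c, fun n hn => ?_⟩
  rw [← Set.ncard_image_of_injective (S ^ n) hf, Set.image_pow]
  exact hc n hn

theorem GroupGrowth.subgroup {Γ : Type*} [Group Γ] (hΓ : GroupGrowth Γ) (H : Subgroup Γ) :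
    GroupGrowth H := hΓ.of_injective H.subtype H.subtype_injective

theorem GroupGrowth.of_surjective {Γ Δ : Type*} [Group Γ] [Group Δ] (hΓ : GroupGrowth Γ)
    (f : Γ →* Δ) (hf : Function.Surjective f) : GroupGrowth Δ := by
  obtain ⟨k, hk⟩ := hΓ
  refine ⟨k, fun S hS => ?_⟩
  have hinv := Function.surjInv_eq hf
  obtain ⟨c, hc⟩ := hk (Function.surjInv hf '' S) (hS.image _)
  refine ⟨c, fun n hn => le_trans ?_ (hc n hn)⟩
  have e : S ^ n = f '' ((Function.surjInv hf '' S) ^ n) := by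
    rw [Set.image_pow, Set.image_image]
    simp [hinv]
  rw [e]
  exact_mod_cast Set.ncard_image_le (finite_pow (hS.image _) n)

theorem exists_finite_subset_mem_closure {Γ : Type*} [Group Γ] {U : Set Γ} {x : Γ}
    (hx : x ∈ Subgroup.closure U) : ∃ S ⊆ U, S.Finite ∧ x ∈ Subgroup.closure S := by
  induction hx using Subgroup.closure_induction with
  | mem x hx => exact ⟨{x}, by simpa using hx, Set.finite_singleton x,
      Subgroup.subset_closure rfl⟩
  | one => exact ⟨∅, by simp, Set.finite_empty, Subgroup.one_mem _⟩
  | mul x y _ _ ihx ihy =>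
    obtain ⟨S, hS, hSf, hxS⟩ := ihx
    obtain ⟨T, hT, hTf, hyT⟩ := ihy
    exact ⟨S ∪ T, Set.union_subset hS hT, hSf.union hTf,
      Subgroup.mul_mem _ (Subgroup.closure_mono Set.subset_union_left hxS)
        (Subgroup.closure_mono Set.subset_union_right hyT)⟩
  | inv x _ ihx =>
    obtain ⟨S, hS, hSf, hxS⟩ := ihx
    exact ⟨S, hS, hSf, Subgroup.inv_mem _ hxS⟩

/-- If the closure of `U` is finitely generated, finitely many elements of `U` generate it. -/
theorem exists_finite_subset_closure_eq {Γ : Type*} [Group Γ] {U : Set Γ}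
    (hU : (Subgroup.closure U).FG) :
    ∃ S ⊆ U, S.Finite ∧ Subgroup.closure S = Subgroup.closure U := by
  obtain ⟨T, hT⟩ := hU
  have : ∀ x : Γ, ∃ S ⊆ U, S.Finite ∧ (x ∈ T → x ∈ Subgroup.closure S) := fun x => by
    by_cases hx : x ∈ T
    · obtain ⟨S, h1, h2, h3⟩ := exists_finite_subset_mem_closure
        (hT ▸ Subgroup.subset_closure hx : x ∈ Subgroup.closure U)
      exact ⟨S, h1, h2, fun _ => h3⟩
    · exact ⟨∅, by simp, Set.finite_empty, fun h => absurd h hx⟩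
  choose F hFU hFf hF using this
  refine ⟨⋃ x ∈ T, F x, Set.iUnion₂_subset fun x _ => hFU x,
    T.finite_toSet.biUnion fun x _ => hFf x, le_antisymm
      (Subgroup.closure_mono (Set.iUnion₂_subset fun x _ => hFU x)) ?_⟩
  rw [← hT, Subgroup.closure_le]
  exact fun x hx => Subgroup.closure_mono (Set.subset_biUnion_of_mem (u := F) hx) (hF x hx)

section Normed

variable {Γ R : Type*} [Group Γ] [NormedRing R] (ρ : Γ →* R)

theorem norm_map_pow_sub_one_le {M : ℝ} (hM : ∀ g, ‖ρ g‖ ≤ M) (h : Γ) (n : ℕ) :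
    ‖ρ (h ^ n) - 1‖ ≤ n * M * ‖ρ h - 1‖ := by
  induction n with
  | zero => simp
  | succ n ih =>
    have e : ρ (h ^ (n + 1)) - 1 = ρ (h ^ n) * (ρ h - 1) + (ρ (h ^ n) - 1) := by
      rw [pow_succ, map_mul]; noncomm_ring
    rw [e]
    refine (norm_add_le _ _).trans ?_
    have := (norm_mul_le (ρ (h ^ n)) (ρ h - 1)).trans
      (mul_le_mul_of_nonneg_right (hM (h ^ n)) (norm_nonneg _))
    push_cast
    linarith

variable [NormedSpace ℝ R]

theorem le_norm_map_pow_sub_one {M : ℝ} (hM : ∀ g, ‖ρ g‖ ≤ M) (h : Γ) (n : ℕ) :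
    (n - n ^ 2 * M * ‖ρ h - 1‖) * ‖ρ h - 1‖ ≤ ‖ρ (h ^ n) - 1‖ := by
  have hM0 : 0 ≤ M := (norm_nonneg _).trans (hM 1)
  have key : ‖(ρ (h ^ n) - 1) - n • (ρ h - 1)‖ ≤ n ^ 2 * M * ‖ρ h - 1‖ * ‖ρ h - 1‖ := by
    induction n with
    | zero => simp
    | succ n ih =>
      have e : (ρ (h ^ (n + 1)) - 1) - (n + 1) • (ρ h - 1) =
          (ρ (h ^ n) - 1) * (ρ h - 1) + ((ρ (h ^ n) - 1) - n • (ρ h - 1)) := by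
        rw [pow_succ, map_mul, add_smul, one_smul]; noncomm_ring
      rw [e]
      refine (norm_add_le _ _).trans ?_
      have h1 := (norm_mul_le (ρ (h ^ n) - 1) (ρ h - 1)).trans
        (mul_le_mul_of_nonneg_right (norm_map_pow_sub_one_le ρ hM h n) (norm_nonneg _))
      have h2 : (n : ℝ) * M * ‖ρ h - 1‖ * ‖ρ h - 1‖ + n ^ 2 * M * ‖ρ h - 1‖ * ‖ρ h - 1‖ ≤
          ((n + 1 : ℕ) : ℝ) ^ 2 * M * ‖ρ h - 1‖ * ‖ρ h - 1‖ := by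
        rw [← add_mul, ← add_mul, ← add_mul]
        gcongr
        push_cast
        nlinarith [(Nat.cast_nonneg n : (0 : ℝ) ≤ n)]
      linarith
  have h3 : ‖n • (ρ h - 1)‖ ≤ ‖ρ (h ^ n) - 1‖ + ‖(ρ (h ^ n) - 1) - n • (ρ h - 1)‖ := by
    have := norm_sub_le (ρ (h ^ n) - 1) ((ρ (h ^ n) - 1) - n • (ρ h - 1))
    rwa [sub_sub_cancel] at this
  rw [← Nat.cast_smul_eq_nsmul ℝ, norm_smul, Real.norm_natCast] at h3
  rw [← Nat.cast_smul_eq_nsmul ℝ] at key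
  linarith [sub_mul (n : ℝ) (n ^ 2 * M * ‖ρ h - 1‖) ‖ρ h - 1‖]

/-- A sequence of elements with rapidly decreasing displacement and word length at most
exponential produces too many elements. -/
theorem false_of_chain {M : ℝ} (hM1 : 1 ≤ M) (hM : ∀ g, ‖ρ g‖ ≤ M) {S : Set Γ} (hS : S.Finite)
    (hS1 : (1 : Γ) ∈ S) {c : ℝ} {k : ℕ}
    (hc : ∀ n : ℕ, 1 ≤ n → ((S ^ n).ncard : ℝ) ≤ c * (n : ℝ) ^ k) (h : ℕ → Γ) {η : ℝ}
    (hpos : ∀ j, 0 < ‖ρ (h j) - 1‖) (hdec : ∀ j, ‖ρ (h (j + 1)) - 1‖ ≤ η * ‖ρ (h j) - 1‖)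
    (hη0 : 0 ≤ η) (hη : 8 * 2 ^ (k + 1) * M ^ 2 * η < 1)
    (h0 : (2 ^ (k + 1)) ^ 2 * M * ‖ρ (h 0) - 1‖ ≤ 1 / 2)
    (hlen : ∀ j, h j ∈ S ^ (3 * 2 ^ j)) : False := by
  set L : ℕ := 2 ^ (k + 1) with hL
  have hL1 : (1 : ℝ) ≤ L := by exact_mod_cast Nat.one_le_two_pow
  have hLc : (2 : ℝ) ^ (k + 1) = L := by simp [hL]
  rw [hLc] at hη h0
  have hMη : 8 * L * M * η < 1 := by
    refine lt_of_le_of_lt ?_ hη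
    have : (0 : ℝ) ≤ 8 * L * η * (M * (M - 1)) := by
      have : 0 ≤ M - 1 := by linarith
      positivity
    nlinarith
  have hMη' : M * η ≤ 1 / 2 := by
    nlinarith [mul_nonneg (mul_nonneg (by linarith : (0 : ℝ) ≤ L - 1) (by linarith : 0 ≤ M)) hη0]
  have hη1 : η ≤ 1 := by nlinarith
  have hsmall : ∀ j, (L : ℝ) ^ 2 * M * ‖ρ (h j) - 1‖ ≤ 1 / 2 := by
    have : ∀ j, ‖ρ (h j) - 1‖ ≤ ‖ρ (h 0) - 1‖ := by
      intro j
      induction j with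
      | zero => exact le_rfl
      | succ j ih => nlinarith [hdec j, norm_nonneg (ρ (h j) - 1)]
    intro j
    refine le_trans ?_ h0
    have := this j
    gcongr
  have hmono : ∀ {m n : ℕ}, m ≤ n → S ^ m ⊆ S ^ n := fun hmn => Set.pow_subset_pow_right hS1 hmn
  have key : ∀ m j : ℕ, ∃ W : Finset Γ, W.card = L ^ m ∧
      (∃ n, n + 3 * L * 2 ^ j ≤ 3 * L * 2 ^ (j + m) ∧ (W : Set Γ) ⊆ S ^ n) ∧
      ∀ w ∈ W, ‖ρ w - 1‖ ≤ 2 * L * M * ‖ρ (h j) - 1‖ := by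
    classical
    intro m
    induction m with
    | zero =>
      refine fun j => ⟨{1}, by simp, ⟨0, by simp, by simp⟩, ?_⟩
      intro w hw
      rw [Finset.mem_singleton.mp hw]
      simp only [map_one, sub_self, norm_zero]
      positivity
    | succ m ih =>
      intro j
      obtain ⟨W, hWc, ⟨n, hn, hWn⟩, hW⟩ := ih (j + 1)
      refine ⟨Finset.image (fun p : ℕ × Γ => h j ^ p.1 * p.2) (Finset.range L ×ˢ W), ?_,
        ⟨L * (3 * 2 ^ j) + n, ?_, ?_⟩, ?_⟩
      · rw [Finset.card_image_of_injOn, Finset.card_product, hWc, Finset.card_range, pow_succ,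
          mul_comm]
        have hlt : ∀ a b : ℕ, ∀ w ∈ W, ∀ w' ∈ W, a < b → b < L →
            h j ^ a * w = h j ^ b * w' → False := by
          intro a b w hw w' hw' hab hb e
          have e1 : h j ^ (b - a) = w * w'⁻¹ := by
            have : h j ^ b = h j ^ a * h j ^ (b - a) := by rw [← pow_add]; congr 1; omega
            rw [this, mul_assoc] at e
            rw [mul_left_cancel e, mul_inv_cancel_right]
          have e2 : ρ (h j ^ (b - a)) - 1 = ((ρ w - 1) - (ρ w' - 1)) * ρ w'⁻¹ := by
            rw [e1, map_mul, sub_sub_sub_cancel_right, sub_mul, ← map_mul ρ w', mul_inv_cancel,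
              map_one]
          have h1 := le_norm_map_pow_sub_one ρ hM (h j) (b - a)
          rw [e2] at h1
          have h2 : ‖((ρ w - 1) - (ρ w' - 1)) * ρ w'⁻¹‖ ≤
              (2 * L * M * ‖ρ (h (j + 1)) - 1‖ + 2 * L * M * ‖ρ (h (j + 1)) - 1‖) * M :=
            (norm_mul_le _ _).trans (mul_le_mul ((norm_sub_le _ _).trans
              (add_le_add (hW w hw) (hW w' hw'))) (hM _) (norm_nonneg _) (by positivity))
          have h3 : (1 : ℝ) ≤ (b - a : ℕ) := by exact_mod_cast (by omega : 1 ≤ b - a)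
          have h4 : ((b - a : ℕ) : ℝ) ≤ L := by exact_mod_cast (by omega : b - a ≤ L)
          have h5 : ((b - a : ℕ) : ℝ) ^ 2 * M * ‖ρ (h j) - 1‖ ≤ 1 / 2 :=
            le_trans (by gcongr) (hsmall j)
          have h6 := hpos j
          have h7 : (1 / 2 : ℝ) * ‖ρ (h j) - 1‖ ≤
            (2 * L * M * (η * ‖ρ (h j) - 1‖) + 2 * L * M * (η * ‖ρ (h j) - 1‖)) * M := by
            have h8 : (1 / 2 : ℝ) * ‖ρ (h j) - 1‖ ≤ (((b - a : ℕ) : ℝ) -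
              ((b - a : ℕ) : ℝ) ^ 2 * M * ‖ρ (h j) - 1‖) * ‖ρ (h j) - 1‖ := by
              gcongr; linarith
            refine h8.trans (h1.trans (h2.trans ?_))
            have := hdec j
            gcongr
          nlinarith
        rintro ⟨a, w⟩ hp ⟨b, w'⟩ hq e
        simp only [Finset.coe_product, Set.mem_prod, Finset.mem_coe, Finset.mem_range] at hp hq e
        rcases lt_trichotomy a b with hab | hab | hab
        · exact (hlt a b w hp.2 w' hq.2 hab hq.1 e).elim
        · subst hab
          rw [mul_left_cancel e]
        · exact (hlt b a w' hq.2 w hp.2 hab hp.1 e.symm).elim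
      · have e1 : 2 ^ (j + (m + 1)) = 2 ^ (j + 1 + m) := by congr 1; omega
        rw [e1]
        have e2 : 2 ^ (j + 1) = 2 * 2 ^ j := by ring
        rw [e2] at hn
        nlinarith
      · intro x hx
        obtain ⟨⟨a, w⟩, hp, rfl⟩ := Finset.mem_image.mp (Finset.mem_coe.mp hx)
        rw [Finset.mem_product, Finset.mem_range] at hp
        rw [pow_add]
        refine Set.mul_mem_mul ?_ (hWn hp.2)
        have : h j ^ a ∈ (S ^ (3 * 2 ^ j)) ^ a := Set.pow_mem_pow (hlen j)
        rw [← pow_mul] at this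
        refine hmono ?_ this
        rw [mul_comm]
        exact Nat.mul_le_mul_right _ hp.1.le
      · intro x hx
        obtain ⟨⟨a, w⟩, hp, rfl⟩ := Finset.mem_image.mp hx
        rw [Finset.mem_product, Finset.mem_range] at hp
        have e : ρ (h j ^ a * w) - 1 = ρ (h j ^ a) * (ρ w - 1) + (ρ (h j ^ a) - 1) := by
          rw [map_mul]; noncomm_ring
        show ‖ρ (h j ^ a * w) - 1‖ ≤ _
        rw [e]
        have h1 : ‖ρ (h j ^ a) * (ρ w - 1)‖ ≤ M * (2 * L * M * ‖ρ (h (j + 1)) - 1‖) :=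
          (norm_mul_le _ _).trans (mul_le_mul (hM _) (hW w hp.2) (norm_nonneg _) (by linarith))
        have h2 := norm_map_pow_sub_one_le ρ hM (h j) a
        have h3 : (a : ℝ) ≤ L := by exact_mod_cast hp.1.le
        have h4 : (a : ℝ) * M * ‖ρ (h j) - 1‖ ≤ L * M * ‖ρ (h j) - 1‖ := by gcongr
        have h5 : M * (2 * L * M * ‖ρ (h (j + 1)) - 1‖) ≤
            M * (2 * L * M * (η * ‖ρ (h j) - 1‖)) := by
          have := hdec j
          gcongr
        have h6 : 2 * L * M * ‖ρ (h j) - 1‖ * (M * η) ≤ 2 * L * M * ‖ρ (h j) - 1‖ * (1 / 2) := by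
          gcongr
        refine (norm_add_le _ _).trans ?_
        nlinarith
  have hbound : ∀ m : ℕ, (2 : ℝ) ^ m ≤ c * (3 * L) ^ k := by
    intro m
    obtain ⟨W, hWc, ⟨n, hn, hWn⟩, -⟩ := key m 0
    have h1 : W.card ≤ (S ^ (3 * L * 2 ^ m)).ncard := by
      rw [← Set.ncard_coe_finset]
      refine Set.ncard_le_ncard (hWn.trans (hmono ?_)) (finite_pow hS _)
      simpa using (Nat.le_add_right _ _).trans hn
    have h2 := hc (3 * L * 2 ^ m) (Nat.one_le_iff_ne_zero.mpr (by positivity))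
    have h3 : ((L : ℝ) ^ m) ≤ c * ((3 * L * 2 ^ m : ℕ) : ℝ) ^ k := by
      refine le_trans ?_ h2
      have : L ^ m ≤ (S ^ (3 * L * 2 ^ m)).ncard := hWc ▸ h1
      exact_mod_cast this
    push_cast at h3
    rw [← hLc] at h3 ⊢
    have h4 : ((2 : ℝ) ^ (k + 1)) ^ m = 2 ^ m * (2 ^ m) ^ k := by
      rw [← pow_mul, ← pow_mul, ← pow_add]; congr 1; ring
    rw [h4, mul_pow _ _ k, ← mul_assoc] at h3
    exact le_of_mul_le_mul_right h3 (by positivity)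
  obtain ⟨m, hm⟩ := pow_unbounded_of_one_lt (c * (3 * L) ^ k) (one_lt_two : (1 : ℝ) < 2)
  exact absurd (hbound m) (not_le.mpr hm)

theorem commute_map_of_mem_closure {Γ R : Type*} [Group Γ] [Monoid R] (ρ : Γ →* R) {S : Set Γ}
    {z : R} (hS : ∀ s ∈ S, Commute z (ρ s)) {g : Γ} (hg : g ∈ Subgroup.closure S) :
    Commute z (ρ g) := by
  induction hg using Subgroup.closure_induction with
  | mem x hx => exact hS x hx
  | one => rw [map_one]; exact Commute.one_right z
  | mul x y _ _ ihx ihy => rw [map_mul]; exact ihx.mul_right ihy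
  | inv x _ ih =>
    have h1 : ρ x * ρ x⁻¹ = 1 := by rw [← map_mul, mul_inv_cancel, map_one]
    have h2 : ρ x⁻¹ * ρ x = 1 := by rw [← map_mul, inv_mul_cancel, map_one]
    calc z * ρ x⁻¹ = ρ x⁻¹ * ρ x * z * ρ x⁻¹ := by rw [h2, one_mul]
      _ = ρ x⁻¹ * z * (ρ x * ρ x⁻¹) := by rw [mul_assoc (ρ x⁻¹), ← ih.eq]; simp only [mul_assoc]
      _ = ρ x⁻¹ * z := by rw [h1, mul_one]

omit [NormedSpace ℝ R] in
/-- Elements mapped close to the identity generate a subgroup of finite index. -/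
theorem finiteIndex_closure_near_one [ProperSpace R] {M : ℝ} (hM : ∀ g, ‖ρ g‖ ≤ M) {ε : ℝ}
    (hε : 0 < ε) : (Subgroup.closure {g | ‖ρ g - 1‖ < ε}).FiniteIndex := by
  have hM0 : 0 ≤ M := (norm_nonneg _).trans (hM 1)
  obtain ⟨t, -, ht, htc⟩ := (isCompact_closedBall (0 : R) M).finite_cover_balls
    (e := ε / (2 * (M + 1))) (by positivity)
  have hex : ∀ g, ∃ x ∈ t, ρ g ∈ Metric.ball x (ε / (2 * (M + 1))) := fun g => by
    have := htc (show ρ g ∈ Metric.closedBall (0 : R) M by simpa using hM g)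
    simpa using this
  choose F hFt hF using hex
  have : Finite t := ht
  have hinj : Function.Injective
      (fun q : Γ ⧸ Subgroup.closure {g | ‖ρ g - 1‖ < ε} => (⟨F q.out, hFt _⟩ : t)) := by
    intro q q' e
    simp only [Subtype.mk.injEq] at e
    rw [← q.out_eq, ← q'.out_eq]
    refine Quotient.sound (QuotientGroup.leftRel_apply.mpr ?_)
    refine Subgroup.subset_closure ?_
    show ‖ρ _ - 1‖ < ε
    have e1 : ρ (q.out⁻¹ * q'.out) - 1 = ρ q.out⁻¹ * (ρ q'.out - ρ q.out) := by
      rw [mul_sub, ← map_mul, ← map_mul, inv_mul_cancel, map_one]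
    rw [e1]
    have h1 : dist (ρ q'.out) (ρ q.out) < ε / (2 * (M + 1)) + ε / (2 * (M + 1)) := by
      refine (dist_triangle_right _ _ (F q.out)).trans_lt ?_
      have h1 := hF q.out
      have h2 := hF q'.out
      rw [← e] at h2
      rw [Metric.mem_ball] at h1 h2
      exact add_lt_add h2 h1
    rw [dist_eq_norm] at h1
    have h2 : ε / (2 * (M + 1)) + ε / (2 * (M + 1)) = ε / (M + 1) := by field_simp; ring
    rw [h2] at h1
    calc _ ≤ M * ‖ρ q'.out - ρ q.out‖ :=
          (norm_mul_le _ _).trans (mul_le_mul_of_nonneg_right (hM _) (norm_nonneg _))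
      _ ≤ M * (ε / (M + 1)) := by gcongr
      _ < ε := by
        rw [mul_div_assoc', div_lt_iff₀ (by positivity)]
        nlinarith
  have : Finite (Γ ⧸ Subgroup.closure {g | ‖ρ g - 1‖ < ε}) := Finite.of_injective _ hinj
  exact Subgroup.finiteIndex_of_finite_quotient

/-- Argument of Jordan in the irreducible case. -/
theorem exists_finiteIndex_commute_of_central [ProperSpace R] [Group.FG Γ] (hΓ : GroupGrowth Γ)
    {M : ℝ} (hM : ∀ g, ‖ρ g‖ ≤ M) {δ : ℝ} (hδ : 0 < δ)
    (hZ : ∀ H : Subgroup Γ, H.FiniteIndex → ∀ a ∈ H, ∀ b ∈ H, ‖ρ ⁅a, b⁆ - 1‖ < δ →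
      (∀ g ∈ H, Commute (ρ ⁅a, b⁆) (ρ g)) → ρ ⁅a, b⁆ = 1) :
    ∃ H : Subgroup Γ, H.FiniteIndex ∧ ∀ a ∈ H, ∀ b ∈ H, Commute (ρ a) (ρ b) := by
  wlog hM1 : 1 ≤ M generalizing M
  · exact this (fun g => (hM g).trans (not_le.mp hM1).le) le_rfl
  obtain ⟨k, hk⟩ := hΓ
  obtain ⟨ε, hε, hε1, hε2, hε3⟩ : ∃ ε : ℝ, 0 < ε ∧ ε ≤ δ / 2 ∧
      8 * 2 ^ (k + 1) * M ^ 2 * (2 * M ^ 2 * ε) < 1 ∧ (2 ^ (k + 1)) ^ 2 * M * ε ≤ 1 / 2 := by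
    refine ⟨min (δ / 2) (min (1 / (2 * (8 * 2 ^ (k + 1) * M ^ 2 * (2 * M ^ 2))))
      (1 / (2 * ((2 ^ (k + 1)) ^ 2 * M)))), by positivity, min_le_left _ _, ?_, ?_⟩
    · have := (min_le_right (δ / 2) (min (1 / (2 * (8 * 2 ^ (k + 1) * M ^ 2 * (2 * M ^ 2))))
        (1 / (2 * ((2 ^ (k + 1)) ^ 2 * M))))).trans (min_le_left _ _)
      rw [le_div_iff₀ (by positivity)] at this
      linarith
    · have := (min_le_right (δ / 2) (min (1 / (2 * (8 * 2 ^ (k + 1) * M ^ 2 * (2 * M ^ 2))))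
        (1 / (2 * ((2 ^ (k + 1)) ^ 2 * M))))).trans (min_le_right _ _)
      rw [le_div_iff₀ (by positivity)] at this
      linarith
  have hA := finiteIndex_closure_near_one ρ hM hε
  obtain ⟨S, hSU, hSf, hSA⟩ := exists_finite_subset_closure_eq
    ((Group.fg_iff_subgroup_fg _).mp (inferInstance :
      Group.FG (Subgroup.closure {g | ‖ρ g - 1‖ < ε})))
  set A := Subgroup.closure {g | ‖ρ g - 1‖ < ε} with hAdef
  refine ⟨A, hA, ?_⟩
  by_contra hcon
  have hex0 : ∃ s ∈ S, ∃ s' ∈ S, ¬ Commute (ρ s) (ρ s') := by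
    by_contra! hall
    refine hcon fun a ha b hb => ?_
    rw [← hSA] at ha hb
    exact commute_map_of_mem_closure ρ
      (fun s hs => (commute_map_of_mem_closure ρ (fun s' hs' => hall s hs s' hs') ha).symm) hb
  set η : ℝ := 2 * M ^ 2 * ε with hη
  have hη1 : η ≤ 1 := by
    have h1 : (1 : ℝ) ≤ 2 ^ (k + 1) := one_le_pow₀ one_le_two
    have h2 : (1 : ℝ) ≤ M ^ 2 := one_le_pow₀ hM1
    have h3 : 0 ≤ η := by positivity
    nlinarith [mul_le_mul h1 h2 zero_le_one (by positivity)]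
  have hone : ∀ h : Γ, (∃ s ∈ S, ¬ Commute (ρ h) (ρ s)) → 0 < ‖ρ h - 1‖ := by
    rintro h ⟨s, -, hs⟩
    refine norm_pos_iff.mpr fun h0 => hs ?_
    rw [sub_eq_zero.mp h0]
    exact Commute.one_left _
  have hSA' : ∀ s ∈ S, s ∈ A := fun s hs => hSA ▸ Subgroup.subset_closure hs
  let P : Set Γ := {h | h ∈ A ∧ (∃ s ∈ S, ¬ Commute (ρ h) (ρ s)) ∧ ‖ρ h - 1‖ ≤ ε}
  have hstep : ∀ h : P, ∃ h' : P, (∃ s ∈ S, (h' : Γ) = ⁅(h : Γ), s⁆) ∧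
      ‖ρ h' - 1‖ ≤ η * ‖ρ (h : Γ) - 1‖ := by
    rintro ⟨h, hhA, ⟨s, hs, hcomm⟩, hhε⟩
    have hs1 : ‖ρ s - 1‖ < ε := hSU hs
    have hle : ‖ρ ⁅h, s⁆ - 1‖ ≤ η * ‖ρ h - 1‖ := by
      have e : ρ ⁅h, s⁆ - 1 = ((ρ h - 1) * (ρ s - 1) - (ρ s - 1) * (ρ h - 1)) * ρ (h⁻¹ * s⁻¹) := by
        have e1 : (ρ h - 1) * (ρ s - 1) - (ρ s - 1) * (ρ h - 1) = ρ (h * s) - ρ (s * h) := by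
          rw [map_mul, map_mul]; noncomm_ring
        have e2 : s * h * (h⁻¹ * s⁻¹) = 1 := by group
        have e3 : h * s * (h⁻¹ * s⁻¹) = ⁅h, s⁆ := by rw [commutatorElement_def]; group
        rw [e1, sub_mul, ← map_mul, ← map_mul, e2, e3, map_one]
      rw [e]
      have h1 : ‖(ρ h - 1) * (ρ s - 1) - (ρ s - 1) * (ρ h - 1)‖ ≤ 2 * ε * ‖ρ h - 1‖ := by
        refine (norm_sub_le _ _).trans ?_
        have h1 := norm_mul_le (ρ h - 1) (ρ s - 1)
        have h2 := norm_mul_le (ρ s - 1) (ρ h - 1)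
        nlinarith [norm_nonneg (ρ h - 1)]
      calc _ ≤ (2 * ε * ‖ρ h - 1‖) * M :=
            (norm_mul_le _ _).trans (mul_le_mul h1 (hM _) (norm_nonneg _) (by positivity))
        _ ≤ η * ‖ρ h - 1‖ := by
          have : 2 * ε * ‖ρ h - 1‖ * M ≤ 2 * ε * ‖ρ h - 1‖ * M ^ 2 := by
            gcongr
            nlinarith
          rw [hη]
          linarith
    have hle' : ‖ρ ⁅h, s⁆ - 1‖ ≤ ε := by nlinarith [norm_nonneg (ρ h - 1)]
    refine ⟨⟨⁅h, s⁆, A.mul_mem (A.mul_mem (A.mul_mem hhA (hSA' s hs)) (A.inv_mem hhA))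
      (A.inv_mem (hSA' s hs)), ?_, hle'⟩, ⟨s, hs, rfl⟩, hle⟩
    by_contra! hall
    have h1 := hZ A hA h hhA s (hSA' s hs) (by linarith) fun g hg => by
      rw [← hSA] at hg
      exact commute_map_of_mem_closure ρ hall hg
    refine hcomm ?_
    have e : h * s = ⁅h, s⁆ * (s * h) := by rw [commutatorElement_def]; group
    rw [commute_iff_eq, ← map_mul, e, map_mul, h1, one_mul, map_mul]
  obtain ⟨s, hs, s', hs', hss⟩ := hex0
  choose next hnext hnext' using hstep
  let H : ℕ → P := fun n => next^[n] ⟨s, hSA' s hs, ⟨s', hs', hss⟩, le_of_lt (hSU hs)⟩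
  have hH : ∀ n, H (n + 1) = next (H n) := fun n => Function.iterate_succ_apply' _ _ _
  set S' : Set Γ := insert 1 (S ∪ S⁻¹) with hS'
  have hS'f : S'.Finite := (hSf.union hSf.inv).insert 1
  have hS'inv : S'⁻¹ = S' := by
    rw [hS', Set.inv_insert, Set.union_inv, inv_inv, inv_one, Set.union_comm]
  obtain ⟨c, hc⟩ := hk S' hS'f
  have hlen : ∀ j, ∃ n, n + 2 = 3 * 2 ^ j ∧ (H j : Γ) ∈ S' ^ n := by
    intro j
    induction j with
    | zero => exact ⟨1, by norm_num, by simp only [pow_one]; exact Or.inr (Or.inl hs)⟩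
    | succ j ih =>
      obtain ⟨n, hn, hmem⟩ := ih
      refine ⟨n + 1 + n + 1, by rw [pow_succ]; omega, ?_⟩
      obtain ⟨t, ht, e⟩ := hnext (H j)
      rw [hH, e, commutatorElement_def, pow_succ, pow_add, pow_succ]
      refine Set.mul_mem_mul (Set.mul_mem_mul (Set.mul_mem_mul hmem (Or.inr (Or.inl ht))) ?_)
        (Or.inr (Or.inr (Set.inv_mem_inv.mpr ht)))
      rw [← Set.mem_inv, ← inv_pow, hS'inv]
      exact hmem
  refine false_of_chain ρ hM1 hM hS'f (Or.inl rfl) hc (fun j => H j) (η := η)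
    (fun j => hone _ (H j).2.2.1) (fun j => by rw [hH]; exact hnext' _) (by positivity) hε2
    (le_trans ?_ hε3) fun j => ?_
  · have := (H 0).2.2.2
    gcongr
  · obtain ⟨n, hn, hmem⟩ := hlen j
    exact Set.pow_subset_pow_right (s := S') (Or.inl rfl) (by omega) hmem

end Normed

end PolyGrowth

namespace PolyGrowth

open scoped Pointwise commutatorElement

theorem finiteIndex_map_subtype {Γ : Type*} [Group Γ] {H : Subgroup Γ} [H.FiniteIndex]
    (K : Subgroup H) [hK : K.FiniteIndex] : (K.map H.subtype).FiniteIndex :=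
  ⟨by rw [Subgroup.index_map_subtype]
      exact mul_ne_zero hK.index_ne_zero (Subgroup.FiniteIndex.index_ne_zero)⟩

/-- A root of unity of order dividing `N` that is close to `1` equals `1`. -/
theorem exists_root_of_unity_gap (N : ℕ) (hN : 0 < N) :
    ∃ δ : ℝ, 0 < δ ∧ ∀ z : ℂ, z ^ N = 1 → ‖z - 1‖ < δ → z = 1 := by
  have hfin : ((Polynomial.nthRootsFinset N (1 : ℂ)).erase 1 : Set ℂ).Finite :=
    Finset.finite_toSet _
  have hopen : IsOpen (((Polynomial.nthRootsFinset N (1 : ℂ)).erase 1 : Set ℂ)ᶜ) :=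
    hfin.isClosed.isOpen_compl
  obtain ⟨δ, hδ, hb⟩ := Metric.isOpen_iff.mp hopen 1 (by simp)
  refine ⟨δ, hδ, fun z hz hzδ => ?_⟩
  by_contra hne
  have := hb (show z ∈ Metric.ball 1 δ by rwa [Metric.mem_ball, dist_eq_norm])
  apply this
  simp [hne, Polynomial.mem_nthRootsFinset hN, hz]

section Irreducible

attribute [local instance] Matrix.linftyOpNormedRing Matrix.linftyOpNormedSpace

theorem exists_finiteIndex_commute_of_irreducible {E Γ : Type*} [AddCommGroup E] [Module ℂ E]
    [FiniteDimensional ℂ E] [Nontrivial E] [Group Γ] [Group.FG Γ] (hΓ : GroupGrowth Γ)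
    (ρ : Γ →* Module.End ℂ E)
    (hb : ∀ (φ : Module.Dual ℂ E) (e : E), ∃ C : ℝ, ∀ g, ‖φ (ρ g e)‖ ≤ C)
    (hirr : ∀ H : Subgroup Γ, H.FiniteIndex → ∀ W : Submodule ℂ E,
      (∀ g ∈ H, ∀ w ∈ W, ρ g w ∈ W) → W ≠ ⊥ → W = ⊤) :
    ∃ H : Subgroup Γ, H.FiniteIndex ∧ ∀ a ∈ H, ∀ b ∈ H, Commute (ρ a) (ρ b) := by
  classical
  obtain ⟨N, hN⟩ : ∃ N, Module.finrank ℂ E = N := ⟨_, rfl⟩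
  have hN0 : 0 < N := hN ▸ Module.finrank_pos
  let b := Module.finBasisOfFinrankEq ℂ E hN
  let e := LinearMap.toMatrixAlgEquiv b
  let σ : Γ →* Matrix (Fin N) (Fin N) ℂ := (e : Module.End ℂ E →* Matrix (Fin N) (Fin N) ℂ).comp ρ
  have hσ : ∀ g, σ g = e (ρ g) := fun g => rfl
  have hbij : ∀ i j, ∃ C : ℝ, ∀ g, ‖σ g i j‖ ≤ C := fun i j => by
    obtain ⟨C, hC⟩ := hb (b.coord i) (b j)
    refine ⟨C, fun g => ?_⟩
    rw [hσ, LinearMap.toMatrixAlgEquiv_apply]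
    exact hC g
  choose C hC using hbij
  have hM : ∀ g, ‖σ g‖ ≤ ∑ i, ∑ j, C i j := fun g => by
    rw [Matrix.linfty_opNorm_def]
    have hC0 : ∀ i j, 0 ≤ C i j := fun i j => (norm_nonneg _).trans (hC i j g)
    have : (Finset.univ : Finset (Fin N)).sup (fun i => ∑ j, ‖σ g i j‖₊) ≤
        (⟨∑ i, ∑ j, C i j, Finset.sum_nonneg fun i _ => Finset.sum_nonneg fun j _ => hC0 i j⟩ :
          NNReal) := by
      refine Finset.sup_le fun i _ => ?_
      refine NNReal.coe_le_coe.mp ?_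
      simp only [NNReal.coe_sum, coe_nnnorm]
      refine (Finset.sum_le_sum fun j _ => hC i j g).trans ?_
      exact Finset.single_le_sum (f := fun i => ∑ j, C i j)
        (fun i _ => Finset.sum_nonneg fun j _ => hC0 i j) (Finset.mem_univ i)
    exact_mod_cast this
  obtain ⟨δ, hδ, hroot⟩ := exists_root_of_unity_gap N hN0
  have hne1 : (0 : ℝ) < ‖(1 : Matrix (Fin N) (Fin N) ℂ)‖ := by
    have : Nonempty (Fin N) := ⟨⟨0, hN0⟩⟩
    exact norm_pos_iff.mpr one_ne_zero
  have hcomm : ∀ x y : Γ, Commute (σ x) (σ y) ↔ Commute (ρ x) (ρ y) := fun x y => by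
    refine ⟨fun hxy => e.injective ?_, fun hxy => ?_⟩
    · rw [map_mul, map_mul]; exact hxy
    · have := congrArg e hxy.eq
      rw [map_mul, map_mul] at this
      exact this
  have : ProperSpace (Matrix (Fin N) (Fin N) ℂ) := FiniteDimensional.proper ℂ _
  obtain ⟨H, hH, hHc⟩ := exists_finiteIndex_commute_of_central σ hΓ hM (mul_pos hδ hne1) (by
    intro H hH x hx y hy hsmall hcen
    simp only [hcomm] at hcen
    obtain ⟨μ, hμ⟩ := Module.End.exists_eigenvalue (ρ ⁅x, y⁆)
    have htop := hirr H hH (Module.End.eigenspace (ρ ⁅x, y⁆) μ) (fun g hg w hw => by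
      rw [Module.End.mem_eigenspace_iff] at hw ⊢
      have := LinearMap.congr_fun (hcen g hg).eq w
      rw [Module.End.mul_apply, Module.End.mul_apply, hw, map_smul] at this
      exact this) hμ
    have hscal : ρ ⁅x, y⁆ = μ • (1 : Module.End ℂ E) := by
      ext w
      have : w ∈ Module.End.eigenspace (ρ ⁅x, y⁆) μ := htop ▸ Submodule.mem_top
      rw [Module.End.mem_eigenspace_iff] at this
      simpa using this
    have hdet : LinearMap.det (ρ ⁅x, y⁆) = 1 := by
      have h1 : (LinearMap.det.comp ρ : Γ →* ℂ) ⁅x, y⁆ = 1 := by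
        have h2 := map_commutatorElement ((LinearMap.det.comp ρ : Γ →* ℂ).toHomUnits) x y
        rw [commutatorElement_eq_one_iff_commute.mpr (Commute.all
          ((LinearMap.det.comp ρ : Γ →* ℂ).toHomUnits x) _)] at h2
        exact congrArg Units.val h2
      exact h1
    rw [hscal, LinearMap.det_smul, map_one, mul_one, hN] at hdet
    have hs : σ ⁅x, y⁆ = μ • 1 := by rw [hσ, hscal, map_smul, map_one]
    rw [hs] at hsmall ⊢
    have hs2 : (μ • (1 : Matrix (Fin N) (Fin N) ℂ)) - 1 = (μ - 1) • 1 := by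
      rw [sub_smul, one_smul]
    rw [hs2, norm_smul] at hsmall
    rw [hroot μ hdet (lt_of_mul_lt_mul_right hsmall hne1.le), one_smul])
  exact ⟨H, hH, fun x hx y hy => (hcomm x y).mp (hHc x hx y hy)⟩

end Irreducible

universe u v

/-- A bounded finite-dimensional representation of a finitely generated group of polynomial growth
is virtually commutative. -/
theorem exists_finiteIndex_commute (N : ℕ) :
    ∀ {E : Type u} {Γ : Type v} [AddCommGroup E] [Module ℂ E]
    [FiniteDimensional ℂ E] [Group Γ] [Group.FG Γ], GroupGrowth Γ → ∀ ρ : Γ →* Module.End ℂ E,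
    (∀ (φ : Module.Dual ℂ E) (e : E), ∃ C : ℝ, ∀ g, ‖φ (ρ g e)‖ ≤ C) →
    Module.finrank ℂ E = N →
    ∃ H : Subgroup Γ, H.FiniteIndex ∧ ∀ a ∈ H, ∀ b ∈ H, Commute (ρ a) (ρ b) := by
  induction N using Nat.strong_induction_on with
  | _ N ih =>
  intro E Γ _ _ _ _ _ hΓ ρ hb hN
  rcases subsingleton_or_nontrivial E with hE | hE
  · exact ⟨⊤, inferInstance, fun a _ b _ => Subsingleton.elim _ _⟩
  by_cases hirr : ∀ H : Subgroup Γ, H.FiniteIndex → ∀ W : Submodule ℂ E,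
      (∀ g ∈ H, ∀ w ∈ W, ρ g w ∈ W) → W ≠ ⊥ → W = ⊤
  · exact exists_finiteIndex_commute_of_irreducible hΓ ρ hb hirr
  push Not at hirr
  obtain ⟨H, hH, W, hW, hWb, hWt⟩ := hirr
  let ρW : H →* Module.End ℂ W :=
    { toFun := fun g => (ρ g).restrict (hW g g.2)
      map_one' := by ext w; simp
      map_mul' := fun a b => by ext w; simp }
  let ρQ : H →* Module.End ℂ (E ⧸ W) :=
    { toFun := fun g => W.mapQ W (ρ g) (hW g g.2)
      map_one' := by ext w; simp
      map_mul' := fun a b => by ext w; simp }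
  obtain ⟨H₁, hH₁, hc₁⟩ := ih (Module.finrank ℂ W)
    (hN ▸ Submodule.finrank_lt hWt) (hΓ.subgroup H) ρW (fun φ w => by
      obtain ⟨ψ, hψ⟩ := LinearMap.exists_extend φ
      obtain ⟨C, hC⟩ := hb ψ w
      refine ⟨C, fun g => ?_⟩
      rw [← hψ]
      exact hC g) rfl
  obtain ⟨H₂, hH₂, hc₂⟩ := ih (Module.finrank ℂ (E ⧸ W)) (by
      have h1 := W.finrank_quotient_add_finrank
      have h2 : 0 < Module.finrank ℂ W :=
        Module.finrank_pos_iff.mpr (Submodule.nontrivial_iff_ne_bot.mpr hWb)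
      omega) (hΓ.subgroup H) ρQ (fun φ w => by
      obtain ⟨e, rfl⟩ := W.mkQ_surjective w
      obtain ⟨C, hC⟩ := hb (φ.comp W.mkQ) e
      exact ⟨C, fun g => hC g⟩) rfl
  refine ⟨(H₁ ⊓ H₂).map H.subtype, finiteIndex_map_subtype _, ?_⟩
  rintro _ ⟨a, ha, rfl⟩ _ ⟨b, hb', rfl⟩
  have hone : ∀ {F : Type u} [AddCommGroup F] [Module ℂ F] (τ : H →* Module.End ℂ F),
      Commute (τ a) (τ b) → τ ⁅a, b⁆ = 1 := by
    intro F _ _ τ hτ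
    have h1 : a * b = ⁅a, b⁆ * (b * a) := by rw [commutatorElement_def]; group
    have h2 : τ ⁅a, b⁆ = τ (a * b) * τ ((b * a)⁻¹) := by
      rw [← map_mul]; congr 1; rw [commutatorElement_def]; group
    rw [h2, map_mul, hτ.eq, ← map_mul, ← map_mul, mul_inv_cancel, map_one]
  have e1 := hone ρW (hc₁ a ha.1 b hb'.1)
  have e2 := hone ρQ (hc₂ a ha.2 b hb'.2)
  set g : Γ := ((⁅a, b⁆ : H) : Γ) with hg
  have f1 : ∀ w ∈ W, ρ g w = w := fun w hw => by
    have := LinearMap.congr_fun e1 ⟨w, hw⟩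
    exact congrArg Subtype.val this
  have f2 : ∀ x, ρ g x - x ∈ W := fun x => by
    have := LinearMap.congr_fun e2 (W.mkQ x)
    rw [← Submodule.Quotient.eq]
    exact this
  have f3 : ∀ (x : E) (n : ℕ), ρ (g ^ n) x = x + n • (ρ g x - x) := by
    intro x n
    induction n with
    | zero => simp
    | succ n ihn =>
      rw [pow_succ', map_mul, Module.End.mul_apply, ihn, map_add, map_nsmul, f1 _ (f2 x), add_smul,
        one_smul]
      abel
  have f4 : ρ g = 1 := by
    ext x
    rw [Module.End.one_apply, ← sub_eq_zero]
    by_contra hne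
    obtain ⟨φ, hφ⟩ := not_forall.mp
      ((Module.forall_dual_apply_eq_zero_iff ℂ (ρ g x - x)).not.mpr hne)
    obtain ⟨C, hC⟩ := hb φ x
    have hpos : 0 < ‖φ (ρ g x - x)‖ := norm_pos_iff.mpr hφ
    obtain ⟨n, hn⟩ := exists_nat_gt ((C + ‖φ x‖) / ‖φ (ρ g x - x)‖)
    rw [div_lt_iff₀ hpos] at hn
    have h1 := hC (g ^ n)
    rw [f3, map_add, map_nsmul] at h1
    have h2 : ‖n • φ (ρ g x - x)‖ = n * ‖φ (ρ g x - x)‖ := by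
      rw [← Nat.cast_smul_eq_nsmul ℂ, norm_smul]; simp
    have h3 := norm_sub_le (φ x + n • φ (ρ g x - x)) (φ x)
    rw [add_sub_cancel_left, h2] at h3
    linarith
  have e : H.subtype a * H.subtype b = g * (H.subtype b * H.subtype a) := by
    rw [hg]
    show ((a * b : H) : Γ) = ((⁅a, b⁆ * (b * a) : H) : Γ)
    congr 1
    rw [commutatorElement_def]; group
  rw [commute_iff_eq, ← map_mul, e, map_mul, f4, one_mul, map_mul]

end PolyGrowth

namespace PolyGrowth

open scoped Pointwise

/-- A transitive action of a group on a connected graph by graph automorphisms. -/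
structure GraphAction (Γ : Type*) {X : Type*} [Group Γ] [MulAction Γ X] (G : SimpleGraph X) :
    Prop where
  conn : G.Connected
  adj_smul : ∀ (g : Γ) (x y : X), G.Adj (g • x) (g • y) ↔ G.Adj x y
  trans : ∀ x y : X, ∃ g : Γ, g • x = y

/-- The distance by which a group element moves the base point. -/
noncomputable def len {Γ X : Type*} [Group Γ] [MulAction Γ X] (G : SimpleGraph X) (o : X) (g : Γ) :
    ℕ := G.dist o (g • o)

namespace GraphAction

variable {Γ X : Type*} [Group Γ] [MulAction Γ X] {G : SimpleGraph X} (A : GraphAction Γ G)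
include A

/-- The automorphism given by a group element. -/
def iso (g : Γ) : G ≃g G where
  toEquiv := MulAction.toPerm g
  map_rel_iff' := by intro x y; exact A.adj_smul g x y

theorem dist_smul (g : Γ) (x y : X) : G.dist (g • x) (g • y) = G.dist x y := by
  have key : ∀ (g : Γ) (a b : X), G.dist (g • a) (g • b) ≤ G.dist a b := by
    intro g a b
    obtain ⟨p, hp⟩ := A.conn.exists_walk_length_eq_dist a b
    rw [← hp]
    exact (SimpleGraph.dist_le (p.map (A.iso g).toHom)).trans (by rw [SimpleGraph.Walk.length_map])
  refine le_antisymm (key g x y) ?_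
  simpa using key g⁻¹ (g • x) (g • y)

theorem dist_smul_smul (o : X) (g h : Γ) : G.dist (g • o) (h • o) = len G o (g⁻¹ * h) := by
  rw [len, ← A.dist_smul g o, smul_smul, mul_inv_cancel_left]

omit A in
theorem len_one (o : X) : len G o (1 : Γ) = 0 := by simp [len]

theorem len_inv (o : X) (g : Γ) : len G o g⁻¹ = len G o g := by
  rw [len, ← A.dist_smul g, smul_inv_smul, SimpleGraph.dist_comm, len]

theorem len_mul (o : X) (g h : Γ) : len G o (g * h) ≤ len G o g + len G o h := by
  have := A.conn.dist_triangle (u := o) (v := g • o) (w := (g * h) • o)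
  rw [mul_smul, A.dist_smul] at this
  rwa [len, mul_smul]

theorem len_pow_le (o : X) (g : Γ) (n : ℕ) : len G o (g ^ n) ≤ n * len G o g := by
  induction n with
  | zero => simp [len_one]
  | succ n ih =>
    rw [pow_succ, add_mul, one_mul]
    exact (A.len_mul o _ _).trans (Nat.add_le_add_right ih _)

theorem len_mem_pow (o : X) {S : Set Γ} {C : ℕ} (hS : ∀ s ∈ S, len G o s ≤ C) (n : ℕ) :
    ∀ g ∈ S ^ n, len G o g ≤ n * C := by
  induction n with
  | zero =>
    intro g hg
    rw [pow_zero, Set.mem_one] at hg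
    simp [hg, len_one]
  | succ n ih =>
    intro g hg
    rw [pow_succ] at hg
    obtain ⟨a, ha, b, hb, rfl⟩ := Set.mem_mul.mp hg
    rw [add_mul, one_mul]
    exact (A.len_mul o a b).trans (add_le_add (ih a ha) (hS b hb))

theorem mem_pow_of_len_le (o : X) {n : ℕ} {g : Γ} (hg : len G o g ≤ n + 1) :
    g ∈ {s : Γ | len G o s ≤ 1} ^ (n + 1) := by
  induction n generalizing g with
  | zero => simpa using hg
  | succ n ih =>
    rcases hg.lt_or_eq with h1 | h1
    · exact Set.pow_subset_pow_right (by simp [len_one]) (Nat.le_succ _) (ih (by omega))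
    · rw [len] at h1
      obtain ⟨y, hy⟩ : ∃ y, y = g • o := ⟨_, rfl⟩
      rw [← hy] at h1
      obtain ⟨p, hp⟩ := A.conn.exists_walk_length_eq_dist o y
      cases p with
      | nil => simp at h1
      | @cons _ z _ hz q =>
        obtain ⟨s, hs⟩ := A.trans o z
        have h2 : len G o (s⁻¹ * g) ≤ n + 1 := by
          rw [← A.dist_smul_smul, hs, ← hy]
          have := SimpleGraph.dist_le q
          rw [SimpleGraph.Walk.length_cons] at hp
          omega
        rw [pow_succ', ← mul_inv_cancel_left s g]
        refine Set.mul_mem_mul ?_ (ih h2)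
        show G.dist o (s • o) ≤ 1
        rw [hs]
        exact (SimpleGraph.dist_eq_one_iff_adj.mpr hz).le

theorem closure_len_le_one (o : X) : Subgroup.closure {s : Γ | len G o s ≤ 1} = ⊤ := by
  refine eq_top_iff.mpr fun g _ => ?_
  have := A.mem_pow_of_len_le o (Nat.le_succ (len G o g))
  have h2 : ∀ n, {s : Γ | len G o s ≤ 1} ^ n ⊆ Subgroup.closure {s : Γ | len G o s ≤ 1} := by
    intro n
    induction n with
    | zero => simp
    | succ n ih =>
      rw [pow_succ]
      rintro _ ⟨a, ha, b, hb, rfl⟩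
      exact Subgroup.mul_mem _ (ih ha) (Subgroup.subset_closure hb)
  exact h2 _ this

/-- A subgroup of finite index is generated by elements of bounded length. -/
theorem exists_closure_len_le (o : X) (H : Subgroup Γ) [H.FiniteIndex] :
    ∃ C, Subgroup.closure {g : Γ | g ∈ H ∧ len G o g ≤ C} = H := by
  obtain ⟨R, hR, hR1⟩ := H.exists_isComplement_right 1
  have hRf : R.Finite := hR.finite_right
  obtain ⟨C, hC⟩ := (hRf.image (len G o)).bddAbove
  have hC' : ∀ r ∈ R, len G o r ≤ C := fun r hr => hC ⟨r, hr, rfl⟩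
  refine ⟨C + 1 + C, le_antisymm ((Subgroup.closure_le _).mpr fun g hg => hg.1) ?_⟩
  conv_lhs => rw [← Subgroup.closure_mul_image_eq hR hR1 (A.closure_len_le_one o)]
  refine Subgroup.closure_mono ?_
  rintro _ ⟨g, hg, rfl⟩
  refine ⟨hR.mul_inv_toRightFun_mem g, ?_⟩
  obtain ⟨r, hr, s, hs, rfl⟩ := Set.mem_mul.mp hg
  refine (A.len_mul o _ _).trans
    (add_le_add ((A.len_mul o _ _).trans (add_le_add (hC' r hr) hs)) ?_)
  rw [A.len_inv]
  exact hC' _ (hR.toRightFun (r * s)).2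

theorem transGraph [G.LocallyFinite] [Infinite X] : TransGraph G where
  conn := A.conn
  trans u v := by
    obtain ⟨g, hg⟩ := A.trans u v
    exact ⟨A.iso g, hg⟩
  deg_pos v := A.conn.preconnected.degree_pos_of_nontrivial v

end GraphAction

/-- A homomorphism with finite image of the stabilizer has an image of polynomial growth. -/
theorem groupGrowth_of_finite_image {Γ X Δ : Type*} [Group Γ] [MulAction Γ X] {G : SimpleGraph X}
    [G.LocallyFinite] [Group Δ] (A : GraphAction Γ G) (h : TransGraph G) {k : ℕ} (hk : h.Growth k)
    (o : X) (H : Subgroup Γ) (f : H →* Δ) (hf : Function.Surjective f)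
    (hfin : (f '' {g | (g : Γ) • o = o}).Finite) : GroupGrowth Δ := by
  classical
  obtain ⟨c, hc, hg⟩ := hk
  refine ⟨k, fun S hS => ?_⟩
  obtain ⟨σ, hσ⟩ : ∃ σ : Δ → H, ∀ x, f (σ x) = x := ⟨_, Function.surjInv_eq hf⟩
  obtain ⟨C, hC⟩ := (hS.image (fun s => len G o (σ s : Γ))).bddAbove
  have hC' : ∀ s ∈ S, len G o (σ s : Γ) ≤ C + 1 := fun s hs => (hC ⟨s, hs, rfl⟩).trans (by omega)
  set F := f '' {g : H | (g : Γ) • o = o}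
  have hrep : ∀ x : X, ∃ d : Δ, ∀ g : H, (g : Γ) • o = x → d⁻¹ * f g ∈ F := by
    intro x
    by_cases hx : ∃ g : H, (g : Γ) • o = x
    · obtain ⟨g₀, hg₀⟩ := hx
      refine ⟨f g₀, fun g hg => ⟨g₀⁻¹ * g, ?_, by rw [map_mul, map_inv]⟩⟩
      show ((g₀⁻¹ * g : H) : Γ) • o = o
      rw [Subgroup.coe_mul, mul_smul, hg, ← hg₀, Subgroup.coe_inv, inv_smul_smul]
    · exact ⟨1, fun g hg => absurd ⟨g, hg⟩ hx⟩
  choose d hd using hrep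
  refine ⟨c * (C + 1) ^ k * F.ncard, fun n hn => ?_⟩
  have hsub : S ^ n ⊆ (d '' (h.ball o (n * (C + 1)) : Set X)) * F := by
    intro s hs
    have : ∀ m, ∀ s ∈ S ^ m, ∃ g : H, f g = s ∧ len G o (g : Γ) ≤ m * (C + 1) := by
      intro m
      induction m with
      | zero =>
        intro s hs
        rw [pow_zero, Set.mem_one] at hs
        exact ⟨1, by rw [map_one, hs], by simp [GraphAction.len_one]⟩
      | succ m ih =>
        intro s hs
        rw [pow_succ] at hs
        obtain ⟨a, ha, b, hb, rfl⟩ := Set.mem_mul.mp hs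
        obtain ⟨g, hga, hgl⟩ := ih a ha
        refine ⟨g * σ b, by rw [map_mul, hσ, hga], ?_⟩
        rw [add_mul, one_mul, Subgroup.coe_mul]
        exact (A.len_mul o _ _).trans (add_le_add hgl (hC' b hb))
    obtain ⟨g, rfl, hgl⟩ := this n s hs
    refine ⟨d ((g : Γ) • o), ⟨_, ?_, rfl⟩, _, hd _ g rfl, by simp⟩
    simpa [len] using hgl
  have h1 := Set.ncard_le_ncard hsub (((Finset.finite_toSet _).image d).mul hfin)
  have h2 : ((d '' (h.ball o (n * (C + 1)) : Set X)) * F).ncard ≤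
      (h.ball o (n * (C + 1))).card * F.ncard := by
    refine Set.natCard_mul_le.trans (Nat.mul_le_mul_right _ ?_)
    refine (Set.ncard_image_le (Finset.finite_toSet _)).trans ?_
    rw [Set.ncard_coe_finset]
  have h3 := hg o (n * (C + 1)) (by nlinarith)
  have h4 : ((S ^ n).ncard : ℝ) ≤ (h.ball o (n * (C + 1))).card * F.ncard := by
    exact_mod_cast h1.trans h2
  refine h4.trans ?_
  calc _ ≤ c * ((n * (C + 1) : ℕ) : ℝ) ^ k * F.ncard := by gcongr
    _ = _ := by push_cast; rw [mul_pow]; ring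

end PolyGrowth

namespace PolyGrowth
open TransGraph

open scoped Pointwise

theorem exists_surjective_int_of_infinite {A : Type*} [CommGroup A] [Group.FG A] [Infinite A] :
    ∃ φ : A →* Multiplicative ℤ, Function.Surjective φ := by
  obtain ⟨n, ι, _, p, hp, e, ⟨E⟩⟩ := AddCommGroup.equiv_free_prod_directSum_zmod (Additive A)
  rcases Nat.eq_zero_or_pos n with hn | hn
  · exfalso
    subst hn
    have : ∀ i, NeZero (p i ^ e i) := fun i => ⟨pow_ne_zero _ (hp i).ne_zero⟩
    have h1 : Finite (DirectSum ι fun i => ZMod (p i ^ e i)) := by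
      classical
      exact Finite.of_equiv _ (DirectSum.addEquivProd (fun i => ZMod (p i ^ e i))).symm.toEquiv
    have h2 : Finite (Additive A) := Finite.of_equiv _ E.symm.toEquiv
    exact not_finite (Additive A)
  · let i : Fin n := ⟨0, hn⟩
    refine ⟨MonoidHom.mk' (fun a => Multiplicative.ofAdd ((E (Additive.ofMul a)).1 i)) ?_, ?_⟩
    · intro a b
      simp [ofMul_mul, ofAdd_add]
    · intro z
      obtain ⟨a, ha⟩ := E.surjective (Finsupp.single i z.toAdd, 0)
      refine ⟨a.toMul, ?_⟩
      simp [ha]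

/-- A variant for commutative images. -/
theorem exists_surjective_int_of_commute {A : Type*} [Group A] [Group.FG A] [Infinite A]
    (hA : ∀ a b : A, Commute a b) : ∃ φ : A →* Multiplicative ℤ, Function.Surjective φ := by
  let _ : CommGroup A := { (inferInstance : Group A) with mul_comm := fun a b => (hA a b).eq }
  exact exists_surjective_int_of_infinite

variable {Γ X : Type*} [Group Γ] [MulAction Γ X] {G : SimpleGraph X} [G.LocallyFinite]
  (A : GraphAction Γ G)

namespace GraphAction

include A in
theorem harm_smul (g : Γ) {f : X → ℝ} (hf : Harm G f) : Harm G (fun x => f (g • x)) := by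
  have := lazyWalk_comp_iso (A.iso g) f
  rw [hf] at this
  exact this

omit [G.LocallyFinite] in
include A in
theorem lip_smul (g : Γ) {f : X → ℝ} {L : ℝ} (hf : Lip G L f) : Lip G L (fun x => f (g • x)) :=
  fun _ _ hxy => hf _ _ ((A.adj_smul g _ _).mpr hxy)

theorem harm_sub_const (h : TransGraph G) {f : X → ℝ} (hf : Harm G f) (c : ℝ) :
    Harm G (fun x => f x - c) := by
  have h1 : (fun x => f x - c) = f - c • (fun _ => (1 : ℝ)) := by
    funext x; simp
  rw [h1, Harm, map_sub, map_smul, hf]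
  congr 2
  have := h.lazyWalk_one
  exact this

/-- The action on Lipschitz harmonic functions vanishing at the base point. -/
noncomputable def rep (h : TransGraph G) (o : X) : Γ →* Module.End ℝ (lhf G o) where
  toFun g :=
    { toFun := fun f => ⟨fun x => f.1 (g⁻¹ • x) - f.1 (g⁻¹ • o),
        harm_sub_const h (A.harm_smul g⁻¹ f.2.1) _, by
          obtain ⟨L, hL, hf⟩ := f.2.2.1
          refine ⟨L, hL, fun x y hxy => ?_⟩
          rw [sub_sub_sub_cancel_right]
          exact A.lip_smul g⁻¹ hf x y hxy, sub_self _⟩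
      map_add' := fun f f' => by
        ext x
        simp only [Submodule.coe_add, Pi.add_apply]
        ring
      map_smul' := fun c f => by
        ext x
        simp only [Submodule.coe_smul, Pi.smul_apply, smul_eq_mul, RingHom.id_apply]
        ring }
  map_one' := by
    ext f x
    have : f.1 o = 0 := f.2.2.2
    simp [this]
  map_mul' a b := by
    ext f x
    simp only [LinearMap.coe_mk, AddHom.coe_mk, Module.End.mul_apply, mul_inv_rev, mul_smul]
    ring

theorem rep_apply (h : TransGraph G) (o : X) (g : Γ) (f : lhf G o) (x : X) :
    (A.rep h o g f).1 x = f.1 (g⁻¹ • x) - f.1 (g⁻¹ • o) := rfl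

end GraphAction

/-- Finitely many evaluations separate the Lipschitz harmonic functions. -/
theorem exists_ball_separating (h : TransGraph G) {k : ℕ} (hk : h.Growth k) (o : X) :
    ∃ n : ℕ, ∀ f : lhf G o, (∀ x, G.dist o x ≤ n → f.1 x = 0) → f = 0 := by
  have := h.finite_lhf hk o
  let K : ℕ →o (Submodule ℝ (lhf G o))ᵒᵈ :=
    { toFun := fun n => OrderDual.toDual
        { carrier := {f | ∀ x, G.dist o x ≤ n → f.1 x = 0}
          zero_mem' := fun x _ => rfl
          add_mem' := fun {f g} hf hg x hx => by
            rw [Submodule.coe_add, Pi.add_apply, hf x hx, hg x hx, add_zero]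
          smul_mem' := fun c f hf x hx => by
            rw [Submodule.coe_smul, Pi.smul_apply, hf x hx, smul_zero] }
      monotone' := fun m n hmn f hf x hx => hf x (hx.trans hmn) }
  obtain ⟨n, hn⟩ := IsArtinian.monotone_stabilizes K
  refine ⟨n, fun f hf => Subtype.ext (funext fun x => ?_)⟩
  have h1 : f ∈ OrderDual.ofDual (K n) := hf
  rw [hn (max n (G.dist o x)) (le_max_left _ _)] at h1
  exact h1 x (le_max_right _ _)

theorem finite_rep_image (h : TransGraph G) {k : ℕ} (hk : h.Growth k) (o : X) (C : ℕ) :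
    (A.rep h o '' {g | len G o g ≤ C}).Finite := by
  obtain ⟨n, hn⟩ := exists_ball_separating h hk o
  let B := h.ball o n
  let B' := h.ball o (n + C)
  have hmem : ∀ g : Γ, len G o g ≤ C → ∀ x ∈ B, g⁻¹ • x ∈ B' := by
    intro g hg x hx
    rw [h.mem_ball] at hx ⊢
    have h1 := A.conn.dist_triangle (u := o) (v := g⁻¹ • o) (w := g⁻¹ • x)
    rw [A.dist_smul] at h1
    have h2 : G.dist o (g⁻¹ • o) ≤ C := by
      have := A.len_inv o g
      rw [len] at this
      omega
    omega
  let Φ : {g : Γ // len G o g ≤ C} → (B → B') := fun g x => ⟨(g : Γ)⁻¹ • (x : X), hmem g g.2 x x.2⟩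
  have hΦ : ∀ a b, Φ a = Φ b → A.rep h o a = A.rep h o b := by
    intro a b hab
    have hx : ∀ x ∈ B, (a : Γ)⁻¹ • x = (b : Γ)⁻¹ • x := fun x hx =>
      congrArg Subtype.val (congrFun hab ⟨x, hx⟩)
    ext1 f
    rw [← sub_eq_zero]
    refine hn _ fun x hx' => ?_
    rw [Submodule.coe_sub, Pi.sub_apply, A.rep_apply, A.rep_apply, hx x (by simpa [B] using hx'),
      hx o (by simp [B]), sub_self]
  have : (A.rep h o '' {g | len G o g ≤ C}) = Set.range fun g : {g : Γ // len G o g ≤ C} =>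
      A.rep h o g := by
    ext y; simp
  rw [this]
  have hfac : (fun g : {g : Γ // len G o g ≤ C} => A.rep h o g) =
      (Function.extend Φ (fun g => A.rep h o g) 1) ∘ Φ := by
    funext g
    exact (Function.FactorsThrough.extend_apply (f := Φ)
      (g := fun g : {g : Γ // len G o g ≤ C} => A.rep h o g) (fun a b hab => hΦ a b hab) 1 g).symm
  rw [hfac]
  exact (Set.finite_range _).subset (Set.range_comp_subset_range _ _)

theorem rep_bounded (h : TransGraph G) {k : ℕ} (hk : h.Growth k) (o : X)
    (φ : Module.Dual ℝ (lhf G o)) (f : lhf G o) : ∃ C : ℝ, ∀ g, |φ (A.rep h o g f)| ≤ C := by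
  classical
  obtain ⟨n, hn⟩ := exists_ball_separating h hk o
  let ev : lhf G o →ₗ[ℝ] (h.ball o n → ℝ) :=
    { toFun := fun f x => f.1 x
      map_add' := fun f g => rfl
      map_smul' := fun c f => rfl }
  have hev : LinearMap.ker ev = ⊥ := by
    rw [LinearMap.ker_eq_bot']
    intro f hf
    exact hn f fun x hx => congrFun hf ⟨x, by simpa using hx⟩
  obtain ⟨s, hs⟩ := ev.exists_leftInverse_of_injective hev
  obtain ⟨L, hL, hf⟩ := f.2.2.1
  refine ⟨∑ x : h.ball o n, L * n * |φ (s (Pi.single x 1))|, fun g => ?_⟩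
  have e : φ (A.rep h o g f) = ∑ x : h.ball o n,
      (A.rep h o g f).1 x * φ (s (Pi.single x 1)) := by
    conv_lhs => rw [← LinearMap.id_apply (R := ℝ) (A.rep h o g f), ← hs, LinearMap.comp_apply]
    rw [pi_eq_sum_univ' (ev (A.rep h o g f)), map_sum, map_sum]
    refine Finset.sum_congr rfl fun x _ => ?_
    rw [map_smul, map_smul, smul_eq_mul]
    congr 4
  rw [e]
  refine (Finset.abs_sum_le_sum_abs _ _).trans (Finset.sum_le_sum fun x _ => ?_)
  rw [abs_mul]
  refine mul_le_mul_of_nonneg_right ?_ (abs_nonneg _)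
  rw [A.rep_apply]
  refine (h.abs_sub_le_dist hf _ _).trans ?_
  rw [A.dist_smul, SimpleGraph.dist_comm]
  have : G.dist o (x : X) ≤ n := (h.mem_ball).mp x.2
  gcongr

end PolyGrowth

namespace PolyGrowth
open TransGraph

open scoped Pointwise TensorProduct

namespace GraphAction

theorem norm_baseChange_bounded {M Δ : Type*} [AddCommGroup M] [Module ℝ M]
    (ρ : Δ → Module.End ℝ M)
    (hρ : ∀ (φ : Module.Dual ℝ M) (f : M), ∃ C : ℝ, ∀ g, |φ (ρ g f)| ≤ C)
    (φ : Module.Dual ℂ (ℂ ⊗[ℝ] M)) (e : ℂ ⊗[ℝ] M) :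
    ∃ C : ℝ, ∀ g, ‖φ ((ρ g).baseChange ℂ e)‖ ≤ C := by
  induction e with
  | zero => exact ⟨0, fun g => by simp⟩
  | add x y hx hy =>
    obtain ⟨C, hC⟩ := hx
    obtain ⟨C', hC'⟩ := hy
    refine ⟨C + C', fun g => ?_⟩
    rw [map_add, map_add]
    exact (norm_add_le _ _).trans (add_le_add (hC g) (hC' g))
  | tmul z f =>
    let ψ : M →ₗ[ℝ] ℂ := (φ.restrictScalars ℝ).comp (TensorProduct.mk ℝ ℂ M z)
    obtain ⟨C, hC⟩ := hρ (Complex.reLm.comp ψ) f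
    obtain ⟨C', hC'⟩ := hρ (Complex.imLm.comp ψ) f
    refine ⟨C + C', fun g => ?_⟩
    rw [LinearMap.baseChange_tmul]
    exact (Complex.norm_le_abs_re_add_abs_im _).trans (add_le_add (hC g) (hC' g))

variable {Γ X : Type*} [Group Γ] [MulAction Γ X] {G : SimpleGraph X} [G.LocallyFinite]
  (A : GraphAction Γ G)

theorem baseChange_complex_injective {M : Type*} [AddCommGroup M] [Module ℝ M]
    {f g : Module.End ℝ M} (hfg : f.baseChange ℂ = g.baseChange ℂ) : f = g := by
  ext m
  have h1 : (1 : ℂ) ⊗ₜ[ℝ] f m = (1 : ℂ) ⊗ₜ[ℝ] g m := by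
    rw [← LinearMap.baseChange_tmul, hfg, LinearMap.baseChange_tmul]
  exact Module.FaithfullyFlat.tensorProduct_mk_injective (A := ℝ) (B := ℂ) M h1

theorem exists_finiteIndex_commute_rep (h : TransGraph G) {k : ℕ} (hk : h.Growth k) (o : X) :
    Group.FG (A.rep h o).toHomUnits.range ∧
    ∃ H : Subgroup (A.rep h o).toHomUnits.range, H.FiniteIndex ∧ ∀ a b : H, Commute a b := by
  have := h.finite_lhf hk o
  set Δ := (A.rep h o).toHomUnits.range with hΔ
  have hfin : ∀ C, ((A.rep h o).toHomUnits '' {g | len G o g ≤ C}).Finite := fun C => by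
    refine Set.Finite.of_finite_image (f := Units.val) ?_ Units.val_injective.injOn
    rw [Set.image_image]
    exact finite_rep_image A h hk o C
  have hfg : Group.FG Δ := by
    rw [Group.fg_iff_subgroup_fg, Subgroup.fg_iff]
    refine ⟨_, ?_, hfin 1⟩
    rw [← MonoidHom.map_closure, A.closure_len_le_one, ← MonoidHom.range_eq_map]
  refine ⟨hfg, ?_⟩
  have hgrowth : GroupGrowth Δ := by
    refine groupGrowth_of_finite_image A h hk o ⊤
      ((A.rep h o).toHomUnits.rangeRestrict.comp (Subgroup.subtype ⊤)) ?_ ?_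
    · rw [MonoidHom.coe_comp]
      exact (MonoidHom.rangeRestrict_surjective _).comp fun g => ⟨⟨g, trivial⟩, rfl⟩
    · refine Set.Finite.of_finite_image (f := Subtype.val) ?_ Subtype.val_injective.injOn
      refine (hfin 0).subset ?_
      rintro _ ⟨_, ⟨g, hg, rfl⟩, rfl⟩
      refine ⟨g, ?_, rfl⟩
      have hg' : (g : Γ) • o = o := hg
      simp [len, hg']
  let ρ : Δ →* Module.End ℂ (ℂ ⊗[ℝ] lhf G o) :=
    ((Module.End.baseChangeHom ℝ ℂ (lhf G o) : _ →ₐ[ℝ] _) : _ →* _).comp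
      ((Units.coeHom _).comp Δ.subtype)
  have hρ : ∀ g : Δ, ρ g =
      LinearMap.baseChange ℂ ((g : (Module.End ℝ (lhf G o))ˣ) : Module.End ℝ (lhf G o)) :=
    fun g => rfl
  obtain ⟨H, hH, hc⟩ := exists_finiteIndex_commute _ hgrowth ρ (fun φ e => by
    refine norm_baseChange_bounded
      (fun g : Δ => ((g : (Module.End ℝ (lhf G o))ˣ) : Module.End ℝ (lhf G o))) ?_ φ e
    intro φ f
    obtain ⟨C, hC⟩ := rep_bounded A h hk o φ f
    refine ⟨C, ?_⟩
    rintro ⟨_, g, rfl⟩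
    exact hC g) rfl
  refine ⟨H, hH, fun a b => ?_⟩
  have h1 := hc a a.2 b b.2
  have h2 : ρ (a * b : H) = ρ (b * a : H) := by
    rw [Subgroup.coe_mul, Subgroup.coe_mul, map_mul, map_mul]; exact h1
  rw [hρ, hρ] at h2
  exact Subtype.ext (Subtype.ext (Units.ext (baseChange_complex_injective h2)))

theorem exists_hom_int_of_infinite_range (h : TransGraph G) {k : ℕ} (hk : h.Growth k) (o : X)
    [Infinite (A.rep h o).toHomUnits.range] :
    ∃ (Γ' : Subgroup Γ) (_ : Γ'.FiniteIndex) (φ : Γ' →* Multiplicative ℤ),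
      Function.Surjective φ ∧ ∀ C, (φ '' {g | len G o (g : Γ) ≤ C}).Finite := by
  obtain ⟨hfg, H, hH, hc⟩ := A.exists_finiteIndex_commute_rep h hk o
  have hinf : Infinite H := by
    by_contra hcon
    rw [not_infinite_iff_finite] at hcon
    have h2 := Nat.finite_of_card_ne_zero (α := (A.rep h o).toHomUnits.range) (by
      rw [← H.card_mul_index]
      exact mul_ne_zero Nat.card_pos.ne' hH.index_ne_zero)
    exact not_finite (A.rep h o).toHomUnits.range
  obtain ⟨ψ, hψ⟩ := exists_surjective_int_of_commute hc
  let q := (A.rep h o).toHomUnits.rangeRestrict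
  refine ⟨H.comap q, ⟨by
    rw [Subgroup.index_comap_of_surjective H (MonoidHom.rangeRestrict_surjective _)]
    exact hH.index_ne_zero⟩, ψ.comp (q.subgroupComap H), ?_, fun C => ?_⟩
  · rw [MonoidHom.coe_comp]
    refine hψ.comp ?_
    rintro ⟨y, hy⟩
    obtain ⟨g, rfl⟩ := MonoidHom.rangeRestrict_surjective _ y
    exact ⟨⟨g, hy⟩, rfl⟩
  · rw [MonoidHom.coe_comp, Set.image_comp]
    refine Set.Finite.image _ ?_
    refine Set.Finite.of_finite_image
      (f := fun y : H => (((y : (A.rep h o).toHomUnits.range) : (Module.End ℝ (lhf G o))ˣ) :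
        Module.End ℝ (lhf G o))) ?_ ?_
    · rw [Set.image_image]
      refine (finite_rep_image A h hk o C).subset ?_
      rintro _ ⟨g, hg, rfl⟩
      exact ⟨g, hg, rfl⟩
    · exact (Units.val_injective.comp (Subtype.val_injective.comp Subtype.val_injective)).injOn

theorem exists_hom_int_of_finite_range (h : TransGraph G) [Infinite X] {k : ℕ} (hk : h.Growth k)
    (o : X) [Finite (A.rep h o).toHomUnits.range] :
    ∃ (Γ' : Subgroup Γ) (_ : Γ'.FiniteIndex) (φ : Γ' →* Multiplicative ℤ),
      Function.Surjective φ ∧ ∀ C, (φ '' {g | len G o (g : Γ) ≤ C}).Finite := by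
  obtain ⟨f, hf⟩ := h.exists_lhf_ne_zero hk o
  have hfo : f.1 o = 0 := f.2.2.2
  let K := (A.rep h o).toHomUnits.ker
  have hKfin : K.FiniteIndex := Subgroup.finiteIndex_ker _
  have hK : ∀ g : K, ∀ x, f.1 ((g : Γ) • x) = f.1 x + f.1 ((g : Γ) • o) := by
    intro g x
    have h1 : A.rep h o (g : Γ)⁻¹ = 1 := congrArg Units.val (K.inv_mem g.2 : _ ∈ K)
    have h2 := A.rep_apply h o (g : Γ)⁻¹ f x
    rw [h1, inv_inv, Module.End.one_apply] at h2
    linarith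
  let θ : K →* Multiplicative ℝ := MonoidHom.mk' (fun g => Multiplicative.ofAdd (f.1 ((g : Γ) • o)))
    (fun a b => by
      rw [← ofAdd_add, Subgroup.coe_mul, mul_smul, hK, add_comm])
  have hθfin : ∀ C, (θ '' {g | len G o (g : Γ) ≤ C}).Finite := by
    intro C
    refine (((h.ball o C).finite_toSet).image fun x => Multiplicative.ofAdd (f.1 x)).subset ?_
    rintro _ ⟨g, hg, rfl⟩
    exact ⟨(g : Γ) • o, by rw [Finset.mem_coe, h.mem_ball]; exact hg, rfl⟩
  have hfg : Group.FG θ.range := by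
    obtain ⟨C, hC⟩ := A.exists_closure_len_le o K
    rw [Group.fg_iff_subgroup_fg, Subgroup.fg_iff]
    refine ⟨_, ?_, hθfin C⟩
    rw [← MonoidHom.map_closure, MonoidHom.range_eq_map]
    congr 1
    apply Subgroup.map_injective K.subtype_injective
    rw [MonoidHom.map_closure, ← MonoidHom.range_eq_map, Subgroup.range_subtype]
    convert hC using 2
    ext g
    simp [and_comm]
  have hne : ∃ g, θ g ≠ 1 := by
    by_contra! hcon
    have hK' : ∀ g ∈ K, ∀ x, f.1 (g • x) = f.1 x := by
      intro g hg x
      have h1 : f.1 (g • o) = 0 := hcon ⟨g, hg⟩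
      rw [hK ⟨g, hg⟩ x, h1, add_zero]
    obtain ⟨R, hR, -⟩ := K.exists_isComplement_right 1
    have hRf : R.Finite := hR.finite_right
    obtain ⟨M, hM⟩ := (hRf.image fun r => |f.1 (r • o)|).bddAbove
    have hbd : ∀ x, |f.1 x| ≤ M := by
      intro x
      obtain ⟨g, rfl⟩ := A.trans o x
      obtain ⟨⟨a, r⟩, har⟩ := hR.surjective g
      rw [← har]
      dsimp only
      rw [mul_smul, hK' _ a.2]
      exact hM ⟨r, r.2, rfl⟩
    exact hf (Subtype.ext (funext fun x => by
      rw [h.eq_of_harm_of_bounded hk f.2.1 hbd x o, hfo]; rfl))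
  have hinf : Infinite θ.range := by
    obtain ⟨g, hg⟩ := hne
    refine Infinite.of_injective (fun n : ℕ => (⟨θ (g ^ n), _, rfl⟩ : θ.range)) ?_
    intro m n hmn
    have h1 : θ (g ^ m) = θ (g ^ n) := congrArg Subtype.val hmn
    rw [map_pow, map_pow] at h1
    have h2 : (m : ℝ) * (θ g).toAdd = n * (θ g).toAdd := by
      have := congrArg Multiplicative.toAdd h1
      simpa using this
    exact_mod_cast
      mul_right_cancel₀ (fun h0 => hg (by simpa using congrArg Multiplicative.ofAdd h0)) h2
  obtain ⟨ψ, hψ⟩ := exists_surjective_int_of_infinite (A := θ.range)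
  refine ⟨K, hKfin, ψ.comp θ.rangeRestrict, ?_, fun C => ?_⟩
  · rw [MonoidHom.coe_comp]
    exact hψ.comp θ.rangeRestrict_surjective
  · rw [MonoidHom.coe_comp, Set.image_comp]
    refine Set.Finite.image _ (Set.Finite.of_finite_image (f := Subtype.val) ?_
      Subtype.val_injective.injOn)
    rw [Set.image_image]
    exact hθfin C

include A in
theorem exists_hom_int (h : TransGraph G) [Infinite X] {k : ℕ} (hk : h.Growth k) (o : X) :
    ∃ (Γ' : Subgroup Γ) (_ : Γ'.FiniteIndex) (φ : Γ' →* Multiplicative ℤ),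
      Function.Surjective φ ∧ ∀ C, (φ '' {g | len G o (g : Γ) ≤ C}).Finite := by
  rcases finite_or_infinite (A.rep h o).toHomUnits.range
  · exact A.exists_hom_int_of_finite_range h hk o
  · exact A.exists_hom_int_of_infinite_range h hk o

end GraphAction

end PolyGrowth

namespace PolyGrowth
open TransGraph

open scoped Pointwise

namespace GraphAction

variable {Γ X : Type*} [Group Γ] [MulAction Γ X] {G : SimpleGraph X} [G.LocallyFinite]
  (A : GraphAction Γ G)

theorem exists_two_pow_gt (c : ℝ) (k D : ℕ) :
    ∃ j : ℕ, 1 ≤ j ∧ c * ((j * D : ℕ) : ℝ) ^ k < 2 ^ j := by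
  have h1 := (tendsto_pow_const_div_const_pow_of_one_lt k (one_lt_two (α := ℝ))).const_mul
    (c * (D : ℝ) ^ k)
  rw [mul_zero] at h1
  obtain ⟨j, hj, hj1⟩ := ((h1.eventually_lt_const one_pos).and (eventually_ge_atTop 1)).exists
  refine ⟨j, hj1, ?_⟩
  rw [← mul_div_assoc, div_lt_one (by positivity)] at hj
  push_cast
  rw [mul_pow]
  linarith

omit [G.LocallyFinite] in
/-- The orbit points supplied by a sequence of conjugates each of which escapes the subgroup
generated by its predecessors. -/
theorem exists_finset_of_escaping [DecidableEq Γ] (o : X) (t : Γ) (e : ℕ → Γ) (L : ℕ → Subgroup Γ)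
    (hL : Monotone L) {K : Subgroup Γ} (hLK : ∀ j, L j ≤ K)
    (hstab : ∀ g ∈ K, g • o = o → g ∈ L 0)
    (hmem : ∀ j, t ^ (j + 1) * e j * (t ^ (j + 1))⁻¹ ∈ L (j + 1))
    (hnot : ∀ j, t ^ (j + 1) * e j * (t ^ (j + 1))⁻¹ ∉ L j)
    {D : ℕ} (hD : ∀ j, len G o (e j) + len G o t ≤ D) (A : GraphAction Γ G) (j : ℕ) :
    ∃ F : Finset Γ, F.card = 2 ^ j ∧ (∀ g ∈ F, g ∈ L j) ∧ Set.InjOn (fun g : Γ => g • o) F ∧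
      ∀ g ∈ F, len G o ((t ^ j)⁻¹ * g) ≤ j * D := by
  induction j with
  | zero => exact ⟨{1}, by simp, by simp, by simp, by simp [len_one]⟩
  | succ j ih =>
    obtain ⟨F, hc, hFL, hinj, hlen⟩ := ih
    set x := t ^ (j + 1) * e j * (t ^ (j + 1))⁻¹ with hx
    have hcross : ∀ g ∈ F, ∀ g' ∈ F, (x * g) • o ≠ g' • o := by
      intro g hg g' hg' heq
      have h1 : (g'⁻¹ * (x * g)) • o = o := by rw [mul_smul, heq, inv_smul_smul]
      have h2 : g'⁻¹ * (x * g) ∈ K := K.mul_mem (K.inv_mem (hLK _ (hFL _ hg')))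
        (K.mul_mem (hLK _ (hmem j)) (hLK _ (hFL _ hg)))
      have h3 := hL (Nat.zero_le j) (hstab _ h2 h1)
      apply hnot j
      have h4 : x = g' * (g'⁻¹ * (x * g)) * g⁻¹ := by group
      rw [← hx, h4]
      exact (L j).mul_mem ((L j).mul_mem (hFL _ hg') h3) ((L j).inv_mem (hFL _ hg))
    refine ⟨F ∪ F.image (x * ·), ?_, ?_, ?_, ?_⟩
    · rw [Finset.card_union_of_disjoint, Finset.card_image_of_injective _ (mul_right_injective x),
        hc, pow_succ, mul_two]
      rw [Finset.disjoint_left]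
      intro g' hg' h2
      obtain ⟨g, hg, hgg⟩ := Finset.mem_image.mp h2
      exact hcross g hg g' hg' (congrArg (· • o) hgg)
    · intro g hg
      rcases Finset.mem_union.mp hg with hg | hg
      · exact hL (Nat.le_succ j) (hFL g hg)
      · obtain ⟨g, hg', rfl⟩ := Finset.mem_image.mp hg
        exact (L (j + 1)).mul_mem (hmem j) (hL (Nat.le_succ j) (hFL g hg'))
    · intro a ha b hb hab
      rw [Finset.coe_union, Finset.coe_image] at ha hb
      rcases ha with ha | ⟨a, ha, rfl⟩ <;> rcases hb with hb | ⟨b, hb, rfl⟩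
      · exact hinj ha hb hab
      · exact (hcross b hb a ha hab.symm).elim
      · exact (hcross a ha b hb hab).elim
      · have : a • o = b • o := by
          have h3 : (x * a) • o = (x * b) • o := hab
          rwa [mul_smul x a, mul_smul x b, smul_left_cancel_iff] at h3
        simp only [hinj ha hb this]
    · intro g hg
      rcases Finset.mem_union.mp hg with hg | hg
      · have h1 : (t ^ (j + 1))⁻¹ * g = t⁻¹ * ((t ^ j)⁻¹ * g) := by rw [pow_succ]; group
        rw [h1]
        have h2 := A.len_mul o t⁻¹ ((t ^ j)⁻¹ * g)
        rw [A.len_inv] at h2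
        have := hlen g hg
        have := hD j
        rw [add_mul]
        omega
      · obtain ⟨g, hg', rfl⟩ := Finset.mem_image.mp hg
        have h1 : (t ^ (j + 1))⁻¹ * (x * g) = (e j * t⁻¹) * ((t ^ j)⁻¹ * g) := by
          rw [hx, pow_succ]; group
        rw [h1]
        have h2 := A.len_mul o (e j * t⁻¹) ((t ^ j)⁻¹ * g)
        have h3 := A.len_mul o (e j) t⁻¹
        rw [A.len_inv] at h3
        have := hlen g hg'
        have := hD j
        rw [add_mul]
        omega

include A in
theorem conj_mem_closure_of_growth (h : TransGraph G) {k : ℕ} (hk : h.Growth k) (o : X)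
    (K : Subgroup Γ) (t : Γ) (ht : ∀ g ∈ K, t * g * t⁻¹ ∈ K) (C : ℕ) :
    ∃ C', ∀ i : ℕ, ∀ e ∈ K, len G o e ≤ C →
      t ^ i * e * (t ^ i)⁻¹ ∈ Subgroup.closure {g : Γ | g ∈ K ∧ len G o g ≤ C'} := by
  classical
  have htp : ∀ i : ℕ, ∀ g ∈ K, t ^ i * g * (t ^ i)⁻¹ ∈ K := by
    intro i
    induction i with
    | zero => intro g hg; simpa using hg
    | succ i ih =>
      intro g hg
      have : t ^ (i + 1) * g * (t ^ (i + 1))⁻¹ = t * (t ^ i * g * (t ^ i)⁻¹) * t⁻¹ := by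
        rw [pow_succ']; group
      rw [this]
      exact ht _ (ih g hg)
  let L : ℕ → Subgroup Γ := fun j => Subgroup.closure
    {x | ∃ i ≤ j, ∃ e ∈ K, len G o e ≤ C ∧ t ^ i * e * (t ^ i)⁻¹ = x}
  have hL : Monotone L := fun a b hab => Subgroup.closure_mono
    fun x ⟨i, hi, e, he⟩ => ⟨i, hi.trans hab, e, he⟩
  by_cases hJ : ∃ J, ∀ e ∈ K, len G o e ≤ C → t ^ (J + 1) * e * (t ^ (J + 1))⁻¹ ∈ L J
  · obtain ⟨J, hJ⟩ := hJ
    refine ⟨2 * (J * len G o t) + C, fun i e he hle => ?_⟩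
    have h1 : L J ≤ Subgroup.closure {g : Γ | g ∈ K ∧ len G o g ≤ 2 * (J * len G o t) + C} := by
      refine Subgroup.closure_mono ?_
      rintro _ ⟨i, hi, e, he, hle, rfl⟩
      refine ⟨htp i e he, ?_⟩
      have h1 := A.len_mul o (t ^ i * e) (t ^ i)⁻¹
      have h2 := A.len_mul o (t ^ i) e
      have h3 := A.len_pow_le o t i
      have h4 : i * len G o t ≤ J * len G o t := Nat.mul_le_mul_right _ hi
      rw [A.len_inv] at h1
      omega
    refine h1 ?_
    have hconj : ∀ g ∈ L J, t * g * t⁻¹ ∈ L J := by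
      have : L J ≤ (L J).comap (MulAut.conj t).toMonoidHom := by
        refine (Subgroup.closure_le _).mpr ?_
        rintro _ ⟨i, hi, e, he, hle, rfl⟩
        have h2 : (MulAut.conj t).toMonoidHom (t ^ i * e * (t ^ i)⁻¹) =
            t ^ (i + 1) * e * (t ^ (i + 1))⁻¹ := by
          simp [pow_succ', mul_assoc]
        rw [SetLike.mem_coe, Subgroup.mem_comap, h2]
        rcases hi.lt_or_eq with hi | rfl
        · exact Subgroup.subset_closure ⟨i + 1, hi, e, he, hle, rfl⟩
        · exact hJ e he hle
      exact fun g hg => this hg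
    induction i with
    | zero => exact Subgroup.subset_closure ⟨0, Nat.zero_le _, e, he, hle, rfl⟩
    | succ i ih =>
      have : t ^ (i + 1) * e * (t ^ (i + 1))⁻¹ = t * (t ^ i * e * (t ^ i)⁻¹) * t⁻¹ := by
        rw [pow_succ']; group
      rw [this]
      exact hconj _ ih
  · exfalso
    push Not at hJ
    choose e he hle hnot using hJ
    obtain ⟨c, hc, hg⟩ := hk
    obtain ⟨j, hj1, hj⟩ := exists_two_pow_gt c k (C + len G o t + 1)
    obtain ⟨F, hF, -, hinj, hlen⟩ := exists_finset_of_escaping o t e L hL (K := K)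
      (fun j => (Subgroup.closure_le _).mpr (by
        rintro _ ⟨i, -, e, he, -, rfl⟩; exact htp i e he))
      (fun g hg ho => Subgroup.subset_closure ⟨0, le_rfl, g, hg, by simp [len, ho], by simp⟩)
      (fun j => Subgroup.subset_closure ⟨j + 1, le_rfl, e j, he j, hle j, rfl⟩) hnot
      (D := C + len G o t + 1) (fun j => by have := hle j; omega) A j
    have h1 := hg (t ^ j • o) (j * (C + len G o t + 1)) (Nat.mul_pos hj1 (Nat.succ_pos _))
    have h2 : (F.image (fun g : Γ => g • o)) ⊆ h.ball (t ^ j • o) (j * (C + len G o t + 1)) := by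
      intro x hx
      obtain ⟨g, hg, rfl⟩ := Finset.mem_image.mp hx
      rw [h.mem_ball, A.dist_smul_smul]
      exact hlen g hg
    have h3 := Finset.card_le_card h2
    rw [Finset.card_image_of_injOn hinj, hF] at h3
    have h4 : (2 : ℝ) ^ j ≤ ((h.ball (t ^ j • o) (j * (C + len G o t + 1))).card : ℝ) := by
      exact_mod_cast h3
    linarith

end GraphAction

end PolyGrowth

namespace PolyGrowth
open TransGraph

open scoped Pointwise

namespace GraphAction

variable {Γ X : Type*} [Group Γ] [MulAction Γ X] {G : SimpleGraph X} [G.LocallyFinite]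
  (A : GraphAction Γ G)

include A in
/-- The kernel of a homomorphism to the integers is generated by a bounded set. -/
theorem exists_closure_ker (h : TransGraph G) {k : ℕ} (hk : h.Growth k) (o : X) (Γ' : Subgroup Γ)
    [Γ'.FiniteIndex] (φ : Γ' →* Multiplicative ℤ) (hφ : Function.Surjective φ)
    (hfin : ∀ C, (φ '' {g | len G o (g : Γ) ≤ C}).Finite) :
    ∃ C, Subgroup.closure {g : Γ | g ∈ φ.ker.map Γ'.subtype ∧ len G o g ≤ C} =
      φ.ker.map Γ'.subtype := by
  set K := φ.ker.map Γ'.subtype with hK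
  have hKmem : ∀ g : Γ', (g : Γ) ∈ K ↔ φ g = 1 := by
    intro g
    rw [hK, Subgroup.mem_map]
    constructor
    · rintro ⟨g', hg', heq⟩
      rwa [Subtype.ext heq] at hg'
    · intro hg
      exact ⟨g, hg, rfl⟩
  have hKle : K ≤ Γ' := by
    rintro _ ⟨g, -, rfl⟩; exact g.2
  obtain ⟨t, ht⟩ := hφ (Multiplicative.ofAdd 1)
  have hφt : ∀ z : ℤ, φ (t ^ z) = Multiplicative.ofAdd z := fun z => by
    rw [map_zpow, ht, ← ofAdd_zsmul, smul_eq_mul, mul_one]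
  obtain ⟨C₀, hC₀⟩ := A.exists_closure_len_le o Γ'
  obtain ⟨M, hM⟩ := ((hfin C₀).image fun z => len G o ((t : Γ) ^ z.toAdd)).bddAbove
  have hnorm : ∀ (z : ℤ), ∀ g ∈ K, (t : Γ) ^ z * g * ((t : Γ) ^ z)⁻¹ ∈ K := by
    intro z g hg
    lift g to Γ' using hKle hg
    have := (hKmem (t ^ z * g * (t ^ z)⁻¹)).mpr (by
      rw [map_mul, map_mul, (hKmem g).mp hg, map_inv, mul_one, mul_inv_cancel])
    simpa using this
  obtain ⟨C₁, h₁⟩ := A.conj_mem_closure_of_growth h hk o K t (by simpa using hnorm 1) (C₀ + M)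
  obtain ⟨C₂, h₂⟩ := A.conj_mem_closure_of_growth h hk o K t⁻¹ (by simpa using hnorm (-1)) (C₀ + M)
  let L := Subgroup.closure {x | ∃ z : ℤ, ∃ e ∈ K, len G o e ≤ C₀ + M ∧
    (t : Γ) ^ z * e * ((t : Γ) ^ z)⁻¹ = x}
  have hLK : L ≤ K := (Subgroup.closure_le _).mpr (by
    rintro _ ⟨z, e, he, -, rfl⟩
    exact hnorm z e he)
  have hLconj : ∀ z : ℤ, ∀ g ∈ L, (t : Γ) ^ z * g * ((t : Γ) ^ z)⁻¹ ∈ L := by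
    intro z
    have : L ≤ L.comap (MulAut.conj ((t : Γ) ^ z)).toMonoidHom := by
      refine (Subgroup.closure_le _).mpr ?_
      rintro _ ⟨i, e, he, hle, rfl⟩
      refine Subgroup.subset_closure ⟨z + i, e, he, hle, ?_⟩
      show (t : Γ) ^ (z + i) * e * ((t : Γ) ^ (z + i))⁻¹ =
        (t : Γ) ^ z * ((t : Γ) ^ i * e * ((t : Γ) ^ i)⁻¹) * ((t : Γ) ^ z)⁻¹
      rw [zpow_add]
      group
    exact fun g hg => this hg
  have hcl : ∀ g ∈ Γ', ∃ z : ℤ, g * ((t : Γ) ^ z)⁻¹ ∈ L := by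
    intro g hg
    rw [← hC₀] at hg
    induction hg using Subgroup.closure_induction with
    | mem s hs =>
      have hsφ := hM ⟨φ ⟨s, hs.1⟩, ⟨_, hs.2, rfl⟩, rfl⟩
      refine ⟨(φ ⟨s, hs.1⟩).toAdd, Subgroup.subset_closure
        ⟨0, s * ((t : Γ) ^ (φ ⟨s, hs.1⟩).toAdd)⁻¹, ?_, ?_, by simp⟩⟩
      · have := (hKmem (⟨s, hs.1⟩ * (t ^ (φ ⟨s, hs.1⟩).toAdd)⁻¹)).mpr (by
          rw [map_mul, map_inv, hφt, ofAdd_toAdd, mul_inv_cancel])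
        simpa using this
      · refine (A.len_mul o _ _).trans (add_le_add hs.2 ?_)
        rw [A.len_inv]
        exact hsφ
    | one => exact ⟨0, by simp [L.one_mem]⟩
    | mul a b _ _ ha hb =>
      obtain ⟨i, hi⟩ := ha
      obtain ⟨j, hj⟩ := hb
      refine ⟨i + j, ?_⟩
      have : a * b * ((t : Γ) ^ (i + j))⁻¹ = a * ((t : Γ) ^ i)⁻¹ *
          ((t : Γ) ^ i * (b * ((t : Γ) ^ j)⁻¹) * ((t : Γ) ^ i)⁻¹) := by
        rw [add_comm, zpow_add]; group
      rw [this]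
      exact L.mul_mem hi (hLconj i _ hj)
    | inv a _ ha =>
      obtain ⟨i, hi⟩ := ha
      refine ⟨-i, ?_⟩
      have : a⁻¹ * ((t : Γ) ^ (-i))⁻¹ =
          (t : Γ) ^ (-i) * (a * ((t : Γ) ^ i)⁻¹)⁻¹ * ((t : Γ) ^ (-i))⁻¹ := by
        rw [zpow_neg]; group
      rw [this]
      exact hLconj _ _ (L.inv_mem hi)
  refine ⟨max C₁ C₂, le_antisymm ((Subgroup.closure_le _).mpr fun g hg => hg.1) fun g hg => ?_⟩
  obtain ⟨z, hz⟩ := hcl g (hKle hg)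
  have htz : (t : Γ) ^ z ∈ K := by
    have h1 := K.mul_mem (K.inv_mem (hLK hz)) hg
    rwa [mul_inv_rev, inv_inv, inv_mul_cancel_right] at h1
  have hz0 : z = 0 := by
    have h1 := (hKmem (t ^ z)).mp (by simpa using htz)
    rw [hφt] at h1
    exact h1
  rw [hz0, zpow_zero, inv_one, mul_one] at hz
  refine ((Subgroup.closure_le _).mpr ?_ : L ≤ _) hz
  rintro _ ⟨i, e, he, hle, rfl⟩
  obtain ⟨n, rfl | rfl⟩ := i.eq_nat_or_neg
  · have := h₁ n e he hle
    rw [zpow_natCast]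
    exact Subgroup.closure_mono (fun g hg => And.intro hg.1 (hg.2.trans (le_max_left _ _))) this
  · have := h₂ n e he hle
    rw [zpow_neg, zpow_natCast, ← inv_pow]
    exact Subgroup.closure_mono (fun g hg => And.intro hg.1 (hg.2.trans (le_max_right _ _))) this

/-- The graph on an orbit joining points at distance at most `C`. -/
def orbitGraph (G : SimpleGraph X) (K : Subgroup Γ) (o : X) (C : ℕ) :
    SimpleGraph (MulAction.orbit K o) where
  Adj x y := x ≠ y ∧ G.dist (x : X) y ≤ C
  symm := ⟨fun _ _ hxy => ⟨hxy.1.symm, by rw [SimpleGraph.dist_comm]; exact hxy.2⟩⟩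
  loopless := ⟨fun _ hx => hx.1 rfl⟩

omit [G.LocallyFinite] in
include A in
theorem orbitGraph_action (K : Subgroup Γ) (o : X) (C : ℕ)
    (hC : Subgroup.closure {g : Γ | g ∈ K ∧ len G o g ≤ C} = K) :
    GraphAction K (orbitGraph G K o C) where
  adj_smul g x y := by
    have h1 : G.dist ((g • x : MulAction.orbit K o) : X) ((g • y : MulAction.orbit K o) : X) =
        G.dist (x : X) y := A.dist_smul (g : Γ) _ _
    simp only [orbitGraph, h1, ne_eq, smul_left_cancel_iff]
  trans := MulAction.exists_smul_eq K
  conn := by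
    let o' : MulAction.orbit K o := ⟨o, MulAction.mem_orbit_self o⟩
    have hadj : ∀ s : K, len G o (s : Γ) ≤ C → ∀ g : K,
        (orbitGraph G K o C).Reachable (g • o') ((g * s) • o') := by
      intro s hs g
      by_cases hne : g • o' = (g * s) • o'
      · rw [← hne]
      · refine SimpleGraph.Adj.reachable ⟨hne, ?_⟩
        have : G.dist ((g : Γ) • o) (((g : Γ) * s) • o) ≤ C := by
          rw [A.dist_smul_smul, inv_mul_cancel_left]; exact hs
        exact this
    have hreach : ∀ g (hg : g ∈ K) (a : K), (orbitGraph G K o C).Reachable (a • o')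
        ((a * (⟨g, hg⟩ : K)) • o') := by
      intro g hg
      have hcl := hg
      rw [← hC] at hcl
      have key : ∀ g ∈ Subgroup.closure {g : Γ | g ∈ K ∧ len G o g ≤ C}, ∃ hg : g ∈ K, ∀ a : K,
          (orbitGraph G K o C).Reachable (a • o') ((a * (⟨g, hg⟩ : K)) • o') := by
        intro g hg
        induction hg using Subgroup.closure_induction with
        | mem s hs => exact ⟨hs.1, fun a => hadj ⟨s, hs.1⟩ hs.2 a⟩
        | one => exact ⟨K.one_mem, fun a => by
            have : a * (⟨1, K.one_mem⟩ : K) = a := mul_one a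
            rw [this]⟩
        | mul x y _ _ hx hy =>
          obtain ⟨hxK, hx⟩ := hx
          obtain ⟨hyK, hy⟩ := hy
          refine ⟨K.mul_mem hxK hyK, fun a => (hx a).trans ?_⟩
          have := hy (a * ⟨x, hxK⟩)
          rw [mul_assoc] at this
          exact this
        | inv x _ hx =>
          obtain ⟨hxK, hx⟩ := hx
          refine ⟨K.inv_mem hxK, fun a => ?_⟩
          have h1 := hx (a * ⟨x⁻¹, K.inv_mem hxK⟩)
          have h2 : a * (⟨x⁻¹, K.inv_mem hxK⟩ : K) * ⟨x, hxK⟩ = a := by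
            ext; simp
          rw [h2] at h1
          exact h1.symm
      exact (key g hcl).2
    refine { preconnected := ?_, nonempty := ⟨o'⟩ }
    intro x y
    obtain ⟨a, ha⟩ := MulAction.exists_smul_eq K o' x
    obtain ⟨b, hb⟩ := MulAction.exists_smul_eq K x y
    rw [← hb, ← ha, smul_smul]
    obtain ⟨c, hc⟩ : ∃ c : K, b * a = a * c := ⟨a⁻¹ * b * a, by group⟩
    rw [hc]
    exact hreach c c.2 a

theorem finite_setOf_dist_le (hG : G.Connected) (o : X) (n : ℕ) : {x | G.dist o x ≤ n}.Finite := by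
  induction n with
  | zero =>
    refine (Set.finite_singleton o).subset fun x hx => ?_
    have : G.dist o x = 0 := Nat.le_zero.mp hx
    exact (hG.dist_eq_zero_iff.mp this).symm
  | succ n ih =>
    refine (ih.union (ih.biUnion fun x _ => (Set.toFinite (G.neighborSet x)))).subset ?_
    intro y hy
    rcases Nat.lt_or_ge (G.dist o y) (n + 1) with h | h
    · exact Or.inl (Nat.lt_succ_iff.mp h)
    · right
      have h1 : G.dist o y = n + 1 := le_antisymm hy h
      obtain ⟨p, hp⟩ := hG.exists_walk_length_eq_dist o y
      rw [Set.mem_iUnion₂]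
      have hnil : ¬ p.Nil := by
        intro hn
        have := SimpleGraph.Walk.length_eq_zero_iff.mpr hn
        omega
      refine ⟨p.penultimate, ?_, p.adj_penultimate hnil⟩
      have h2 := SimpleGraph.dist_le p.dropLast
      have h3 : p.dropLast.length + 1 = p.length := by
        rw [← SimpleGraph.Walk.length_concat p.dropLast (p.adj_penultimate hnil)]
        simp
      show G.dist o p.penultimate ≤ n
      omega

theorem orbitGraph_locallyFinite (hG : G.Connected) (K : Subgroup Γ) (o : X) (C : ℕ) :
    Nonempty (orbitGraph G K o C).LocallyFinite := by
  refine ⟨fun x => (Set.Finite.of_finite_image (f := Subtype.val)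
    ((finite_setOf_dist_le hG (x : X) C).subset ?_) Subtype.val_injective.injOn).fintype⟩
  rintro _ ⟨y, hy, rfl⟩
  exact hy.2

omit [G.LocallyFinite] in
theorem dist_le_orbitGraph_dist {K : Subgroup Γ} {o : X} {C : ℕ} (hG : G.Connected)
    (hc : (orbitGraph G K o C).Connected) (x y : MulAction.orbit K o) :
    G.dist (x : X) y ≤ C * (orbitGraph G K o C).dist x y := by
  obtain ⟨p, hp⟩ := hc.exists_walk_length_eq_dist x y
  rw [← hp]
  clear hp
  induction p with
  | nil => simp
  | cons hadj p ih =>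
    rw [SimpleGraph.Walk.length_cons, mul_add, mul_one]
    have h2 := hadj.2
    exact hG.dist_triangle.trans ((add_le_add h2 ih).trans (add_comm _ _).le)

theorem exists_orbitGraph_len_le (hG : G.Connected) (K : Subgroup Γ) (o : X) (C R : ℕ) :
    ∃ R', ∀ g : K, len G o (g : Γ) ≤ R →
      len (orbitGraph G K o C) ⟨o, MulAction.mem_orbit_self o⟩ g ≤ R' := by
  set o' : MulAction.orbit K o := ⟨o, MulAction.mem_orbit_self o⟩ with ho'
  have hfin : {x : MulAction.orbit K o | G.dist o (x : X) ≤ R}.Finite :=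
    Set.Finite.of_finite_image (f := Subtype.val) ((finite_setOf_dist_le hG o R).subset (by
      rintro _ ⟨y, hy, rfl⟩; exact hy)) Subtype.val_injective.injOn
  obtain ⟨R', hR'⟩ := (hfin.image fun x => (orbitGraph G K o C).dist o' x).bddAbove
  exact ⟨R', fun g hg => hR' ⟨g • o', hg, rfl⟩⟩

end GraphAction

end PolyGrowth

namespace PolyGrowth
open TransGraph

open scoped Pointwise

/-- Polynomial growth of degree at most `k` around the vertex `o`. -/
def PolyBound {X : Type*} (G : SimpleGraph X) (o : X) (k : ℕ) : Prop :=
  ∃ c : ℝ, 0 < c ∧ ∀ n : ℕ, 1 ≤ n → ({x | G.dist o x ≤ n}.ncard : ℝ) ≤ c * n ^ k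

namespace GraphAction

variable {Γ X : Type*} [Group Γ] [MulAction Γ X] {G : SimpleGraph X} [G.LocallyFinite]
  (A : GraphAction Γ G)

theorem growth_of_polyBound (h : TransGraph G) {o : X} {k : ℕ} (hk : PolyBound G o k) :
    h.Growth k := by
  obtain ⟨c, hc, hb⟩ := hk
  refine ⟨c, hc, fun v r hr => ?_⟩
  rw [h.card_ball_eq v o r]
  refine le_trans (le_of_eq ?_) (hb r hr)
  rw [← Set.ncard_coe_finset]
  congr 2
  ext x
  simp

omit [G.LocallyFinite] in
theorem map_eq_one_of_smul_eq {o : X} {Γ' : Subgroup Γ} (φ : Γ' →* Multiplicative ℤ)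
    (hfin : (φ '' {g | len G o (g : Γ) ≤ 0}).Finite) {g : Γ'} (hg : (g : Γ) • o = o) :
    φ g = 1 := by
  by_contra hne
  have hz : (φ g).toAdd ≠ 0 := fun h0 => hne (by simpa using congrArg Multiplicative.ofAdd h0)
  refine (Set.infinite_of_injective_forall_mem (f := fun m : ℕ => φ (g ^ m)) ?_ ?_) hfin
  · intro a b hab
    have h1 := congrArg Multiplicative.toAdd hab
    simp only [map_pow, toAdd_pow, nsmul_eq_mul] at h1
    exact_mod_cast mul_right_cancel₀ hz h1
  · intro m
    refine ⟨g ^ m, ?_, rfl⟩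
    have h1 : ((g : Γ) ^ m) • o = o := by
      induction m with
      | zero => simp
      | succ m ih => rw [pow_succ, mul_smul, hg, ih]
    simp [len, h1]

include A in
theorem mul_ncard_orbit_le (o : X) {Γ' : Subgroup Γ} (φ : Γ' →* Multiplicative ℤ)
    (hfin : (φ '' {g | len G o (g : Γ) ≤ 0}).Finite) (t : Γ') (ht : φ t = Multiplicative.ofAdd 1)
    (C n : ℕ) :
    n * {x : X | x ∈ MulAction.orbit (φ.ker.map Γ'.subtype) o ∧ G.dist o x ≤ C * n}.ncard ≤
      {x : X | G.dist o x ≤ (len G o (t : Γ) + C) * n}.ncard := by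
  set F := {x : X | x ∈ MulAction.orbit (φ.ker.map Γ'.subtype) o ∧ G.dist o x ≤ C * n}
  have hF : F.Finite := (finite_setOf_dist_le A.conn o (C * n)).subset fun x hx => hx.2
  have hcard : n * F.ncard = ((Finset.range n : Set ℕ) ×ˢ F).ncard := by
    rw [Set.ncard_prod, Set.ncard_coe_finset, Finset.card_range]
  rw [hcard]
  refine Set.ncard_le_ncard_of_injOn (fun p => (t : Γ) ^ p.1 • p.2) ?_ ?_
    (finite_setOf_dist_le A.conn o _)
  · rintro ⟨i, x⟩ ⟨hi, -, hx⟩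
    rw [Finset.mem_coe, Finset.mem_range] at hi
    have hi : i ≤ n := hi.le
    have h1 := A.conn.dist_triangle (u := o) (v := (t : Γ) ^ i • o) (w := (t : Γ) ^ i • x)
    rw [A.dist_smul] at h1
    have h2 : G.dist o ((t : Γ) ^ i • o) ≤ i * len G o (t : Γ) := A.len_pow_le o t i
    have h3 := Nat.mul_le_mul_right (len G o (t : Γ)) hi
    have hx' : G.dist o x ≤ C * n := hx
    show G.dist o ((t : Γ) ^ i • x) ≤ _
    rw [add_mul, mul_comm (len G o (t : Γ))]
    omega
  · rintro ⟨i, x⟩ ⟨-, ⟨⟨_, a, ha, rfl⟩, rfl⟩, -⟩ ⟨j, y⟩ ⟨-, ⟨⟨_, b, hb, rfl⟩, rfl⟩, -⟩ heq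
    have heq' : ((t ^ i * a : Γ') : Γ) • o = ((t ^ j * b : Γ') : Γ) • o := by
      simpa [mul_smul] using heq
    have h1 : φ ((t ^ j * b)⁻¹ * (t ^ i * a)) = 1 := by
      refine map_eq_one_of_smul_eq φ hfin (o := o) ?_
      rw [Subgroup.coe_mul, mul_smul, heq', ← mul_smul, Subgroup.coe_inv, inv_mul_cancel, one_smul]
    have ha' : φ a = 1 := ha
    have hb' : φ b = 1 := hb
    rw [map_mul, map_inv, inv_mul_eq_one, map_mul, map_mul, ha', hb', mul_one, mul_one, map_pow,
      map_pow, ht, ← ofAdd_nsmul, ← ofAdd_nsmul] at h1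
    have hij : j = i := by
      have := Multiplicative.ofAdd.injective h1
      simpa using this
    subst hij
    refine Prod.ext rfl ?_
    exact smul_left_cancel _ heq

include A in
theorem polyBound_orbitGraph [Infinite X] (o : X) {k : ℕ} (hk : PolyBound G o k) {Γ' : Subgroup Γ}
    (φ : Γ' →* Multiplicative ℤ) (hφ : Function.Surjective φ)
    (hfin : (φ '' {g | len G o (g : Γ) ≤ 0}).Finite) (C : ℕ)
    (hC : (orbitGraph G (φ.ker.map Γ'.subtype) o C).Connected) :
    ∃ l, k = l + 1 ∧ PolyBound (orbitGraph G (φ.ker.map Γ'.subtype) o C)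
      ⟨o, MulAction.mem_orbit_self o⟩ l := by
  obtain ⟨t, ht⟩ := hφ (Multiplicative.ofAdd 1)
  obtain ⟨c, hc, hb⟩ := hk
  set D := len G o (t : Γ) + C + 1 with hD
  set o' : MulAction.orbit (φ.ker.map Γ'.subtype) o := ⟨o, MulAction.mem_orbit_self o⟩
  have key : ∀ n : ℕ, 1 ≤ n →
      (n : ℝ) * {x | (orbitGraph G (φ.ker.map Γ'.subtype) o C).dist o' x ≤ n}.ncard ≤
        c * (D * n) ^ k := by
    intro n hn
    have h1 := A.mul_ncard_orbit_le o φ hfin t ht C n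
    have h2 : {x | (orbitGraph G (φ.ker.map Γ'.subtype) o C).dist o' x ≤ n}.ncard ≤
        {x : X | x ∈ MulAction.orbit (φ.ker.map Γ'.subtype) o ∧ G.dist o x ≤ C * n}.ncard := by
      refine Set.ncard_le_ncard_of_injOn Subtype.val ?_ Subtype.val_injective.injOn
        ((finite_setOf_dist_le A.conn o (C * n)).subset fun x hx => hx.2)
      intro x hx
      exact ⟨x.2, (dist_le_orbitGraph_dist A.conn hC o' x).trans (Nat.mul_le_mul_left _ hx)⟩
    have h3 : {x : X | G.dist o x ≤ (len G o (t : Γ) + C) * n}.ncard ≤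
        {x : X | G.dist o x ≤ D * n}.ncard :=
      Set.ncard_le_ncard (fun x hx => le_trans hx (Nat.mul_le_mul_right _ (Nat.le_succ _)))
        (finite_setOf_dist_le A.conn o _)
    have h4 := hb (D * n) (Nat.mul_pos (Nat.succ_pos _) hn)
    push_cast at h4
    refine le_trans ?_ h4
    exact_mod_cast (Nat.mul_le_mul_left n h2).trans (h1.trans h3)
  have hone : ∀ n, 1 ≤ {x | (orbitGraph G (φ.ker.map Γ'.subtype) o C).dist o' x ≤ n}.ncard := by
    intro n
    rw [Nat.one_le_iff_ne_zero]
    refine Set.ncard_ne_zero_of_mem (a := o') (by simp) ?_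
    have := (orbitGraph_locallyFinite A.conn (φ.ker.map Γ'.subtype) o C).some
    exact finite_setOf_dist_le hC o' n
  rcases k with _ | l
  · exfalso
    obtain ⟨n, hn⟩ := exists_nat_gt c
    have hn1 : 1 ≤ n + 1 := Nat.succ_pos n
    have h1 := key (n + 1) hn1
    have h2 :
        (1 : ℝ) ≤ {x | (orbitGraph G (φ.ker.map Γ'.subtype) o C).dist o' x ≤ n + 1}.ncard := by
      exact_mod_cast hone (n + 1)
    rw [pow_zero, mul_one] at h1
    have h3 : ((n + 1 : ℕ) : ℝ) * 1 ≤ c :=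
      (mul_le_mul_of_nonneg_left h2 (Nat.cast_nonneg _)).trans h1
    push_cast at h3
    linarith
  · refine ⟨l, rfl, c * D ^ (l + 1), by positivity, fun n hn => ?_⟩
    have h1 := key n hn
    have hn0 : (0 : ℝ) < n := by exact_mod_cast hn
    refine le_of_mul_le_mul_left (h1.trans (le_of_eq ?_)) hn0
    rw [mul_pow, pow_succ (n : ℝ)]
    ring

omit [G.LocallyFinite] in
theorem exists_normal_hom_int (o : X) {Γ' : Subgroup Γ} [Γ'.FiniteIndex]
    (φ : Γ' →* Multiplicative ℤ) (hφ : Function.Surjective φ)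
    (hfin : ∀ C, (φ '' {g | len G o (g : Γ) ≤ C}).Finite) :
    ∃ (Γ'' : Subgroup Γ) (_ : Γ''.FiniteIndex) (_ : Γ''.Normal) (ψ : Γ'' →* Multiplicative ℤ),
      Function.Surjective ψ ∧ ∀ C, (ψ '' {g | len G o (g : Γ) ≤ C}).Finite := by
  let ι : Γ'.normalCore →* Γ' := Subgroup.inclusion Γ'.normalCore_le
  let θ := φ.comp ι
  obtain ⟨t, ht⟩ := hφ (Multiplicative.ofAdd 1)
  have hinf : Infinite θ.range := by
    obtain ⟨m, hm, -, hmem⟩ := Subgroup.exists_pow_mem_of_index_ne_zero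
      (H := Γ'.normalCore) (Subgroup.FiniteIndex.index_ne_zero) (t : Γ)
    let s : Γ'.normalCore := ⟨(t : Γ) ^ m, hmem⟩
    have hs : φ (ι s) = Multiplicative.ofAdd (m : ℤ) := by
      have : ι s = t ^ m := Subtype.ext (by simp [ι, s])
      rw [this, map_pow, ht, ← ofAdd_nsmul]
      simp
    refine Infinite.of_injective (fun n : ℕ => (⟨θ (s ^ n), _, rfl⟩ : θ.range)) ?_
    intro a b hab
    have h1 : θ (s ^ a) = θ (s ^ b) := congrArg Subtype.val hab
    have h2 : φ (ι (s ^ a)) = φ (ι (s ^ b)) := h1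
    rw [map_pow, map_pow, map_pow, map_pow, hs, ← ofAdd_nsmul, ← ofAdd_nsmul] at h2
    have h3 := Multiplicative.ofAdd.injective h2
    simp only [nsmul_eq_mul] at h3
    exact_mod_cast mul_right_cancel₀ (by exact_mod_cast hm.ne') h3
  have hfg : Group.FG θ.range := by
    obtain ⟨g, hg⟩ := IsCyclic.exists_generator (α := θ.range)
    rw [Group.fg_def]
    refine ⟨{g}, ?_⟩
    rw [Finset.coe_singleton, ← Subgroup.zpowers_eq_closure]
    exact eq_top_iff.mpr fun x _ => hg x
  obtain ⟨ψ, hψ⟩ := exists_surjective_int_of_infinite (A := θ.range)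
  refine ⟨Γ'.normalCore, inferInstance, inferInstance, ψ.comp θ.rangeRestrict, ?_, fun C => ?_⟩
  · rw [MonoidHom.coe_comp]
    exact hψ.comp θ.rangeRestrict_surjective
  · rw [MonoidHom.coe_comp, Set.image_comp]
    refine Set.Finite.image _ (Set.Finite.of_finite_image (f := Subtype.val) ?_
      Subtype.val_injective.injOn)
    rw [Set.image_image]
    refine (hfin C).subset ?_
    rintro _ ⟨g, hg, rfl⟩
    exact ⟨ι g, hg, rfl⟩

end GraphAction

end PolyGrowth

namespace PolyGrowth

open scoped Pointwise

/-- All subgroups are finitely generated. -/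
def Noeth (D : Type*) [Group D] : Prop := ∀ H : Subgroup D, H.FG

section Noeth

variable {D E : Type*} [Group D] [Group E]

theorem fg_map {H : Subgroup D} (hH : H.FG) (f : D →* E) : (H.map f).FG := by
  obtain ⟨S, hS, hf⟩ := (Subgroup.fg_iff H).mp hH
  rw [Subgroup.fg_iff]
  exact ⟨f '' S, by rw [← MonoidHom.map_closure, hS], hf.image f⟩

theorem Noeth.of_injective (hD : Noeth D) (f : E →* D) (hf : Function.Injective f) : Noeth E := by
  intro H
  have h1 : Group.FG (H.map f) := (Group.fg_iff_subgroup_fg _).mpr (hD _)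
  rw [← Group.fg_iff_subgroup_fg]
  exact Group.fg_of_surjective (f := (H.equivMapOfInjective f hf).symm.toMonoidHom)
    (H.equivMapOfInjective f hf).symm.surjective

theorem Noeth.of_surjective (hD : Noeth D) (f : D →* E) (hf : Function.Surjective f) : Noeth E := by
  intro H
  rw [← Subgroup.map_comap_eq_self_of_surjective hf H]
  exact fg_map (hD _) f

theorem Noeth.subgroup (hD : Noeth D) (H : Subgroup D) : Noeth H :=
  hD.of_injective H.subtype H.subtype_injective

theorem Noeth.fg (hD : Noeth D) : Group.FG D := Group.fg_def.mpr (hD ⊤)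

theorem noeth_of_finite [Finite D] : Noeth D :=
  fun H => (Group.fg_iff_subgroup_fg H).mp inferInstance

theorem noeth_of_isCyclic [IsCyclic D] : Noeth D := fun H => by
  obtain ⟨g, hg⟩ := IsCyclic.exists_generator (α := H)
  rw [← Group.fg_iff_subgroup_fg, Group.fg_def]
  refine ⟨{g}, ?_⟩
  rw [Finset.coe_singleton, ← Subgroup.zpowers_eq_closure]
  exact eq_top_iff.mpr fun x _ => hg x

theorem Noeth.of_extension (f : D →* E) (hk : Noeth f.ker) (hE : Noeth E) : Noeth D := by
  intro H
  obtain ⟨S, hS, hSf⟩ := (Subgroup.fg_iff _).mp (fg_map (hk (H.subgroupOf f.ker)) f.ker.subtype)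
  have h1 : Subgroup.closure (f '' (H : Set D)) = H.map f := by
    rw [← MonoidHom.map_closure, Subgroup.closure_eq]
  obtain ⟨T, hT, hTf, hTc⟩ := exists_finite_subset_closure_eq (U := f '' (H : Set D))
    (by rw [h1]; exact hE _)
  obtain ⟨T', hT', hTf', rfl⟩ := Set.exists_subset_image_finite_and.mp ⟨T, hT, hTf, rfl⟩
  rw [Subgroup.fg_iff]
  refine ⟨S ∪ T', le_antisymm ?_ ?_, hSf.union hTf'⟩
  · rw [Subgroup.closure_le, Set.union_subset_iff]
    refine ⟨fun s hs => ?_, hT'⟩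
    have h2 : s ∈ Subgroup.closure S := Subgroup.subset_closure hs
    rw [hS] at h2
    obtain ⟨y, hy, rfl⟩ := h2
    exact hy
  · intro x hx
    have h2 : f x ∈ Subgroup.closure (f '' T') := by
      rw [hTc]; exact Subgroup.subset_closure ⟨x, hx, rfl⟩
    rw [← MonoidHom.map_closure] at h2
    obtain ⟨y, hy, hyx⟩ := h2
    have hyH : y ∈ H := (Subgroup.closure_le _).mpr hT' hy
    have h3 : x * y⁻¹ ∈ Subgroup.closure S := by
      rw [hS]
      refine ⟨⟨x * y⁻¹, ?_⟩, ?_, rfl⟩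
      · rw [MonoidHom.mem_ker, map_mul, map_inv, hyx, mul_inv_cancel]
      · exact H.mul_mem hx (H.inv_mem hyH)
    rw [← inv_mul_cancel_right x y]
    exact Subgroup.mul_mem _ (Subgroup.closure_mono Set.subset_union_left h3)
      (Subgroup.closure_mono Set.subset_union_right hy)

theorem finite_sup_of_normal {H N : Subgroup D} [N.Normal] (hH : (H : Set D).Finite)
    (hN : (N : Set D).Finite) : ((H ⊔ N : Subgroup D) : Set D).Finite := by
  rw [Subgroup.mul_normal]
  exact hH.mul hN

/-- A Noetherian group has a largest finite normal subgroup. -/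
theorem Noeth.exists_max_finite_normal (hD : Noeth D) : ∃ F : Subgroup D, F.Normal ∧
    (F : Set D).Finite ∧ ∀ M : Subgroup D, M.Normal → (M : Set D).Finite → M ≤ F := by
  obtain ⟨S, hSU, hSf, hS⟩ := exists_finite_subset_closure_eq
    (U := {x : D | ∃ M : Subgroup D, M.Normal ∧ (M : Set D).Finite ∧ x ∈ M}) (hD _)
  have key : ∃ F : Subgroup D, F.Normal ∧ (F : Set D).Finite ∧ S ⊆ F := by
    clear hS
    induction S, hSf using Set.Finite.induction_on with
    | empty => exact ⟨⊥, inferInstance, by simp, by simp⟩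
    | insert _ _ ih =>
      obtain ⟨F, hF, hFf, hSF⟩ := ih ((Set.subset_insert _ _).trans hSU)
      obtain ⟨M, hM, hMf, hx⟩ := hSU (Set.mem_insert _ _)
      refine ⟨F ⊔ M, inferInstance, finite_sup_of_normal hFf hMf, Set.insert_subset ?_ ?_⟩
      · exact (le_sup_right : M ≤ F ⊔ M) hx
      · exact hSF.trans (le_sup_left : F ≤ F ⊔ M)
  obtain ⟨F, hF, hFf, hSF⟩ := key
  refine ⟨F, hF, hFf, fun M hM hMf x hx => ?_⟩
  have h1 : x ∈ Subgroup.closure S := by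
    rw [hS]; exact Subgroup.subset_closure ⟨M, hM, hMf, hx⟩
  exact (Subgroup.closure_le _).mpr hSF h1

theorem isVirtuallyNilpotent_of_surjective (hD : Group.IsVirtuallyNilpotent D) (f : D →* E)
    (hf : Function.Surjective f) : Group.IsVirtuallyNilpotent E := by
  obtain ⟨N, hN, hNi⟩ := hD
  refine ⟨N.map f, ?_, ⟨?_⟩⟩
  · exact Group.nilpotent_of_surjective (f.subgroupMap N) (f.subgroupMap_surjective N)
  · exact ne_zero_of_dvd_ne_zero hNi.index_ne_zero (N.index_map_dvd hf)

theorem isVirtuallyNilpotent_of_injective (hD : Group.IsVirtuallyNilpotent D) (f : E →* D)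
    (hf : Function.Injective f) : Group.IsVirtuallyNilpotent E := by
  obtain ⟨N, hN, hNi⟩ := hD
  refine ⟨N.comap f, ?_, ⟨?_⟩⟩
  · have : Function.Injective (f.subgroupComap N) := fun x y hxy =>
      Subtype.ext (hf (congrArg Subtype.val hxy))
    exact Group.nilpotent_of_mulEquiv (MonoidHom.ofInjective this).symm
  · rw [Subgroup.index_comap]
    exact (inferInstance : (N.subgroupOf f.range).FiniteIndex).index_ne_zero

theorem isVirtuallyNilpotent_of_finiteIndex {H : Subgroup D} [H.FiniteIndex]
    (hH : Group.IsVirtuallyNilpotent H) : Group.IsVirtuallyNilpotent D := by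
  obtain ⟨N, hN, hNi⟩ := hH
  refine ⟨N.map H.subtype, ?_, finiteIndex_map_subtype N⟩
  exact Group.nilpotent_of_mulEquiv (N.equivMapOfInjective _ H.subtype_injective)

end Noeth

/-- A symmetric subadditive function vanishing at the identity. -/
structure IsLen {Γ : Type*} [Group Γ] (ℓ : Γ → ℕ) : Prop where
  inv : ∀ g, ℓ g⁻¹ = ℓ g
  mul : ∀ g h, ℓ (g * h) ≤ ℓ g + ℓ h

/-- A bounded normal subgroup with discrete Noetherian quotient. -/
structure GoodKer {Γ : Type*} [Group Γ] (ℓ : Γ → ℕ) (N : Subgroup Γ) [N.Normal] : Prop where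
  bdd : ∃ C, ∀ g ∈ N, ℓ g ≤ C
  fin : ∀ C, (QuotientGroup.mk' N '' {g | ℓ g ≤ C}).Finite
  noeth : Noeth (Γ ⧸ N)

/-- Up to a bounded normal subgroup the group is discrete, Noetherian and virtually nilpotent. -/
def Good (Γ : Type*) [Group Γ] (ℓ : Γ → ℕ) : Prop :=
  ∃ (N : Subgroup Γ) (_ : N.Normal), GoodKer ℓ N ∧ Group.IsVirtuallyNilpotent (Γ ⧸ N)

section Good

variable {Γ Δ : Type*} [Group Γ] [Group Δ] {ℓ : Γ → ℕ}

theorem Good.exists_max (hℓ : IsLen ℓ) (hΓ : Good Γ ℓ) : ∃ (N : Subgroup Γ) (_ : N.Normal),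
    GoodKer ℓ N ∧ Group.IsVirtuallyNilpotent (Γ ⧸ N) ∧
      ∀ M : Subgroup Γ, M.Normal → (∃ C, ∀ g ∈ M, ℓ g ≤ C) → M ≤ N := by
  obtain ⟨N, hN, ⟨⟨C, hC⟩, hfin, hnoeth⟩, hvn⟩ := hΓ
  obtain ⟨F, hF, hFf, hFmax⟩ := hnoeth.exists_max_finite_normal
  let N' := F.comap (QuotientGroup.mk' N)
  have hNN' : N ≤ N' := by
    intro g hg
    have : QuotientGroup.mk' N g = 1 := (QuotientGroup.eq_one_iff g).mpr hg
    rw [Subgroup.mem_comap, this]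
    exact F.one_mem
  let q : Γ ⧸ N →* Γ ⧸ N' := QuotientGroup.map N N' (MonoidHom.id Γ) hNN'
  have hq : Function.Surjective q := by
    intro x
    obtain ⟨g, rfl⟩ := QuotientGroup.mk'_surjective N' x
    exact ⟨QuotientGroup.mk' N g, rfl⟩
  refine ⟨N', inferInstance, ⟨?_, fun C => ?_, hnoeth.of_surjective q hq⟩,
    isVirtuallyNilpotent_of_surjective hvn q hq, fun M hM ⟨C, hMC⟩ => ?_⟩
  · obtain ⟨B, hB⟩ := (hFf.image fun x => ℓ x.out).bddAbove
    refine ⟨B + C, fun g hg => ?_⟩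
    have h1 : ℓ (QuotientGroup.mk' N g).out ≤ B := hB ⟨_, hg, rfl⟩
    have h2 : (QuotientGroup.mk' N g).out⁻¹ * g ∈ N := by
      rw [← QuotientGroup.eq]
      exact Quotient.out_eq' _
    have h3 := hℓ.mul (QuotientGroup.mk' N g).out ((QuotientGroup.mk' N g).out⁻¹ * g)
    rw [mul_inv_cancel_left] at h3
    exact h3.trans (add_le_add h1 (hC _ h2))
  · refine ((hfin C).image q).subset ?_
    rintro _ ⟨g, hg, rfl⟩
    exact ⟨_, ⟨g, hg, rfl⟩, rfl⟩
  · have hMn := hM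
    have h1 := hFmax (M.map (QuotientGroup.mk' N))
      (hM.map _ (QuotientGroup.mk'_surjective N)) ((hfin C).subset (by
        rintro _ ⟨g, hg, rfl⟩
        exact ⟨g, hMC g hg, rfl⟩))
    exact fun g hg => h1 ⟨g, hg, rfl⟩

theorem Good.of_mulEquiv {ℓ' : Δ → ℕ} (hΔ : Good Δ ℓ') (e : Γ ≃* Δ)
    (h1 : ∀ C, ∃ C', ∀ g, ℓ g ≤ C → ℓ' (e g) ≤ C') (h2 : ∀ C, ∃ C', ∀ g, ℓ' (e g) ≤ C → ℓ g ≤ C') :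
    Good Γ ℓ := by
  obtain ⟨N, hN, ⟨⟨C, hC⟩, hfin, hnoeth⟩, hvn⟩ := hΔ
  let q : Γ ⧸ N.comap e.toMonoidHom →* Δ ⧸ N := QuotientGroup.map _ N e.toMonoidHom le_rfl
  have hq : Function.Injective q := by
    rw [← MonoidHom.ker_eq_bot_iff, eq_bot_iff]
    intro x hx
    obtain ⟨g, rfl⟩ := QuotientGroup.mk'_surjective _ x
    have : (QuotientGroup.mk' N (e g)) = 1 := hx
    exact (QuotientGroup.eq_one_iff g).mpr ((QuotientGroup.eq_one_iff (e g)).mp this)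
  refine ⟨N.comap e.toMonoidHom, inferInstance, ⟨?_, fun C => ?_, hnoeth.of_injective q hq⟩,
    isVirtuallyNilpotent_of_injective hvn q hq⟩
  · obtain ⟨C', hC'⟩ := h2 C
    exact ⟨C', fun g hg => hC' g (hC _ hg)⟩
  · obtain ⟨C', hC'⟩ := h1 C
    refine Set.Finite.of_finite_image (f := q) ?_ hq.injOn
    refine (hfin C').subset ?_
    rintro _ ⟨_, ⟨g, hg, rfl⟩, rfl⟩
    exact ⟨e g, hC' g hg, rfl⟩

theorem Good.extension (hℓ : IsLen ℓ) (Δ : Subgroup Γ) [Δ.Normal]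
    (hfin : ∀ C, (QuotientGroup.mk' Δ '' {g | ℓ g ≤ C}).Finite) (hQ : Noeth (Γ ⧸ Δ))
    (hΔ : Good Δ (fun g => ℓ g)) : ∃ (N : Subgroup Γ) (_ : N.Normal), GoodKer ℓ N ∧ N ≤ Δ ∧
      Group.IsVirtuallyNilpotent (Δ.map (QuotientGroup.mk' N)) := by
  obtain ⟨N₀, hN₀, ⟨⟨C₀, hC₀⟩, hfin₀, hnoeth₀⟩, hvn₀, hmax⟩ :=
    Good.exists_max (Γ := Δ) (ℓ := fun g : Δ => ℓ (g : Γ))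
      ⟨fun g => hℓ.inv g, fun g h => hℓ.mul g h⟩ hΔ
  set N := N₀.map Δ.subtype with hNdef
  have hNle : N ≤ Δ := by
    rintro _ ⟨g, -, rfl⟩; exact g.2
  have hN : N.Normal := by
    refine ⟨fun n hn g => ?_⟩
    obtain ⟨n, hn, rfl⟩ := hn
    have hM := hmax (N₀.map (MulAut.conjNormal g : Δ ≃* Δ).toMonoidHom)
      (hN₀.map _ (MulAut.conjNormal g : Δ ≃* Δ).surjective) ⟨ℓ g + C₀ + ℓ g, by
        rintro _ ⟨x, hx, rfl⟩
        have h1 := hℓ.mul (g * x) g⁻¹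
        have h2 := hℓ.mul g x
        have h3 := hC₀ x hx
        rw [hℓ.inv] at h1
        have h4 : (((MulAut.conjNormal g : Δ ≃* Δ).toMonoidHom x : Δ) : Γ) = g * x * g⁻¹ := rfl
        show ℓ _ ≤ _
        rw [h4]
        omega⟩
    exact ⟨_, hM ⟨n, hn, rfl⟩, rfl⟩
  let ρ : Δ ⧸ N₀ →* Γ ⧸ N := QuotientGroup.map N₀ N Δ.subtype (fun g hg => ⟨g, hg, rfl⟩)
  have hρ : ρ.range = Δ.map (QuotientGroup.mk' N) := by
    ext x
    constructor
    · rintro ⟨y, rfl⟩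
      obtain ⟨g, rfl⟩ := QuotientGroup.mk'_surjective N₀ y
      exact ⟨g, g.2, rfl⟩
    · rintro ⟨g, hg, rfl⟩
      exact ⟨QuotientGroup.mk' N₀ ⟨g, hg⟩, rfl⟩
  let q : Γ ⧸ N →* Γ ⧸ Δ := QuotientGroup.map N Δ (MonoidHom.id Γ) hNle
  have hq : q.ker = ρ.range := by
    rw [hρ]
    ext x
    obtain ⟨g, rfl⟩ := QuotientGroup.mk'_surjective N x
    constructor
    · intro hx
      exact ⟨g, (QuotientGroup.eq_one_iff g).mp hx, rfl⟩
    · rintro ⟨y, hy, hyx⟩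
      rw [← hyx]
      exact (QuotientGroup.eq_one_iff y).mpr hy
  refine ⟨N, hN, ⟨⟨C₀, ?_⟩, fun C => ?_, ?_⟩, hNle, ?_⟩
  · rintro _ ⟨x, hx, rfl⟩
    exact hC₀ x hx
  · obtain ⟨B, hB⟩ := ((hfin C).image fun x => ℓ x.out).bddAbove
    refine (((hfin₀ (C + B)).image ρ).mul
      ((hfin C).image fun x => QuotientGroup.mk' N x.out)).subset ?_
    rintro _ ⟨g, hg, rfl⟩
    set r := (QuotientGroup.mk' Δ g).out with hr
    have h1 : ℓ r ≤ B := hB ⟨_, ⟨g, hg, rfl⟩, rfl⟩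
    have h2 : g * r⁻¹ ∈ Δ := by
      have : r⁻¹ * g ∈ Δ := by
        rw [← QuotientGroup.eq]
        exact Quotient.out_eq' _
      exact (‹Δ.Normal›.mem_comm_iff).mp this
    refine ⟨QuotientGroup.mk' N (g * r⁻¹), ⟨QuotientGroup.mk' N₀ ⟨g * r⁻¹, h2⟩, ⟨_, ?_, rfl⟩, rfl⟩,
      QuotientGroup.mk' N r, ⟨_, ⟨g, hg, rfl⟩, rfl⟩, ?_⟩
    · have h3 := hℓ.mul g r⁻¹
      rw [hℓ.inv] at h3
      have hg' : ℓ g ≤ C := hg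
      show ℓ (g * r⁻¹) ≤ C + B
      omega
    · show QuotientGroup.mk' N (g * r⁻¹) * QuotientGroup.mk' N r = _
      rw [← map_mul, inv_mul_cancel_right]
  · refine Noeth.of_extension q ?_ hQ
    rw [hq]
    exact hnoeth₀.of_surjective ρ.rangeRestrict ρ.rangeRestrict_surjective
  · rw [← hρ]
    exact isVirtuallyNilpotent_of_surjective hvn₀ ρ.rangeRestrict ρ.rangeRestrict_surjective

end Good

end PolyGrowth

namespace PolyGrowth

open Polynomial

section Kronecker

theorem norm_le_two_of_isRoot {f : ℂ[X]} (hf : f ≠ 0) (hb : ∀ i, ‖f.coeff i‖ ≤ 1)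
    (hl : ‖f.leadingCoeff‖ = 1) {z : ℂ} (hz : f.IsRoot z) : ‖z‖ ≤ 2 := by
  have h1 := hz.norm_lt_cauchyBound hf
  have h2 : f.cauchyBound ≤ 2 := by
    rw [cauchyBound, ← one_add_one_eq_two]
    gcongr
    refine div_le_one_of_le₀ ?_ (by positivity)
    refine Finset.sup_le fun i _ => ?_
    rw [← NNReal.coe_le_coe, coe_nnnorm, coe_nnnorm, hl]
    exact hb i
  have h3 : ‖z‖₊ ≤ 2 := h1.le.trans h2
  exact_mod_cast h3

theorem norm_le_one_of_pow_le {x : ℝ} {B : ℝ} (hx : ∀ q : ℕ, 1 ≤ q → x ^ q ≤ B) : x ≤ 1 := by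
  by_contra! h
  obtain ⟨n, hn⟩ := pow_unbounded_of_one_lt B h
  have h1 := hx (n + 1) (by omega)
  have h2 : x ^ n ≤ x ^ (n + 1) := pow_le_pow_right₀ h.le (by omega)
  linarith

theorem exists_pow_eq_one_of_conj {z : ℂ} (hz0 : z ≠ 0) (hz : IsIntegral ℤ z)
    (hconj : ∀ w : ℂ, aeval w (minpoly ℚ z) = 0 → ‖w‖ ≤ 1) : ∃ n, 0 < n ∧ z ^ n = 1 := by
  let K := IntermediateField.adjoin ℚ {z}
  have : NumberField K :=
    { to_charZero := inferInstance
      to_finiteDimensional := IntermediateField.adjoin.finiteDimensional hz.tower_top }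
  let y : K := ⟨z, IntermediateField.mem_adjoin_simple_self ℚ z⟩
  have hy : algebraMap K ℂ y = z := rfl
  have hy0 : y ≠ 0 := fun h => hz0 (by rw [← hy, h, map_zero])
  have hyi : IsIntegral ℤ y := by
    refine (isIntegral_algHom_iff (IsScalarTower.toAlgHom ℤ K ℂ) ?_).mp ?_
    · exact (algebraMap K ℂ).injective
    · exact hz
  obtain ⟨n, hn, h⟩ := NumberField.Embeddings.pow_eq_one_of_norm_le_one K ℂ hy0 hyi fun φ => by
    refine hconj _ ?_
    have h1 : minpoly ℚ z = minpoly ℚ y := by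
      rw [← hy]
      exact minpoly.algebraMap_eq (algebraMap K ℂ).injective y
    have h2 : aeval (φ.toRatAlgHom y) (minpoly ℚ y) = φ.toRatAlgHom (aeval y (minpoly ℚ y)) :=
      aeval_algHom_apply _ _ _
    rw [minpoly.aeval, map_zero] at h2
    rw [h1]
    exact h2
  exact ⟨n, hn, by rw [← hy, ← map_pow, h, map_one]⟩

end Kronecker

section Unipotent

variable {Z : Type*} [AddCommGroup Z] [Module.Finite ℤ Z]

/-- A nonzero integer polynomial with coefficients in `{-1, 0, 1}`. -/
def IsSignPoly (f : ℤ[X]) : Prop := f ≠ 0 ∧ ∀ i, |f.coeff i| ≤ 1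

theorem IsSignPoly.norm_le_two {f : ℤ[X]} (hf : IsSignPoly f) {z : ℂ} (hz : aeval z f = 0) :
    ‖z‖ ≤ 2 := by
  have hinj : Function.Injective (algebraMap ℤ ℂ) := (algebraMap ℤ ℂ).injective_int
  have hb : ∀ i, ‖(f.map (algebraMap ℤ ℂ)).coeff i‖ ≤ 1 := fun i => by
    rw [coeff_map, eq_intCast, Complex.norm_intCast]
    exact_mod_cast hf.2 i
  refine norm_le_two_of_isRoot (f := f.map (algebraMap ℤ ℂ)) ?_ hb ?_ ?_
  · rw [Polynomial.map_ne_zero_iff hinj]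
    exact hf.1
  · refine le_antisymm (hb _) ?_
    rw [leadingCoeff_map_of_injective hinj, eq_intCast, Complex.norm_intCast]
    have := Int.one_le_abs (leadingCoeff_ne_zero.mpr hf.1)
    exact_mod_cast this
  · rw [IsRoot, eval_map_algebraMap]
    exact hz

theorem exists_aeval_eq_zero_of_sign (U : Module.End ℤ Z)
    (h : ∀ b, ∃ f : ℤ[X], IsSignPoly f ∧ aeval U f b = 0) :
    ∃ f : ℤ[X], aeval U f = 0 ∧ ∀ z : ℂ, aeval z f = 0 → ‖z‖ ≤ 2 := by
  classical
  obtain ⟨S, hS⟩ := (Module.Finite.fg_top : (⊤ : Submodule ℤ Z).FG)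
  choose F hF using h
  refine ⟨∏ b ∈ S, F b, ?_, fun z hz => ?_⟩
  · refine LinearMap.ext_on (s := (S : Set Z)) hS fun b hb => ?_
    rw [← Finset.mul_prod_erase S F hb, mul_comm, map_mul, Module.End.mul_apply, (hF b).2,
      map_zero, LinearMap.zero_apply]
  · rw [map_prod, Finset.prod_eq_zero_iff] at hz
    obtain ⟨b, -, hb⟩ := hz
    exact (hF b).1.norm_le_two hb

open TensorProduct in
/-- An automorphism of a finitely generated abelian group, all of whose powers satisfy relations
with small coefficients, is virtually unipotent up to torsion. -/
theorem exists_pow_sub_one_torsion (T : Module.End ℤ Z) (hT : Function.Injective T)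
    (h : ∀ b, ∀ q, 1 ≤ q → ∃ f : ℤ[X], IsSignPoly f ∧ aeval (T ^ q) f b = 0) :
    ∃ m s, 0 < m ∧ ∀ z, ∃ N : ℤ, N ≠ 0 ∧ N • ((T ^ m - 1) ^ s : Module.End ℤ Z) z = 0 := by
  let φ : Module.End ℤ Z →ₐ[ℤ] Module.End ℚ (ℚ ⊗[ℤ] Z) := Module.End.baseChangeHom ℤ ℚ Z
  set p := minpoly ℚ (φ T) with hp
  have hpm : p.Monic := minpoly.monic (Algebra.IsIntegral.isIntegral (φ T))
  have hroot : ∀ f : ℤ[X], aeval T f = 0 → ∀ z : ℂ, aeval z p = 0 → aeval z f = 0 := by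
    intro f hf z hz
    have h1 : aeval (φ T) (f.map (algebraMap ℤ ℚ)) = 0 := by
      rw [aeval_map_algebraMap, aeval_algHom_apply, hf, map_zero]
    obtain ⟨g, hg⟩ := minpoly.dvd ℚ _ h1
    rw [← aeval_map_algebraMap ℚ, hg, map_mul, hz, zero_mul]
  have hle : ∀ z : ℂ, aeval z p = 0 → ‖z‖ ≤ 1 := by
    intro z hz
    refine norm_le_one_of_pow_le (B := 2) fun q hq => ?_
    obtain ⟨f, hf, hf2⟩ := exists_aeval_eq_zero_of_sign (T ^ q) (fun b => h b q hq)
    rw [← norm_pow]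
    refine hf2 _ ?_
    have := hroot (expand ℤ q f) (by rw [expand_aeval]; exact hf) z hz
    rwa [expand_aeval] at this
  have hne : ∀ z : ℂ, aeval z p = 0 → z ≠ 0 := by
    rintro z hz rfl
    have h0 : p.IsRoot 0 := by
      rw [← map_zero (algebraMap ℚ ℂ), aeval_algebraMap_apply] at hz
      rw [IsRoot, ← coe_aeval_eq_eval]
      exact (algebraMap ℚ ℂ).injective (by rw [hz, map_zero])
    obtain ⟨v, hv⟩ := (Module.End.hasEigenvalue_of_isRoot h0).exists_hasEigenvector
    have h1 : φ T v = 0 := by rw [hv.apply_eq_smul, zero_smul]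
    have h2 : Function.Injective (T.lTensor ℚ) :=
      Module.Flat.lTensor_preserves_injective_linearMap T hT
    exact hv.2 (h2 (by rw [map_zero]; exact h1))
  have hinteg : ∀ z : ℂ, aeval z p = 0 → IsIntegral ℤ z := by
    intro z hz
    obtain ⟨f, hfm, hf⟩ := Algebra.IsIntegral.isIntegral (R := ℤ) T
    exact ⟨f, hfm, hroot f hf z hz⟩
  have hunity : ∀ z : ℂ, aeval z p = 0 → ∃ n, 0 < n ∧ z ^ n = 1 := fun z hz =>
    exists_pow_eq_one_of_conj (hne z hz) (hinteg z hz) fun w hw => hle w (by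
      obtain ⟨g, hg⟩ := minpoly.dvd ℚ z hz
      rw [hg, map_mul, hw, zero_mul])
  choose! N hN0 hN using hunity
  set R := (p.map (algebraMap ℚ ℂ)).roots with hR
  have hmem : ∀ z ∈ R, aeval z p = 0 := by
    intro z hz
    have := (mem_roots'.mp hz).2
    rwa [IsRoot, eval_map_algebraMap] at this
  set m := (R.map N).prod with hm
  have hm0 : 0 < m := Multiset.prod_pos (by
    intro x hx
    obtain ⟨z, hz, rfl⟩ := Multiset.mem_map.mp hx
    exact hN0 z (hmem z hz))
  have hdvd : p ∣ (X ^ m - 1) ^ R.card := by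
    refine (map_dvd_map' (algebraMap ℚ ℂ)).mp ?_
    rw [Polynomial.map_pow, Polynomial.map_sub, Polynomial.map_pow, map_X, Polynomial.map_one,
      (IsAlgClosed.splits (p.map (algebraMap ℚ ℂ))).eq_prod_roots, (hpm.map _).leadingCoeff,
      map_one, one_mul, ← hR]
    have : ∀ M : Multiset ℂ, M ≤ R →
        (M.map fun a => X - C a).prod ∣ ((X ^ m - 1) ^ M.card : ℂ[X]) := by
      intro M
      induction M using Multiset.induction with
      | empty => simp
      | cons z M ih =>
        intro hM
        rw [Multiset.map_cons, Multiset.prod_cons, Multiset.card_cons, pow_succ']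
        refine mul_dvd_mul ?_ (ih ((Multiset.le_cons_self M z).trans hM))
        rw [dvd_iff_isRoot]
        have hz : z ∈ R := Multiset.mem_of_le hM (Multiset.mem_cons_self z M)
        obtain ⟨c, hc⟩ : N z ∣ m := Multiset.dvd_prod (Multiset.mem_map_of_mem N hz)
        simp [IsRoot, hc, pow_mul, hN z (hmem z hz)]
    exact this R le_rfl
  refine ⟨m, R.card, hm0, fun z => ?_⟩
  have h1 : φ ((T ^ m - 1) ^ R.card) = 0 := by
    obtain ⟨g, hg⟩ := hdvd
    have : aeval (φ T) ((X ^ m - 1 : ℚ[X]) ^ R.card) = 0 := by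
      rw [hg, map_mul, minpoly.aeval, zero_mul]
    simpa using this
  have h2 : TensorProduct.mk ℤ ℚ Z 1 (((T ^ m - 1) ^ R.card) z) = 0 := by
    have : φ ((T ^ m - 1) ^ R.card) ((1 : ℚ) ⊗ₜ[ℤ] z) = 0 := by rw [h1, LinearMap.zero_apply]
    exact this
  obtain ⟨c, hc⟩ :=
    (IsLocalizedModule.eq_zero_iff (nonZeroDivisors ℤ) (TensorProduct.mk ℤ ℚ Z 1)).mp h2
  exact ⟨c, nonZeroDivisors.ne_zero c.2, hc⟩

/-- An automorphism of a finitely generated abelian group, all of whose powers satisfy relations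
with small coefficients, is virtually unipotent. -/
theorem exists_pow_sub_one_pow_eq_zero (T : Module.End ℤ Z) (hT : Function.Injective T)
    (h : ∀ b, ∀ q, 1 ≤ q → ∃ f : ℤ[X], IsSignPoly f ∧ aeval (T ^ q) f b = 0) :
    ∃ m s, 0 < m ∧ (T ^ m - 1) ^ s = 0 := by
  obtain ⟨m, s, hm, hs⟩ := exists_pow_sub_one_torsion T hT h
  set U := (T ^ m - 1) ^ s with hU
  have hTU : Commute T U := by
    rw [hU]
    exact ((Commute.self_pow T m).sub_right (Commute.one_right T)).pow_right s
  have hmaps : ∀ x ∈ LinearMap.range U, T x ∈ LinearMap.range U := by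
    rintro _ ⟨x, rfl⟩
    refine ⟨T x, ?_⟩
    rw [← Module.End.mul_apply, ← Module.End.mul_apply, hTU.eq]
  have hfin : Finite (LinearMap.range U) := by
    refine Module.finite_of_fg_torsion _ ?_
    rintro ⟨_, x, rfl⟩
    obtain ⟨N, hN, hx⟩ := hs x
    exact ⟨⟨N, mem_nonZeroDivisors_of_ne_zero hN⟩, Subtype.ext hx⟩
  let W := T.restrict hmaps
  have hW : Function.Injective W := fun x y hxy =>
    Subtype.ext (hT (congrArg Subtype.val hxy))
  have : Finite (Module.End ℤ (LinearMap.range U)) := DFunLike.finite _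
  obtain ⟨i, j, hij, hW2⟩ := Finite.exists_ne_map_eq_of_infinite fun n : ℕ => W ^ n
  wlog hlt : i < j generalizing i j
  · exact this j i hij.symm hW2.symm (by omega)
  have hW3 : W ^ (j - i) = 1 := by
    ext1 x
    have hinj : Function.Injective (W ^ i) := by
      rw [Module.End.coe_pow]; exact hW.iterate i
    refine hinj ?_
    rw [← Module.End.mul_apply, ← pow_add, Nat.add_sub_cancel' hlt.le]
    exact (LinearMap.congr_fun hW2 x).symm
  set m' := j - i with hm'
  have hTm : ∀ x, (T ^ m') (U x) = U x := by
    intro x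
    have h1 := LinearMap.congr_fun hW3 ⟨U x, x, rfl⟩
    rw [Module.End.pow_restrict] at h1
    exact congrArg Subtype.val h1
  refine ⟨m * m', s + 1, Nat.mul_pos hm (by omega), ?_⟩
  obtain ⟨g, hg⟩ : (X ^ m - 1 : ℤ[X]) ∣ X ^ (m * m') - 1 := by
    simpa [pow_mul] using sub_dvd_pow_sub_pow (X ^ m : ℤ[X]) 1 m'
  obtain ⟨g', hg'⟩ : (X ^ m' - 1 : ℤ[X]) ∣ X ^ (m * m') - 1 := by
    simpa [pow_mul, mul_comm m m'] using sub_dvd_pow_sub_pow (X ^ m' : ℤ[X]) 1 m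
  have h1 : (X ^ (m * m') - 1 : ℤ[X]) ^ (s + 1) =
      (g ^ s * g') * ((X ^ m' - 1) * (X ^ m - 1) ^ s) := by
    rw [pow_succ]
    nth_rw 1 [hg]
    rw [hg', mul_pow]
    ring
  have h2 : (T ^ m' - 1) * U = 0 := by
    ext x
    rw [Module.End.mul_apply, LinearMap.sub_apply, hTm, Module.End.one_apply, sub_self,
      LinearMap.zero_apply]
  have h3 := congrArg (aeval T) h1
  have h4 : aeval T ((X ^ m' - 1) * (X ^ m - 1) ^ s : ℤ[X]) = 0 := by
    simpa using h2
  rw [map_mul, h4, mul_zero] at h3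
  simpa using h3

end Unipotent

end PolyGrowth

namespace PolyGrowth

open scoped Pointwise commutatorElement
open Polynomial IsMulCommutative

/-- The iterated commutators `⁅…⁅⁅Z, B⁆, B⁆…, B⁆`. -/
def iterComm {D : Type*} [Group D] (B Z : Subgroup D) : ℕ → Subgroup D
  | 0 => Z
  | s + 1 => ⁅iterComm B Z s, B⁆

section iterComm

variable {D E : Type*} [Group D] [Group E]

theorem iterComm_mono {B B' Z Z' : Subgroup D} (hB : B ≤ B') (hZ : Z ≤ Z') (s : ℕ) :
    iterComm B Z s ≤ iterComm B' Z' s := by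
  induction s with
  | zero => exact hZ
  | succ s ih => exact Subgroup.commutator_mono ih hB

theorem iterComm_add (B Z : Subgroup D) (s r : ℕ) :
    iterComm B Z (s + r) = iterComm B (iterComm B Z s) r := by
  induction r with
  | zero => rfl
  | succ r ih =>
    show ⁅iterComm B Z (s + r), B⁆ = _
    rw [ih]; rfl

theorem map_iterComm (f : D →* E) (B Z : Subgroup D) (s : ℕ) :
    (iterComm B Z s).map f = iterComm (B.map f) (Z.map f) s := by
  induction s with
  | zero => rfl
  | succ s ih =>
    show (⁅iterComm B Z s, B⁆).map f = ⁅_, _⁆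
    rw [Subgroup.map_commutator, ih]

theorem iterComm_self (B : Subgroup D) (s : ℕ) : iterComm B B s = B.lowerCentralSeries s := by
  induction s with
  | zero => rfl
  | succ s ih =>
    show ⁅iterComm B B s, B⁆ = _
    rw [ih]; rfl

end iterComm

section Unipotent

variable {D : Type*} [Group D]

/-- The action by conjugation on an abelian normal subgroup. -/
def conjEnd (Z : Subgroup D) [Z.Normal] [IsMulCommutative Z] :
    D →* Module.End ℤ (Additive Z) where
  toFun d := (MonoidHom.toAdditive (MulAut.conjNormal d : MulAut Z).toMonoidHom).toIntLinearMap
  map_one' := by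
    ext x
    simp
  map_mul' d e := by
    ext x
    simp

theorem conjEnd_apply (Z : Subgroup D) [Z.Normal] [IsMulCommutative Z] (d : D) (z : Additive Z) :
    ((conjEnd Z d z).toMul : D) = d * (z.toMul : D) * d⁻¹ := rfl

/-- A positive word in `u` and `b * u`. -/
def signWord (b u : D) (ε : ℕ → ℕ) : ℕ → D
  | 0 => 1
  | n + 1 => signWord b u ε n * (b ^ ε n * u)

theorem signWord_mem (b u : D) {ε : ℕ → ℕ} (hε : ∀ j, ε j ≤ 1) (n : ℕ) :
    signWord b u ε n ∈ ({u, b * u} : Set D) ^ n := by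
  induction n with
  | zero => simp [signWord]
  | succ n ih =>
    rw [pow_succ]
    refine Set.mul_mem_mul ih ?_
    have := hε n
    interval_cases h : ε n <;> simp

theorem signWord_eq (Z : Subgroup D) [Z.Normal] [IsMulCommutative Z] (b : Z) (u : D)
    (ε : ℕ → ℕ) (n : ℕ) :
    signWord (b : D) u ε n = ((aeval (conjEnd Z u)
      (∑ j ∈ Finset.range n, C (ε j : ℤ) * X ^ j : ℤ[X]) (Additive.ofMul b)).toMul : D) *
        u ^ n := by
  induction n with
  | zero => simp [signWord]
  | succ n ih =>
    rw [signWord, ih, Finset.sum_range_succ, map_add, LinearMap.add_apply, toMul_add,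
      Subgroup.coe_mul, pow_succ]
    have : ((aeval (conjEnd Z u) (C (ε n : ℤ) * X ^ n : ℤ[X]) (Additive.ofMul b)).toMul : D) =
        u ^ n * (b : D) ^ ε n * (u ^ n)⁻¹ := by
      rw [map_mul, map_pow, aeval_X, ← map_pow, aeval_C, Module.End.mul_apply]
      have h2 : ((algebraMap ℤ (Module.End ℤ (Additive Z))) (ε n : ℤ))
          ((conjEnd Z (u ^ n)) (Additive.ofMul b)) =
          ε n • (conjEnd Z (u ^ n)) (Additive.ofMul b) := by
        simp
      rw [h2, toMul_nsmul, Subgroup.coe_pow, conjEnd_apply, conj_pow]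
      rfl
    rw [this]
    group

theorem exists_isSignPoly (hD : GroupGrowth D) (Z : Subgroup D) [Z.Normal] [IsMulCommutative Z]
    (b : Additive Z) (u : D) : ∃ f : ℤ[X], IsSignPoly f ∧ aeval (conjEnd Z u) f b = 0 := by
  obtain ⟨k, hk⟩ := hD
  have hS : ({u, (b.toMul : D) * u} : Set D).Finite := by simp
  obtain ⟨c, hc⟩ := hk _ hS
  obtain ⟨n, hn, hcn⟩ := GraphAction.exists_two_pow_gt c k 1
  let ε : Finset ℕ → ℕ → ℕ := fun s j => if j ∈ s then 1 else 0
  have hε : ∀ s j, ε s j ≤ 1 := fun s j => by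
    show (if j ∈ s then 1 else 0) ≤ 1
    split_ifs <;> omega
  have hnot : ¬ Set.InjOn (fun s => signWord (b.toMul : D) u (ε s) n)
      ((Finset.range n).powerset : Set (Finset ℕ)) := by
    intro hinj
    have h1 := Set.ncard_le_ncard_of_injOn _ (fun s _ => signWord_mem (b.toMul : D) u (hε s) n) hinj
      (finite_pow hS n)
    rw [Set.ncard_coe_finset, Finset.card_powerset, Finset.card_range] at h1
    have h2 := hc n hn
    rw [mul_one] at hcn
    have h3 : ((2 ^ n : ℕ) : ℝ) ≤ _ := Nat.cast_le.mpr h1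
    push_cast at h3
    linarith
  obtain ⟨s, hs, s', hs', heq, hne⟩ : ∃ s ∈ (Finset.range n).powerset,
      ∃ s' ∈ (Finset.range n).powerset, signWord (b.toMul : D) u (ε s) n =
        signWord (b.toMul : D) u (ε s') n ∧ s ≠ s' := by
    by_contra! h
    exact hnot fun s hs s' hs' heq => h s hs s' hs' heq
  set P : Finset ℕ → ℤ[X] := fun s => ∑ j ∈ Finset.range n, C (ε s j : ℤ) * X ^ j with hP
  have hcoeff : ∀ s i, (P s).coeff i = if i < n then (ε s i : ℤ) else 0 := by
    intro s i
    simp [hP, finsetSum_coeff, coeff_X_pow]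
  refine ⟨P s - P s', ⟨?_, fun i => ?_⟩, ?_⟩
  · intro h0
    apply hne
    ext i
    have h1 := congrArg (coeff · i) h0
    simp only [coeff_sub, hcoeff, coeff_zero] at h1
    by_cases hi : i < n
    · rw [if_pos hi, if_pos hi, sub_eq_zero] at h1
      by_cases h2 : i ∈ s <;> by_cases h3 : i ∈ s' <;> simp_all [ε]
    · have h2 : i ∉ s := fun h => hi (Finset.mem_range.mp (Finset.mem_powerset.mp hs h))
      have h3 : i ∉ s' := fun h => hi (Finset.mem_range.mp (Finset.mem_powerset.mp hs' h))
      simp [h2, h3]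
  · rw [coeff_sub, hcoeff, hcoeff]
    have h1 := hε s i
    have h2 := hε s' i
    split_ifs
    · rw [abs_le]; omega
    · simp
  · rw [map_sub, LinearMap.sub_apply, sub_eq_zero]
    have h1 := signWord_eq Z b.toMul u (ε s) n
    rw [heq, signWord_eq Z b.toMul u (ε s') n] at h1
    exact (Additive.toMul.injective (Subtype.ext (mul_right_cancel h1))).symm

theorem zpow_sub_one_dvd {R : Type*} [Ring R] (U : Rˣ) (n : ℤ) :
    ∃ g : R, Commute g (U : R) ∧ ((U ^ n : Rˣ) : R) - 1 = g * ((U : R) - 1) := by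
  have key : ∀ n : ℕ, ∃ g : R, Commute g (U : R) ∧ ((U ^ n : Rˣ) : R) - 1 = g * ((U : R) - 1) := by
    intro n
    induction n with
    | zero => exact ⟨0, Commute.zero_left _, by simp⟩
    | succ n ih =>
      obtain ⟨g, hg, h⟩ := ih
      refine ⟨g * U + 1, (hg.mul_left (Commute.refl _)).add_left (Commute.one_left _), ?_⟩
      have h1 : ((U ^ (n + 1) : Rˣ) : R) - 1 = (((U ^ n : Rˣ) : R) - 1) * U + (U - 1) := by
        rw [pow_succ, Units.val_mul]; noncomm_ring
      rw [h1, h]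
      noncomm_ring
  obtain ⟨n, rfl | rfl⟩ := n.eq_nat_or_neg
  · simpa using key n
  · obtain ⟨g, hg, h⟩ := key n
    refine ⟨-((U ^ (-(n : ℤ)) : Rˣ) : R) * g, Commute.mul_left ?_ hg, ?_⟩
    · refine Commute.neg_left ?_
      rw [Commute, SemiconjBy, ← Units.val_mul, ← Units.val_mul]
      exact congrArg Units.val ((Commute.refl U).zpow_left _).eq
    · rw [mul_assoc, ← h, mul_sub, mul_one, neg_mul, ← Units.val_mul, zpow_neg, zpow_natCast,
        inv_mul_cancel, Units.val_one]
      noncomm_ring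

/-- In a group of polynomial growth every element acts virtually unipotently on an abelian normal
subgroup. -/
theorem exists_iterComm_eq_bot (hD : GroupGrowth D) (A Z : Subgroup D) [Z.Normal] (hZ : Z.FG)
    (hZA : Z ≤ A) (hc : ⁅Z, A⁆ = ⊥) (t : D) :
    ∃ m s, 0 < m ∧ iterComm (A ⊔ Subgroup.zpowers (t ^ m)) Z s = ⊥ := by
  have hcomm : ∀ z ∈ Z, ∀ a ∈ A, z * a = a * z := fun z hz a ha => by
    have := Subgroup.commutator_mem_commutator hz ha
    rw [hc, Subgroup.mem_bot, commutatorElement_eq_one_iff_mul_comm] at this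
    exact this
  have : IsMulCommutative Z := IsMulCommutative.of_setLike_mul_comm
    fun a ha b hb => hcomm a ha b (hZA hb)
  have : Group.FG Z := (Group.fg_iff_subgroup_fg Z).mpr hZ
  have : Module.Finite ℤ (Additive Z) := Module.Finite.iff_addGroup_fg.mpr inferInstance
  have hinj : Function.Injective (conjEnd Z t) := fun x y hxy => by
    have h1 := congrArg (conjEnd Z t⁻¹) hxy
    rw [← Module.End.mul_apply, ← Module.End.mul_apply, ← map_mul, inv_mul_cancel, map_one] at h1
    exact h1
  obtain ⟨m, s, hm, hs⟩ := exists_pow_sub_one_pow_eq_zero (conjEnd Z t) hinj fun b q _ => by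
    rw [← map_pow]
    exact exists_isSignPoly hD Z b (t ^ q)
  refine ⟨m, s, hm, ?_⟩
  set ρ : D →* (Module.End ℤ (Additive Z))ˣ := (conjEnd Z).toHomUnits with hρ
  have hmem : ∀ b ∈ A ⊔ Subgroup.zpowers (t ^ m), ρ b ∈ Subgroup.zpowers (ρ t ^ m) := by
    intro b hb
    have h1 : A ⊔ Subgroup.zpowers (t ^ m) ≤ (Subgroup.zpowers (ρ t ^ m)).comap ρ := by
      refine sup_le (fun a ha => ?_) ?_
      · have : ρ a = 1 := by
          ext z
          show ((conjEnd Z a z).toMul : D) = z.toMul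
          rw [conjEnd_apply, ← hcomm _ z.toMul.2 a ha, mul_inv_cancel_right]
        rw [Subgroup.mem_comap, this]
        exact Subgroup.one_mem _
      · rw [Subgroup.zpowers_le, Subgroup.mem_comap, map_pow]
        exact Subgroup.mem_zpowers _
    exact h1 hb
  set U : Module.End ℤ (Additive Z) := (ρ t ^ m).val with hU
  have hU' : U = conjEnd Z t ^ m := by rw [hU, Units.val_pow_eq_pow_val]; rfl
  have key : ∀ j r, j + r = s → ∀ z ∈ iterComm (A ⊔ Subgroup.zpowers (t ^ m)) Z j,
      ∃ x : Additive Z, (x.toMul : D) = z ∧ ((U - 1) ^ r) x = 0 := by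
    intro j
    induction j with
    | zero =>
      intro r hr z hz
      refine ⟨Additive.ofMul ⟨z, hz⟩, rfl, ?_⟩
      obtain rfl : r = s := by omega
      rw [hU', hs, LinearMap.zero_apply]
    | succ j ih =>
      intro r hr z hz
      let W : Subgroup D := ((LinearMap.ker ((U - 1) ^ r)).toAddSubgroup.toSubgroup').map Z.subtype
      have : iterComm (A ⊔ Subgroup.zpowers (t ^ m)) Z (j + 1) ≤ W := by
        refine Subgroup.commutator_le.mpr fun w hw b hb => ?_
        obtain ⟨x, rfl, hx⟩ := ih (r + 1) (by omega) w hw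
        obtain ⟨n, hn⟩ := hmem b hb
        obtain ⟨g, hg, hgU⟩ := zpow_sub_one_dvd (ρ t ^ m) n
        have hb' : (conjEnd Z b) - 1 = g * (U - 1) := by
          rw [← hgU]
          dsimp only at hn
          rw [hn]
          rfl
        refine ⟨(x - conjEnd Z b x).toMul, ?_, ?_⟩
        · show ((U - 1) ^ r) (x - conjEnd Z b x) = 0
          have h1 : x - conjEnd Z b x = -((conjEnd Z b - 1) x) := by simp
          have h2 : Commute g (U - 1) := hg.sub_right (Commute.one_right g)
          rw [h1, hb', map_neg, ← Module.End.mul_apply, ← mul_assoc, ← (h2.pow_right r).eq,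
            mul_assoc, ← pow_succ, Module.End.mul_apply, hx, map_zero, neg_zero]
        · show ((x.toMul / (conjEnd Z b x).toMul : Z) : D) = _
          rw [Subgroup.coe_div, conjEnd_apply, commutatorElement_def, div_eq_mul_inv]
          group
      obtain ⟨x, hx, rfl⟩ := this hz
      exact ⟨Additive.ofMul x, rfl, hx⟩
  rw [eq_bot_iff]
  intro z hz
  obtain ⟨x, rfl, hx⟩ := key s 0 rfl z hz
  rw [pow_zero, Module.End.one_apply] at hx
  rw [hx]
  exact Subgroup.one_mem _

end Unipotent

section Extension

variable {D : Type*} [Group D]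

theorem finite_monoidHom {E : Type*} [Group E] [Finite E] [Group.FG D] : Finite (D →* E) := by
  obtain ⟨S, hS⟩ := Group.fg_def.mp ‹Group.FG D›
  refine Finite.of_injective (fun f : D →* E => fun s : S => f s) fun f g hfg => ?_
  exact MonoidHom.eq_of_eqOn_dense hS fun x hx => congrFun hfg ⟨x, hx⟩

/-- A finite index subgroup of a finitely generated group contains a characteristic one. -/
theorem exists_characteristic_le [Group.FG D] (N : Subgroup D) [N.FiniteIndex] :
    ∃ M : Subgroup D, M.Characteristic ∧ M.FiniteIndex ∧ M ≤ N := by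
  have : Finite (D →* Equiv.Perm (D ⧸ N)) := finite_monoidHom
  refine ⟨⨅ f : D →* Equiv.Perm (D ⧸ N), f.ker, ?_, ?_, ?_⟩
  · refine Subgroup.characteristic_iff_le_comap.mpr fun φ x hx => ?_
    rw [Subgroup.mem_comap, Subgroup.mem_iInf]
    intro f
    exact (Subgroup.mem_iInf.mp hx) (f.comp φ.toMonoidHom)
  · exact Subgroup.finiteIndex_iInf fun f => inferInstance
  · refine (iInf_le _ (MulAction.toPermHom D (D ⧸ N))).trans ?_
    rw [← Subgroup.normalCore_eq_ker]
    exact N.normalCore_le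

theorem normal_lowerCentralSeries (A : Subgroup D) [A.Normal] (j : ℕ) :
    (A.lowerCentralSeries j).Normal := by
  induction j with
  | zero => assumption
  | succ j ih => exact Subgroup.commutator_normal _ _

/-- In a group of polynomial growth, a cyclic extension of a Noetherian nilpotent normal subgroup is
virtually nilpotent. -/
theorem exists_isNilpotent_sup_zpowers (hD : GroupGrowth D) (A : Subgroup D) [A.Normal]
    (hA : Noeth A) (hn : Group.IsNilpotent A) (t : D) :
    ∃ m, 0 < m ∧ Group.IsNilpotent (A ⊔ Subgroup.zpowers (t ^ m) : Subgroup D) := by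
  obtain ⟨c, hc⟩ := (Subgroup.isNilpotent_iff_lowerCentralSeries A).mp hn
  have hnorm := normal_lowerCentralSeries A
  have hle : ∀ j, A.lowerCentralSeries j ≤ A := fun j =>
    A.lowerCentralSeries_antitone (Nat.zero_le j)
  have step : ∀ j, ∃ m s, 0 < m ∧ iterComm (A ⊔ Subgroup.zpowers (t ^ m))
      (A.lowerCentralSeries j) s ≤ A.lowerCentralSeries (j + 1) := by
    intro j
    set π := QuotientGroup.mk' (A.lowerCentralSeries (j + 1)) with hπ
    have hπs : Function.Surjective π := QuotientGroup.mk'_surjective _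
    have hfg : (A.lowerCentralSeries j).FG := by
      have := fg_map (hA ((A.lowerCentralSeries j).subgroupOf A)) A.subtype
      rwa [Subgroup.map_subgroupOf_eq_of_le (hle j)] at this
    have : ((A.lowerCentralSeries j).map π).Normal := (hnorm j).map π hπs
    obtain ⟨m, s, hm, hs⟩ := exists_iterComm_eq_bot (hD.of_surjective π hπs) (A.map π)
      ((A.lowerCentralSeries j).map π) (fg_map hfg π) (Subgroup.map_mono (hle j)) (by
        rw [← Subgroup.map_commutator, Subgroup.map_eq_bot_iff, hπ, QuotientGroup.ker_mk']
        exact le_rfl) (π t)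
    refine ⟨m, s, hm, ?_⟩
    rw [← map_pow, ← MonoidHom.map_zpowers, ← Subgroup.map_sup, ← map_iterComm,
      Subgroup.map_eq_bot_iff, hπ, QuotientGroup.ker_mk'] at hs
    exact hs
  choose m s hm hs using step
  set M := ∏ j ∈ Finset.range c, m j with hM
  refine ⟨M, Finset.prod_pos fun j _ => hm j, ?_⟩
  set B := A ⊔ Subgroup.zpowers (t ^ M) with hB
  have key : ∀ j ≤ c, ∃ r, iterComm B B r ≤ A.lowerCentralSeries j := by
    intro j
    induction j with
    | zero =>
      refine fun _ => ⟨1, Subgroup.commutator_le.mpr fun x hx y hy => ?_⟩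
      have hx' : ∀ x ∈ B,
          QuotientGroup.mk' A x ∈ Subgroup.zpowers (QuotientGroup.mk' A (t ^ M)) := by
        have : B ≤
            (Subgroup.zpowers (QuotientGroup.mk' A (t ^ M))).comap (QuotientGroup.mk' A) := by
          refine sup_le (fun a ha => ?_) ?_
          · have : QuotientGroup.mk' A a = 1 := (QuotientGroup.eq_one_iff a).mpr ha
            rw [Subgroup.mem_comap, this]
            exact Subgroup.one_mem _
          · rw [Subgroup.zpowers_le]
            exact Subgroup.mem_zpowers _
        exact this
      obtain ⟨i, hi⟩ := hx' x hx
      obtain ⟨l, hl⟩ := hx' y hy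
      rw [Subgroup.lowerCentralSeries_zero, ← QuotientGroup.eq_one_iff]
      show QuotientGroup.mk' A ⁅x, y⁆ = 1
      rw [map_commutatorElement, commutatorElement_eq_one_iff_commute, ← hi, ← hl]
      exact ((Commute.refl _).zpow_left _).zpow_right _
    | succ j ih =>
      intro hj
      obtain ⟨r, hr⟩ := ih (by omega)
      refine ⟨r + s j, ?_⟩
      rw [iterComm_add]
      refine (iterComm_mono ?_ hr (s j)).trans (hs j)
      refine sup_le_sup le_rfl ?_
      rw [Subgroup.zpowers_le]
      obtain ⟨d, hd⟩ : m j ∣ M := Finset.dvd_prod_of_mem m (Finset.mem_range.mpr hj)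
      rw [hd, pow_mul]
      exact Subgroup.npow_mem_zpowers _ _
  obtain ⟨r, hr⟩ := key c le_rfl
  refine (Subgroup.isNilpotent_iff_lowerCentralSeries B).mpr ⟨r, ?_⟩
  rw [← iterComm_self, eq_bot_iff, ← hc]
  exact hr

theorem finiteIndex_sup_zpowers (A : Subgroup D) (M : Subgroup A) [M.FiniteIndex]
    [(M.map A.subtype).Normal] (hA : A.Normal) (t : D) (ht : A ⊔ Subgroup.zpowers t = ⊤) {m : ℕ}
    (hm : 0 < m) : (M.map A.subtype ⊔ Subgroup.zpowers (t ^ m)).FiniteIndex := by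
  set B := M.map A.subtype ⊔ Subgroup.zpowers (t ^ m) with hB
  refine Subgroup.finiteIndex_iff_finite_quotient.mpr ?_
  refine Finite.of_surjective
    (fun p : Fin m × (A ⧸ M) => (QuotientGroup.mk (t ^ (p.1 : ℕ) * (p.2.out : D)) : D ⧸ B)) ?_
  intro x
  obtain ⟨d, rfl⟩ := QuotientGroup.mk_surjective x
  have hd : d ∈ A ⊔ Subgroup.zpowers t := by rw [ht]; trivial
  rw [← SetLike.mem_coe, Subgroup.normal_mul] at hd
  obtain ⟨a, ha, _, ⟨n, rfl⟩, rfl⟩ := hd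
  have hm' : (m : ℤ) ≠ 0 := by omega
  obtain ⟨r, hr⟩ := Int.eq_ofNat_of_zero_le (Int.emod_nonneg n hm')
  have hrm : r < m := by
    have := Int.emod_lt_of_pos n (b := m) (by omega)
    omega
  set a' : A := ⟨t ^ (-(r : ℤ)) * a * (t ^ (-(r : ℤ)))⁻¹, hA.conj_mem a ha _⟩ with ha'
  refine ⟨(⟨r, hrm⟩, QuotientGroup.mk a'), ?_⟩
  rw [QuotientGroup.eq]
  set b : A := (QuotientGroup.mk a' : A ⧸ M).out with hb
  have hba : b⁻¹ * a' ∈ M := by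
    rw [← QuotientGroup.eq]
    exact Quotient.out_eq' _
  have h1 : n = r + m * (n / m) := by
    have := Int.emod_add_mul_ediv n m
    rw [hr] at this
    exact this.symm
  have h2 : (t ^ r * (b : D))⁻¹ * (a * t ^ n) = ((b⁻¹ * a' : A) : D) * (t ^ m) ^ (n / m) := by
    rw [Subgroup.coe_mul, Subgroup.coe_inv, ha']
    nth_rw 1 [h1]
    rw [zpow_add, zpow_mul, zpow_natCast, zpow_natCast]
    simp only [zpow_neg, zpow_natCast]
    group
  show (t ^ r * (b : D))⁻¹ * (a * t ^ n) ∈ B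
  rw [h2]
  exact B.mul_mem ((le_sup_left : M.map A.subtype ≤ B) ⟨_, hba, rfl⟩)
    ((le_sup_right : _ ≤ B) (Subgroup.zpow_mem_zpowers _ _))

/-- In a group of polynomial growth, a cyclic extension of a Noetherian virtually nilpotent normal
subgroup is virtually nilpotent. -/
theorem isVirtuallyNilpotent_of_sup_zpowers (hD : GroupGrowth D) (A : Subgroup D) (hN : A.Normal)
    (hA : Noeth A) (hn : Group.IsVirtuallyNilpotent A) (t : D) (ht : A ⊔ Subgroup.zpowers t = ⊤) :
    Group.IsVirtuallyNilpotent D := by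
  obtain ⟨N, hN', hNi⟩ := hn
  have := hA.fg
  obtain ⟨M, hM, hMi, hMN⟩ := exists_characteristic_le N
  have hMn : Group.IsNilpotent M :=
    Group.nilpotent_of_mulEquiv (Subgroup.subgroupOfEquivOfLe hMN)
  have hMM : (M.map A.subtype).Normal := inferInstance
  have e := M.equivMapOfInjective A.subtype A.subtype_injective
  obtain ⟨m, hm, hB⟩ := exists_isNilpotent_sup_zpowers hD (M.map A.subtype)
    ((hA.subgroup M).of_injective e.symm.toMonoidHom e.symm.injective)
    (Group.nilpotent_of_mulEquiv e) t
  exact ⟨_, hB, finiteIndex_sup_zpowers A M hN t ht hm⟩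

end Extension

end PolyGrowth

namespace PolyGrowth
open TransGraph

universe u v

theorem good_of_finite_graph {Γ X : Type*} [Group Γ] [MulAction Γ X] {G : SimpleGraph X} [Finite X]
    (o : X) : Good Γ (len G o) := by
  obtain ⟨C, hC⟩ := (Set.finite_range (fun x => G.dist o x)).bddAbove
  have hs : Subsingleton (Γ ⧸ (⊤ : Subgroup Γ)) := QuotientGroup.subsingleton_quotient_top
  refine ⟨⊤, inferInstance, ⟨⟨C, fun g _ => hC ⟨g • o, rfl⟩⟩, fun C => Set.toFinite _,
    noeth_of_finite⟩, ⊤, ?_, inferInstance⟩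
  infer_instance

theorem GraphAction.isLen {Γ X : Type*} [Group Γ] [MulAction Γ X] {G : SimpleGraph X}
    (A : GraphAction Γ G) (o : X) : IsLen (len G o : Γ → ℕ) :=
  ⟨A.len_inv o, A.len_mul o⟩

namespace GraphAction

variable {Γ X : Type*} [Group Γ] [MulAction Γ X] {G : SimpleGraph X} [G.LocallyFinite]
  (A : GraphAction Γ G)

include A in
theorem good_of_good_ker (h : TransGraph G) {k : ℕ} (hk : h.Growth k) (o : X) {Γ' : Subgroup Γ}
    [Γ'.FiniteIndex] [Γ'.Normal] (ψ : Γ' →* Multiplicative ℤ) (hψ : Function.Surjective ψ)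
    (hfin : ∀ C, (ψ '' {g | len G o (g : Γ) ≤ C}).Finite)
    (hker : Good ψ.ker (fun g => len G o ((g : Γ') : Γ))) : Good Γ (len G o) := by
  have hℓ := A.isLen o
  have hℓ' : IsLen (fun g : Γ' => len G o (g : Γ)) :=
    ⟨fun g => hℓ.inv g, fun g g' => hℓ.mul g g'⟩
  have hinj := QuotientGroup.kerLift_injective ψ
  obtain ⟨N, hN, hG, -, hvn⟩ := Good.extension hℓ' ψ.ker (fun C => by
      refine Set.Finite.of_finite_image (f := QuotientGroup.kerLift ψ) ?_ hinj.injOn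
      refine (hfin C).subset ?_
      rintro _ ⟨_, ⟨g, hg, rfl⟩, rfl⟩
      exact ⟨g, hg, rfl⟩) (noeth_of_isCyclic.of_injective _ hinj) hker
  have hD : GroupGrowth (Γ' ⧸ N) := by
    refine groupGrowth_of_finite_image A h hk o Γ' (QuotientGroup.mk' N)
      (QuotientGroup.mk'_surjective N) ((hG.fin 0).subset (Set.image_mono fun g hg => ?_))
    have hg' : (g : Γ) • o = o := hg
    simp [len, hg']
  obtain ⟨t, ht⟩ := hψ (Multiplicative.ofAdd 1)
  have htop : ψ.ker.map (QuotientGroup.mk' N) ⊔ Subgroup.zpowers (QuotientGroup.mk' N t) = ⊤ := by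
    refine eq_top_iff.mpr fun x _ => ?_
    obtain ⟨g, rfl⟩ := QuotientGroup.mk'_surjective N x
    have hg : g * (t ^ (ψ g).toAdd)⁻¹ ∈ ψ.ker := by
      rw [MonoidHom.mem_ker, map_mul, map_inv, map_zpow, ht, ← ofAdd_zsmul]
      simp
    have h2 := Subgroup.mul_mem_sup (Subgroup.mem_map_of_mem (QuotientGroup.mk' N) hg)
      (Subgroup.zpow_mem_zpowers (QuotientGroup.mk' N t) (ψ g).toAdd)
    rwa [map_mul, map_inv, map_zpow, inv_mul_cancel_right] at h2
  have hΓ' : Good Γ' (fun g : Γ' => len G o (g : Γ)) :=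
    ⟨N, hN, hG, isVirtuallyNilpotent_of_sup_zpowers hD _
      (Subgroup.Normal.map inferInstance _ (QuotientGroup.mk'_surjective N))
      (hG.noeth.subgroup _) hvn _ htop⟩
  obtain ⟨N', hN', hG', -, hvn'⟩ := Good.extension hℓ Γ' (fun C => Set.toFinite _)
    noeth_of_finite hΓ'
  have : (Γ'.map (QuotientGroup.mk' N')).FiniteIndex :=
    ⟨ne_zero_of_dvd_ne_zero (Subgroup.FiniteIndex.index_ne_zero (H := Γ'))
      (Γ'.index_map_dvd (QuotientGroup.mk'_surjective N'))⟩
  exact ⟨N', hN', hG', isVirtuallyNilpotent_of_finiteIndex hvn'⟩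

end GraphAction

/-- A group acting transitively on a graph of polynomial growth is, up to a bounded normal
subgroup, discrete, Noetherian and virtually nilpotent. -/
theorem good_of_polyBound (k : ℕ) : ∀ (Γ : Type u) (X : Type v) [Group Γ] [MulAction Γ X]
    (G : SimpleGraph X) [G.LocallyFinite] (_ : GraphAction Γ G) (o : X), PolyBound G o k →
      Good Γ (len G o) := by
  induction k with
  | zero =>
    intro Γ X _ _ G _ A o hb
    rcases finite_or_infinite X with hX | hX
    · exact good_of_finite_graph o
    exfalso
    have h := A.transGraph
    have hk := GraphAction.growth_of_polyBound h hb
    obtain ⟨Γ₁, hΓ₁, φ, hφ, hfin⟩ := A.exists_hom_int h hk o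
    obtain ⟨C, hC⟩ := A.exists_closure_ker h hk o Γ₁ φ hφ hfin
    have A' := A.orbitGraph_action _ o C hC
    obtain ⟨l, hl, -⟩ := A.polyBound_orbitGraph o hb φ hφ (hfin 0) C A'.conn
    omega
  | succ k ih =>
    intro Γ X _ _ G _ A o hb
    rcases finite_or_infinite X with hX | hX
    · exact good_of_finite_graph o
    have h := A.transGraph
    have hk := GraphAction.growth_of_polyBound h hb
    obtain ⟨Γ₁, hΓ₁, φ, hφ, hfin⟩ := A.exists_hom_int h hk o
    obtain ⟨Γ', hΓ', hΓn, ψ, hψ, hψfin⟩ := GraphAction.exists_normal_hom_int o φ hφ hfin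
    obtain ⟨C, hC⟩ := A.exists_closure_ker h hk o Γ' ψ hψ hψfin
    have A' := A.orbitGraph_action _ o C hC
    obtain ⟨l, hl, hb'⟩ := A.polyBound_orbitGraph o hb ψ hψ (hψfin 0) C A'.conn
    obtain rfl : k = l := by omega
    obtain ⟨hlf⟩ := GraphAction.orbitGraph_locallyFinite A.conn (ψ.ker.map Γ'.subtype) o C
    have hgood := ih _ _ _ A' _ hb'
    refine A.good_of_good_ker h hk o ψ hψ hψfin (Good.of_mulEquiv hgood
      (ψ.ker.equivMapOfInjective _ Γ'.subtype_injective) (fun R => ?_) fun R => ⟨C * R, ?_⟩)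
    · obtain ⟨R', hR'⟩ := GraphAction.exists_orbitGraph_len_le A.conn (ψ.ker.map Γ'.subtype) o C R
      exact ⟨R', fun g hg => hR' _ hg⟩
    · intro g hg
      exact (GraphAction.dist_le_orbitGraph_dist A.conn A'.conn _ _).trans
        (Nat.mul_le_mul_left C hg)

end PolyGrowth

namespace PolyGrowth

open scoped Pointwise commutatorElement

section LowerCentral

variable {D : Type*} [Group D]

theorem commutator_commutator_le_of_rotate {H K L N : Subgroup D} [N.Normal]
    (h1 : ⁅⁅K, L⁆, H⁆ ≤ N) (h2 : ⁅⁅L, H⁆, K⁆ ≤ N) : ⁅⁅H, K⁆, L⁆ ≤ N := by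
  have key : ∀ M : Subgroup D, M.map (QuotientGroup.mk' N) = ⊥ ↔ M ≤ N := fun M => by
    rw [Subgroup.map_eq_bot_iff, QuotientGroup.ker_mk']
  rw [← key, Subgroup.map_commutator, Subgroup.map_commutator] at h1 h2 ⊢
  exact Subgroup.commutator_commutator_eq_bot_of_rotate h1 h2

theorem commutator_lowerCentralSeries_le (i j : ℕ) :
    ⁅(⊤ : Subgroup D).lowerCentralSeries i, (⊤ : Subgroup D).lowerCentralSeries j⁆ ≤
      (⊤ : Subgroup D).lowerCentralSeries (i + j + 1) := by
  induction i generalizing j with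
  | zero =>
    rw [Subgroup.commutator_comm, Subgroup.lowerCentralSeries_zero, zero_add,
      Subgroup.lowerCentralSeries_succ]
  | succ i ih =>
    rw [Subgroup.lowerCentralSeries_succ]
    refine commutator_commutator_le_of_rotate ?_ ?_
    · rw [Subgroup.commutator_comm ⊤, ← Subgroup.lowerCentralSeries_succ, Subgroup.commutator_comm]
      refine (ih (j + 1)).trans (le_of_eq ?_)
      congr 1
      omega
    · rw [Subgroup.commutator_comm ((⊤ : Subgroup D).lowerCentralSeries j)]
      refine (Subgroup.commutator_mono (ih j) le_rfl).trans (le_of_eq ?_)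
      rw [← Subgroup.lowerCentralSeries_succ]
      congr 1
      omega

end LowerCentral

/-- Words in the letters `x l`, `l ∈ P`, of weighted length at most `A`, where the letter `x l`
has length `ρ ^ (w l + 1)`. -/
inductive WLe {D ι : Type*} [Group D] (x : ι → D) (w : ι → ℕ) (ρ : ℝ) (P : Set ι) : ℝ → D → Prop
  | one {A : ℝ} (hA : 0 ≤ A) : WLe x w ρ P A 1
  | snoc {A : ℝ} {g : D} {l : ι} (ε : ℤˣ) (hg : WLe x w ρ P A g) (hl : l ∈ P) :
      WLe x w ρ P (A + ρ ^ (w l + 1)) (g * x l ^ (ε : ℤ))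

namespace WLe

variable {D ι : Type*} [Group D] {x : ι → D} {w : ι → ℕ} {ρ : ℝ} {P Q : Set ι} {A B : ℝ} {g h : D}

theorem mono (hg : WLe x w ρ P A g) (hAB : A ≤ B) : WLe x w ρ P B g := by
  induction hg generalizing B with
  | one hA => exact one (hA.trans hAB)
  | @snoc A g l ε hg hl ih =>
    have := snoc ε (ih (B := B - ρ ^ (w l + 1)) (by linarith)) hl
    rwa [sub_add_cancel] at this

theorem mul (hg : WLe x w ρ P A g) (hh : WLe x w ρ P B h) :
    WLe x w ρ P (A + B) (g * h) := by
  induction hh with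
  | one hA => rw [mul_one]; exact hg.mono (by linarith)
  | snoc ε hh hl ih => rw [← mul_assoc, ← add_assoc]; exact ih.snoc ε hl

theorem single {l : ι} (hl : l ∈ P) (ε : ℤˣ) : WLe x w ρ P (ρ ^ (w l + 1)) (x l ^ (ε : ℤ)) := by
  have := (one (x := x) (w := w) (ρ := ρ) (P := P) le_rfl).snoc ε hl
  rwa [zero_add, one_mul] at this

theorem inv (hg : WLe x w ρ P A g) : WLe x w ρ P A g⁻¹ := by
  induction hg with
  | one hA => rw [inv_one]; exact one hA
  | @snoc A g l ε hg hl ih =>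
    rw [mul_inv_rev, add_comm]
    have := single (x := x) (w := w) (ρ := ρ) hl (-ε)
    rw [Units.val_neg, zpow_neg] at this
    exact this.mul ih

theorem pow (hg : WLe x w ρ P A g) (n : ℕ) : WLe x w ρ P (n * A) (g ^ n) := by
  induction n with
  | zero => rw [pow_zero]; exact one (by simp)
  | succ n ih =>
    rw [pow_succ]
    exact (ih.mul hg).mono (by push_cast; linarith)

theorem zpow (hg : WLe x w ρ P A g) (n : ℤ) : WLe x w ρ P (n.natAbs * A) (g ^ n) := by
  rcases Int.natAbs_eq n with hn | hn
  · conv => { arg 6; rw [hn] }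
    rw [zpow_natCast]
    exact hg.pow _
  · conv => { arg 6; rw [hn] }
    rw [zpow_neg, zpow_natCast]
    exact (hg.pow _).inv

theorem eq_one (hg : WLe x w ρ ∅ A g) : g = 1 := by
  cases hg with
  | one => rfl
  | snoc ε hg hl => exact hl.elim

theorem conj {c : D} {κ : ℝ} (hκ : 0 ≤ κ) (hc : ∀ l ∈ P, ∀ ε : ℤˣ,
    WLe x w ρ P (ρ ^ (w l + 1) * κ) (c⁻¹ * x l ^ (ε : ℤ) * c)) (hg : WLe x w ρ P A g) :
    WLe x w ρ P (A * κ) (c⁻¹ * g * c) := by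
  induction hg with
  | one hA => rw [mul_one, inv_mul_cancel]; exact one (by positivity)
  | @snoc A g l ε hg hl ih =>
    have := ih.mul (hc l hl ε)
    rw [← add_mul] at this
    convert this using 1
    group

/-- Elements of the subgroup generated by letters of weight at least `j`. -/
theorem exists_of_mem_closure (x : ι → D) (w : ι → ℕ) {j : ℕ} (hQP : Q ⊆ P) (hQ : ∀ l ∈ Q, j ≤ w l)
    (hg : g ∈ Subgroup.closure (x '' Q)) :
    ∃ K : ℝ, 0 ≤ K ∧ ∀ ρ : ℝ, 0 ≤ ρ → ρ ≤ 1 → WLe x w ρ P (K * ρ ^ (j + 1)) g := by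
  induction hg using Subgroup.closure_induction with
  | mem y hy =>
    obtain ⟨l, hl, rfl⟩ := hy
    refine ⟨1, zero_le_one, fun ρ h0 h1 => ?_⟩
    have := single (x := x) (w := w) (ρ := ρ) (hQP hl) 1
    rw [Units.val_one, zpow_one] at this
    refine this.mono ?_
    rw [one_mul]
    exact pow_le_pow_of_le_one h0 h1 (Nat.succ_le_succ (hQ l hl))
  | one => exact ⟨0, le_rfl, fun ρ h0 h1 => one (by simp)⟩
  | mul a b _ _ ha hb =>
    obtain ⟨K, hK, hKa⟩ := ha
    obtain ⟨L, hL, hLb⟩ := hb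
    refine ⟨K + L, add_nonneg hK hL, fun ρ h0 h1 => ?_⟩
    rw [add_mul]
    exact (hKa ρ h0 h1).mul (hLb ρ h0 h1)
  | inv a _ ha =>
    obtain ⟨K, hK, hKa⟩ := ha
    exact ⟨K, hK, fun ρ h0 h1 => (hKa ρ h0 h1).inv⟩

end WLe

/-- The letters from the `k`-th on. -/
def finTail (m k : ℕ) : Set (Fin m) := {l | k ≤ (l : ℕ)}

/-- A finite family adapted to the lower central series. -/
structure LCSBasis {D : Type*} [Group D] {m : ℕ} (x : Fin m → D) (w : Fin m → ℕ) : Prop where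
  mono : Monotone w
  closure : ∀ j, Subgroup.closure (x '' {l | j ≤ w l}) = (⊤ : Subgroup D).lowerCentralSeries j

namespace LCSBasis

variable {D : Type*} [Group D]

theorem exists_of_noeth (hD : Noeth D) [Group.IsNilpotent D] :
    ∃ (m : ℕ) (x : Fin m → D) (w : Fin m → ℕ), LCSBasis x w := by
  classical
  obtain ⟨c, hc⟩ := Subgroup.nilpotent_iff_lowerCentralSeries.mp ‹Group.IsNilpotent D›
  choose F hF using fun j => hD ((⊤ : Subgroup D).lowerCentralSeries j)
  let L : List (D × ℕ) := (List.range c).flatMap fun j => (F j).toList.map fun y => (y, j)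
  have hL : ∀ p, p ∈ L ↔ p.2 < c ∧ p.1 ∈ F p.2 := by
    rintro ⟨y, j⟩
    simp [L]
  have hs : L.Pairwise fun p q => p.2 ≤ q.2 := by
    rw [List.pairwise_flatMap]
    refine ⟨fun j _ => ?_, List.pairwise_lt_range.imp ?_⟩
    · rw [List.pairwise_map]
      exact List.pairwise_iff_get.mpr fun _ _ _ => le_rfl
    · intro i j hij p hp q hq
      simp only [List.mem_map] at hp hq
      obtain ⟨_, _, rfl⟩ := hp
      obtain ⟨_, _, rfl⟩ := hq
      exact hij.le
  refine ⟨L.length, fun l => (L.get l).1, fun l => (L.get l).2, ?_, fun j => le_antisymm ?_ ?_⟩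
  · intro a b hab
    rcases hab.lt_or_eq with hlt | rfl
    · exact List.pairwise_iff_get.mp hs a b hlt
    · exact le_rfl
  · rw [Subgroup.closure_le]
    rintro _ ⟨l, hl, rfl⟩
    have h1 := ((hL _).mp (L.get_mem l)).2
    refine Subgroup.lowerCentralSeries_antitone _ hl ?_
    rw [← hF]
    exact Subgroup.subset_closure h1
  · rcases lt_or_ge j c with hj | hj
    · rw [← hF, Subgroup.closure_le]
      intro y hy
      obtain ⟨l, hl⟩ := List.mem_iff_get.mp ((hL (y, j)).mpr ⟨hj, hy⟩)
      refine Subgroup.subset_closure ⟨l, ?_, ?_⟩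
      · exact (congrArg Prod.snd hl).ge
      · exact congrArg Prod.fst hl
    · have : (⊤ : Subgroup D).lowerCentralSeries j = ⊥ :=
        eq_bot_iff.mpr (hc ▸ Subgroup.lowerCentralSeries_antitone _ hj)
      rw [this]
      exact bot_le

variable {m : ℕ} {x : Fin m → D} {w : Fin m → ℕ} (h : LCSBasis x w)
include h

theorem mem (l : Fin m) : x l ∈ (⊤ : Subgroup D).lowerCentralSeries (w l) := by
  rw [← h.closure]
  exact Subgroup.subset_closure ⟨l, le_refl (w l), rfl⟩

theorem exists_conj (k : Fin m) : ∃ K : ℝ, 0 ≤ K ∧ ∀ ρ : ℝ, 0 ≤ ρ → ρ ≤ 1 → ∀ δ : ℤˣ,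
    ∀ l ∈ finTail m (k + 1), ∀ ε : ℤˣ,
      WLe x w ρ (finTail m (k + 1)) (ρ ^ (w l + 1) * (1 + K * ρ ^ (w k + 1)))
        ((x k ^ (δ : ℤ))⁻¹ * x l ^ (ε : ℤ) * x k ^ (δ : ℤ)) := by
  have key : ∀ q : ℤˣ × Fin m × ℤˣ, ∃ K : ℝ, 0 ≤ K ∧ ∀ ρ : ℝ, 0 ≤ ρ → ρ ≤ 1 →
      q.2.1 ∈ finTail m (k + 1) →
      WLe x w ρ (finTail m (k + 1)) (ρ ^ (w q.2.1 + 1) * (1 + K * ρ ^ (w k + 1)))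
        ((x k ^ (q.1 : ℤ))⁻¹ * x q.2.1 ^ (q.2.2 : ℤ) * x k ^ (q.1 : ℤ)) := by
    rintro ⟨δ, l, ε⟩
    have h1 : ⁅(x l ^ (ε : ℤ))⁻¹, (x k ^ (δ : ℤ))⁻¹⁆ ∈
        (⊤ : Subgroup D).lowerCentralSeries (w l + w k + 1) :=
      commutator_lowerCentralSeries_le _ _ (Subgroup.commutator_mem_commutator
        (inv_mem (zpow_mem (h.mem l) _)) (inv_mem (zpow_mem (h.mem k) _)))
    rw [← h.closure] at h1
    obtain ⟨K, hK, hK'⟩ := WLe.exists_of_mem_closure (P := finTail m (k + 1)) x w (fun l' hl' => by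
      have hl'' : w l + w k + 1 ≤ w l' := hl'
      by_contra hcon
      have : l' ≤ k := by
        rw [finTail, Set.mem_ofPred_eq] at hcon
        exact Fin.le_def.mpr (by omega)
      have := h.mono this
      omega) (fun l' hl' => hl') h1
    refine ⟨K, hK, fun ρ h0 h1 hl => ?_⟩
    have := (WLe.single (x := x) (w := w) (ρ := ρ) (P := (finTail m (k + 1))) hl ε).mul
      (hK' ρ h0 h1)
    have h2 := this.mono (B := ρ ^ (w l + 1) * (1 + K * ρ ^ (w k + 1))) (le_of_eq (by ring))
    convert h2 using 1
    rw [commutatorElement_def]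
    group
  choose K hK0 hK using key
  refine ⟨∑ q, K q, Finset.sum_nonneg fun q _ => hK0 q, fun ρ h0 h1 δ l hl ε =>
    (hK (δ, l, ε) ρ h0 h1 hl).mono ?_⟩
  have : K (δ, l, ε) ≤ ∑ q, K q :=
    Finset.single_le_sum (fun q _ => hK0 q) (Finset.mem_univ _)
  gcongr

theorem exists_extract (k : Fin m) : ∃ K : ℝ, 0 ≤ K ∧ ∀ ρ : ℝ, 0 ≤ ρ → ρ ≤ 1 → ∀ A g,
    WLe x w ρ (finTail m k) A g → ∃ (e : ℤ) (T : D), g = x k ^ e * T ∧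
      e.natAbs * ρ ^ (w k + 1) ≤ A ∧
      WLe x w ρ (finTail m (k + 1)) (A * Real.exp (K * A)) T := by
  obtain ⟨K, hK0, hK⟩ := h.exists_conj k
  refine ⟨K, hK0, fun ρ h0 h1 A g hg => ?_⟩
  set κ := 1 + K * ρ ^ (w k + 1) with hκ
  have hκ1 : 1 ≤ κ := by
    have : 0 ≤ K * ρ ^ (w k + 1) := by positivity
    linarith
  have key : ∃ (e : ℤ) (N : ℕ) (T : D) (B : ℝ), g = x k ^ e * T ∧ e.natAbs ≤ N ∧ 0 ≤ B ∧
      N * ρ ^ (w k + 1) + B ≤ A ∧ WLe x w ρ (finTail m (k + 1)) (B * κ ^ N) T := by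
    induction hg with
    | one hA => exact ⟨0, 0, 1, 0, by simp, by simp, le_rfl, by simpa using hA, .one (by simp)⟩
    | @snoc A g l ε hg hl ih =>
      obtain ⟨e, N, T, B, rfl, he, hB, hA, hT⟩ := ih
      rcases Nat.lt_or_ge (k : ℕ) l with hlt | hge
      · refine ⟨e, N, T * x l ^ (ε : ℤ), B + ρ ^ (w l + 1), by rw [mul_assoc], he, by positivity,
          by linarith, (hT.snoc ε hlt).mono ?_⟩
        have : 1 ≤ κ ^ N := one_le_pow₀ hκ1
        have h3 : 0 ≤ ρ ^ (w l + 1) := by positivity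
        nlinarith
      · obtain rfl : l = k := Fin.ext (le_antisymm hge hl)
        refine ⟨e + ε, N + 1, (x l ^ (ε : ℤ))⁻¹ * T * x l ^ (ε : ℤ), B, ?_, ?_, hB, ?_, ?_⟩
        · rw [zpow_add]
          group
        · refine (Int.natAbs_add_le _ _).trans ?_
          rw [Int.units_natAbs]
          omega
        · push_cast
          linarith
        · have := hT.conj (κ := κ) (by linarith) (fun l' hl' ε' => hK ρ h0 h1 ε l' hl' ε')
          refine this.mono (le_of_eq ?_)
          rw [pow_succ, mul_assoc]
  obtain ⟨e, N, T, B, rfl, he, hB, hA, hT⟩ := key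
  have hρ : 0 ≤ ρ ^ (w k + 1) := by positivity
  have hNA : N * ρ ^ (w k + 1) ≤ A := by linarith
  refine ⟨e, T, rfl, ?_, hT.mono ?_⟩
  · exact (mul_le_mul_of_nonneg_right (by exact_mod_cast he) hρ).trans hNA
  · have h2 : κ ^ N ≤ Real.exp (K * A) := by
      calc κ ^ N ≤ Real.exp (K * ρ ^ (w k + 1)) ^ N := by
            refine pow_le_pow_left₀ (by linarith) ?_ N
            rw [hκ, add_comm]
            exact Real.add_one_le_exp _
        _ = Real.exp (K * (N * ρ ^ (w k + 1))) := by
            rw [← Real.exp_nat_mul]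
            ring_nf
        _ ≤ Real.exp (K * A) := Real.exp_le_exp.mpr (by gcongr)
    have hBA : B ≤ A := by
      have : 0 ≤ N * ρ ^ (w k + 1) := by positivity
      linarith
    exact mul_le_mul hBA h2 (by positivity) (hB.trans hBA)

end LCSBasis

end PolyGrowth

namespace PolyGrowth

open scoped Pointwise commutatorElement

section Commutator

variable {D : Type*} [Group D]

theorem commutatorElement_pow_left {g y : D} (hz : ∀ a, Commute ⁅g, y⁆ a) (n : ℕ) :
    ⁅g ^ n, y⁆ = ⁅g, y⁆ ^ n := by
  induction n with
  | zero => simp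
  | succ n ih =>
    have h1 : ⁅g ^ (n + 1), y⁆ = g * ⁅g ^ n, y⁆ * g⁻¹ * ⁅g, y⁆ := by
      simp only [commutatorElement_def, pow_succ']
      group
    rw [h1, ih, ((hz g).pow_left n).symm.eq, mul_inv_cancel_right, pow_succ]

theorem commutatorElement_pow_right {g y : D} (hz : ∀ a, Commute ⁅g, y⁆ a) (n : ℕ) :
    ⁅g, y ^ n⁆ = ⁅g, y⁆ ^ n := by
  have h1 : ∀ a, Commute ⁅y, g⁆ a := fun a => by
    rw [← commutatorElement_inv]
    exact (hz a).inv_left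
  rw [← commutatorElement_inv, commutatorElement_pow_left h1, ← inv_pow, commutatorElement_inv]

theorem commute_mk_lowerCentralSeries {i : ℕ} {g : D}
    (hg : g ∈ (⊤ : Subgroup D).lowerCentralSeries i)
    (a : D ⧸ (⊤ : Subgroup D).lowerCentralSeries (i + 1)) :
    Commute (QuotientGroup.mk' ((⊤ : Subgroup D).lowerCentralSeries (i + 1)) g) a := by
  obtain ⟨y, rfl⟩ := QuotientGroup.mk'_surjective _ a
  rw [← commutatorElement_eq_one_iff_commute, ← map_commutatorElement]
  refine (QuotientGroup.eq_one_iff _).mpr ?_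
  rw [Subgroup.lowerCentralSeries_succ]
  exact Subgroup.commutator_mem_commutator hg trivial

theorem inv_mem_pow {S : Set D} (hS : S⁻¹ = S) {g : D} {n : ℕ} (hg : g ∈ S ^ n) : g⁻¹ ∈ S ^ n := by
  have : (S ^ n)⁻¹ = S ^ n := by rw [← inv_pow, hS]
  rw [← this]
  exact Set.inv_mem_inv.mpr hg

theorem commutatorElement_mem_pow {S : Set D} (hS : S⁻¹ = S) {g y : D} {a b : ℕ}
    (hg : g ∈ S ^ a) (hy : y ∈ S ^ b) : ⁅g, y⁆ ∈ S ^ (a + b + a + b) := by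
  rw [commutatorElement_def, pow_add, pow_add, pow_add]
  exact Set.mul_mem_mul (Set.mul_mem_mul (Set.mul_mem_mul hg hy) (inv_mem_pow hS hg))
    (inv_mem_pow hS hy)

theorem exists_mem_pow_of_closure {S : Set D} (hS : S⁻¹ = S)
    (hc : Subgroup.closure S = ⊤) (g : D) : ∃ n, g ∈ S ^ n := by
  have hg : g ∈ Subgroup.closure S := hc ▸ trivial
  induction hg using Subgroup.closure_induction with
  | mem y hy => exact ⟨1, by rwa [pow_one]⟩
  | one => exact ⟨0, by simp⟩
  | mul a b _ _ ha hb =>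
    obtain ⟨n, hn⟩ := ha
    obtain ⟨k, hk⟩ := hb
    exact ⟨n + k, by rw [pow_add]; exact Set.mul_mem_mul hn hk⟩
  | inv a _ ha =>
    obtain ⟨n, hn⟩ := ha
    exact ⟨n, inv_mem_pow hS hn⟩

/-- Powers of elements of the lower central series are polynomially distorted, modulo the next
term. -/
theorem exists_distortion {S : Set D} (h1 : (1 : D) ∈ S) (hS : S⁻¹ = S)
    (hc : Subgroup.closure S = ⊤) (i : ℕ) : ∀ g ∈ (⊤ : Subgroup D).lowerCentralSeries i,
      ∃ C : ℕ, ∀ n : ℕ, 1 ≤ n → ∀ e ≤ n ^ (i + 1), ∃ u ∈ S ^ (C * n),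
        QuotientGroup.mk' ((⊤ : Subgroup D).lowerCentralSeries (i + 1)) u =
          QuotientGroup.mk' ((⊤ : Subgroup D).lowerCentralSeries (i + 1)) g ^ e := by
  have hmono : ∀ {a b : ℕ}, a ≤ b → S ^ a ⊆ S ^ b := fun hab => Set.pow_subset_pow_right h1 hab
  have hpow : ∀ {g : D} {a : ℕ}, g ∈ S ^ a → ∀ b, g ^ b ∈ S ^ (a * b) := fun hg b => by
    rw [pow_mul]
    exact Set.pow_mem_pow hg
  induction i with
  | zero =>
    intro g _
    obtain ⟨C, hC⟩ := exists_mem_pow_of_closure hS hc g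
    refine ⟨C, fun n hn e he => ⟨g ^ e, hmono ?_ (hpow hC e), map_pow _ _ _⟩⟩
    exact Nat.mul_le_mul_left C (by simpa using he)
  | succ i ih =>
    intro g hg
    rw [Subgroup.lowerCentralSeries_succ, Subgroup.commutator_def] at hg
    set π := QuotientGroup.mk' ((⊤ : Subgroup D).lowerCentralSeries (i + 1 + 1)) with hπ
    induction hg using Subgroup.closure_induction with
    | mem z hz =>
      obtain ⟨g, hg, y, -, rfl⟩ := hz
      obtain ⟨C, hC⟩ := ih g hg
      obtain ⟨a₀, ha₀⟩ := exists_mem_pow_of_closure hS hc g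
      obtain ⟨b₀, hb₀⟩ := exists_mem_pow_of_closure hS hc y
      have hcent : ∀ z ∈ (⊤ : Subgroup D).lowerCentralSeries (i + 1), ∀ a, Commute (π z) a :=
        fun z hz a => commute_mk_lowerCentralSeries hz a
      have hcomm : ∀ (g' y' : D), g' ∈ (⊤ : Subgroup D).lowerCentralSeries i →
          ∀ a, Commute ⁅π g', π y'⁆ a := fun g' y' hg' a => by
        rw [← map_commutatorElement]
        refine hcent _ ?_ a
        rw [Subgroup.lowerCentralSeries_succ]
        exact Subgroup.commutator_mem_commutator hg' trivial
      refine ⟨(C + b₀ + C + b₀) + (a₀ + b₀ + a₀ + b₀), fun n hn e he => ?_⟩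
      obtain ⟨u, hu, hug⟩ := hC n hn (e / n) (by
        refine Nat.div_le_of_le_mul ?_
        rwa [← pow_succ'])
      refine ⟨⁅u, y ^ n⁆ * ⁅g, y ^ (e % n)⁆, ?_, ?_⟩
      · rw [add_mul, pow_add]
        refine Set.mul_mem_mul ?_ ?_
        · have := commutatorElement_mem_pow hS hu (hpow hb₀ n)
          simpa only [add_mul] using this
        · refine hmono ?_ (commutatorElement_mem_pow hS ha₀ (hpow hb₀ (e % n)))
          have h2 : b₀ * (e % n) ≤ b₀ * n := Nat.mul_le_mul_left _ (Nat.mod_lt _ hn).le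
          have h3 : a₀ ≤ a₀ * n := Nat.le_mul_of_pos_right _ hn
          rw [add_mul, add_mul, add_mul]
          omega
      · have hv : (g ^ (e / n))⁻¹ * u ∈ (⊤ : Subgroup D).lowerCentralSeries (i + 1) := by
          rw [← map_pow] at hug
          exact QuotientGroup.eq.mp hug.symm
        have hvc := hcent _ hv
        have h2 : π u = π g ^ (e / n) * π ((g ^ (e / n))⁻¹ * u) := by
          rw [← map_pow, ← map_mul, mul_inv_cancel_left]
        have h3 : ⁅π u, π y ^ n⁆ = ⁅π g ^ (e / n), π y ^ n⁆ := by
          rw [h2, commutatorElement_def, commutatorElement_def, mul_inv_rev]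
          generalize π ((g ^ (e / n))⁻¹ * u) = v at hvc
          rw [mul_assoc _ v, (hvc _).eq]
          group
        rw [map_mul, map_commutatorElement, map_commutatorElement, map_pow, map_pow, h3,
          map_commutatorElement, commutatorElement_pow_right (hcomm g y hg),
          ← map_pow π g, commutatorElement_pow_right (hcomm _ y (pow_mem hg _)), map_pow,
          commutatorElement_pow_left (hcomm g y hg), ← pow_mul, ← pow_add, mul_comm,
          Nat.div_add_mod]
    | one => exact ⟨0, fun n hn e he => ⟨1, by simp, by rw [map_one, one_pow]⟩⟩
    | mul a b ha hb iha ihb =>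
      obtain ⟨A, hA⟩ := iha
      obtain ⟨B, hB⟩ := ihb
      refine ⟨A + B, fun n hn e he => ?_⟩
      obtain ⟨u, hu, hua⟩ := hA n hn e he
      obtain ⟨v, hv, hvb⟩ := hB n hn e he
      refine ⟨u * v, by rw [add_mul, pow_add]; exact Set.mul_mem_mul hu hv, ?_⟩
      rw [map_mul, hua, hvb, map_mul, Commute.mul_pow]
      refine commute_mk_lowerCentralSeries ?_ _
      rw [Subgroup.lowerCentralSeries_succ, Subgroup.commutator_def]
      exact ha
    | inv a _ ih =>
      obtain ⟨A, hA⟩ := ih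
      refine ⟨A, fun n hn e he => ?_⟩
      obtain ⟨u, hu, hua⟩ := hA n hn e he
      exact ⟨u⁻¹, inv_mem_pow hS hu, by rw [map_inv, hua, map_inv, inv_pow]⟩

end Commutator

namespace LCSBasis

variable {D : Type*} [Group D] {m : ℕ} {x : Fin m → D} {w : Fin m → ℕ}

theorem ncard_le_of_subset {y : D} {E : Set ℤ} {U V : Set D} (hE : E.Finite) (hV : V.Finite)
    (hU : ∀ g ∈ U, ∃ e ∈ E, ∃ v ∈ V, g = y ^ e * v) : U.Finite ∧ U.ncard ≤ E.ncard * V.ncard := by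
  have hsub : U ⊆ (fun p : ℤ × D => y ^ p.1 * p.2) '' (E ×ˢ V) := fun g hg => by
    obtain ⟨e, he, v, hv, rfl⟩ := hU g hg
    exact ⟨(e, v), ⟨he, hv⟩, rfl⟩
  have hfin := hE.prod hV
  refine ⟨(hfin.image _).subset hsub, (Set.ncard_le_ncard hsub (hfin.image _)).trans ?_⟩
  rw [← Set.ncard_prod]
  exact Set.ncard_image_le hfin

/-- Words of bounded weighted length in the letters from the `k`-th on grow with degree at most
`d`. -/
def Upper (x : Fin m → D) (w : Fin m → ℕ) (k d : ℕ) : Prop :=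
  ∀ A : ℝ, 0 ≤ A → ∃ C : ℝ, 0 ≤ C ∧ ∀ n : ℕ, 1 ≤ n →
    {g | WLe x w (n : ℝ)⁻¹ (finTail m k) A g}.Finite ∧
      ({g | WLe x w (n : ℝ)⁻¹ (finTail m k) A g}.ncard : ℝ) ≤ C * n ^ d

/-- The subgroup generated by the letters from the `k`-th on grows with degree at least `d`. -/
def Lower (x : Fin m → D) (S : Set D) (k d : ℕ) : Prop :=
  ∃ C : ℕ, ∀ n : ℕ, 1 ≤ n → ∃ F : Set D, F ⊆ Subgroup.closure (x '' finTail m k) ∧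
    F ⊆ S ^ (C * n) ∧ n ^ d ≤ F.ncard

theorem upper_base : Upper x w m 0 := by
  intro A hA
  refine ⟨1, zero_le_one, fun n hn => ?_⟩
  have : {g | WLe x w (n : ℝ)⁻¹ (finTail m m) A g} ⊆ {1} := fun g hg => by
    have hT : finTail m m = ∅ := by
      ext l
      simp [finTail]
    rw [Set.mem_ofPred_eq, hT] at hg
    exact hg.eq_one
  refine ⟨(Set.finite_singleton 1).subset this, ?_⟩
  have := Set.ncard_le_ncard this (Set.finite_singleton 1)
  rw [Set.ncard_singleton] at this
  simpa using this

theorem lower_base (S : Set D) (k : ℕ) : Lower x S k 0 :=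
  ⟨0, fun n hn => ⟨{1}, by simp, by simp, by simp⟩⟩

variable (h : LCSBasis x w)
include h

theorem upper_succ {k : Fin m} {d : ℕ} (hd : Upper x w (k + 1) d) :
    Upper x w k (w k + 1 + d) := by
  obtain ⟨K, hK0, hK⟩ := h.exists_extract k
  intro A hA
  obtain ⟨C, hC0, hC⟩ := hd (A * Real.exp (K * A)) (by positivity)
  refine ⟨(2 * A + 1) * C, by positivity, fun n hn => ?_⟩
  obtain ⟨hfin, hle⟩ := hC n hn
  have hn1 : (1 : ℝ) ≤ n := by exact_mod_cast hn
  have hn0 : (0 : ℝ) < n := by linarith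
  set M := ⌊A * n ^ (w k + 1)⌋₊ with hM
  have hMle : (M : ℝ) ≤ A * n ^ (w k + 1) := Nat.floor_le (by positivity)
  obtain ⟨h1, h2⟩ := ncard_le_of_subset (y := x k) (E := Set.Icc (-(M : ℤ)) M)
    (U := {g | WLe x w (n : ℝ)⁻¹ (finTail m k) A g}) (Set.finite_Icc _ _) hfin (fun g hg => by
      obtain ⟨e, T, rfl, he, hT⟩ := hK (n : ℝ)⁻¹ (by positivity) (inv_le_one_of_one_le₀ hn1) A g hg
      refine ⟨e, ?_, T, hT, rfl⟩
      have : e.natAbs ≤ M := by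
        refine Nat.le_floor ?_
        rwa [inv_pow, ← div_eq_mul_inv, div_le_iff₀ (by positivity)] at he
      rw [Set.mem_Icc]
      omega)
  refine ⟨h1, ?_⟩
  have hcard : (Set.Icc (-(M : ℤ)) M).ncard = 2 * M + 1 := by
    rw [← Finset.coe_Icc, Set.ncard_coe_finset, Int.card_Icc]
    omega
  rw [hcard] at h2
  have hp : (1 : ℝ) ≤ n ^ (w k + 1) := one_le_pow₀ hn1
  calc (({g | WLe x w (n : ℝ)⁻¹ (finTail m k) A g}.ncard : ℕ) : ℝ)
      ≤ (2 * M + 1) * _ := by exact_mod_cast h2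
    _ ≤ ((2 * A + 1) * n ^ (w k + 1)) * (C * n ^ d) :=
        mul_le_mul (by linarith) hle (by positivity) (by positivity)
    _ = (2 * A + 1) * C * n ^ (w k + 1 + d) := by ring

theorem upper_succ_of_mem {k : Fin m} {d o : ℕ} (ho : 0 < o)
    (hmem : x k ^ o ∈ Subgroup.closure (x '' finTail m (k + 1))) (hd : Upper x w (k + 1) d) :
    Upper x w k d := by
  obtain ⟨K, hK0, hK⟩ := h.exists_extract k
  obtain ⟨L, hL0, hL⟩ := WLe.exists_of_mem_closure (j := w k) x w (le_refl (finTail m (k + 1)))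
    (fun l hl => h.mono (by
      have : (k : ℕ) + 1 ≤ l := hl
      exact Fin.le_def.mpr (by omega))) hmem
  intro A hA
  obtain ⟨C, hC0, hC⟩ := hd (A * L + A * Real.exp (K * A)) (by positivity)
  refine ⟨o * C, by positivity, fun n hn => ?_⟩
  obtain ⟨hfin, hle⟩ := hC n hn
  have hn1 : (1 : ℝ) ≤ n := by exact_mod_cast hn
  have hinv : (n : ℝ)⁻¹ ≤ 1 := inv_le_one_of_one_le₀ hn1
  obtain ⟨h1, h2⟩ := ncard_le_of_subset (y := x k) (E := Set.Ico (0 : ℤ) o)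
    (U := {g | WLe x w (n : ℝ)⁻¹ (finTail m k) A g}) (Set.finite_Ico _ _) hfin (fun g hg => by
      obtain ⟨e, T, rfl, he, hT⟩ := hK (n : ℝ)⁻¹ (by positivity) hinv A g hg
      have ho' : (0 : ℤ) < o := by exact_mod_cast ho
      refine ⟨e % o, ⟨Int.emod_nonneg _ ho'.ne', Int.emod_lt_of_pos _ ho'⟩,
        (x k ^ o) ^ (e / o) * T, ?_, ?_⟩
      · have h3 := (hL (n : ℝ)⁻¹ (by positivity) hinv).zpow (e / o)
        refine (h3.mul hT).mono ?_
        have h4 : (e / o).natAbs ≤ e.natAbs := Int.natAbs_ediv_le_natAbs _ _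
        have h5 : ((e / o).natAbs : ℝ) ≤ e.natAbs := by exact_mod_cast h4
        have h6 : (0 : ℝ) ≤ (n : ℝ)⁻¹ ^ (w k + 1) := by positivity
        have h7 := mul_le_mul_of_nonneg_left ((mul_le_mul_of_nonneg_right h5 h6).trans he) hL0
        linarith
      · rw [← mul_assoc, ← zpow_natCast, ← zpow_mul, ← zpow_add, Int.emod_add_mul_ediv])
  refine ⟨h1, ?_⟩
  have hcard : (Set.Ico (0 : ℤ) o).ncard = o := by
    rw [← Finset.coe_Ico, Set.ncard_coe_finset, Int.card_Ico]
    omega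
  rw [hcard] at h2
  calc (({g | WLe x w (n : ℝ)⁻¹ (finTail m k) A g}.ncard : ℕ) : ℝ)
      ≤ o * ({g | WLe x w (n : ℝ)⁻¹ (finTail m (k + 1))
        (A * L + A * Real.exp (K * A)) g}.ncard : ℝ) := by exact_mod_cast h2
    _ ≤ o * (C * n ^ d) := by gcongr
    _ = o * C * n ^ d := by ring

omit h in
theorem closure_finTail_le (k : ℕ) :
    Subgroup.closure (x '' finTail m (k + 1)) ≤ Subgroup.closure (x '' finTail m k) :=
  Subgroup.closure_mono (Set.image_mono fun l hl => by
    have : k + 1 ≤ (l : ℕ) := hl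
    exact (Nat.le_succ k).trans this)

omit h in
theorem Lower.succ {S : Set D} {k d : ℕ} (hd : Lower x S (k + 1) d) : Lower x S k d := by
  obtain ⟨C, hC⟩ := hd
  refine ⟨C, fun n hn => ?_⟩
  obtain ⟨F, hF, hF'⟩ := hC n hn
  exact ⟨F, hF.trans (closure_finTail_le k), hF'⟩

theorem lower_succ {S : Set D} (hSf : S.Finite) (h1 : (1 : D) ∈ S) (hS : S⁻¹ = S)
    (hc : Subgroup.closure S = ⊤) {k : Fin m} {d : ℕ}
    (hinf : ∀ o : ℕ, 0 < o → x k ^ o ∉ Subgroup.closure (x '' finTail m (k + 1)))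
    (hd : Lower x S (k + 1) d) : Lower x S k (w k + 1 + d) := by
  obtain ⟨C₁, hC₁⟩ := exists_distortion h1 hS hc (w k) (x k) (h.mem k)
  obtain ⟨C, hC⟩ := hd
  refine ⟨C₁ + C, fun n hn => ?_⟩
  obtain ⟨F, hFH, hFS, hF⟩ := hC n hn
  choose! u hu hux using hC₁ n hn
  set H := Subgroup.closure (x '' finTail m (k + 1)) with hH
  have hγ : (⊤ : Subgroup D).lowerCentralSeries (w k + 1) ≤ H := by
    rw [← h.closure]
    refine Subgroup.closure_mono (Set.image_mono fun l (hl : w k + 1 ≤ w l) => ?_)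
    by_contra hcon
    have hlk : l ≤ k := by
      rw [finTail, Set.mem_ofPred_eq] at hcon
      exact Fin.le_def.mpr (by omega)
    have := h.mono hlk
    omega
  have hv : ∀ e ≤ n ^ (w k + 1), (x k ^ e)⁻¹ * u e ∈ H := fun e he => hγ (by
    have := hux e he
    rw [← map_pow] at this
    exact QuotientGroup.eq.mp this.symm)
  have hFfin : F.Finite := (finite_pow hSf _).subset hFS
  have hxk : x k ∈ Subgroup.closure (x '' finTail m k) :=
    Subgroup.subset_closure ⟨k, le_refl (k : ℕ), rfl⟩
  refine ⟨(fun p : ℕ × D => u p.1 * p.2) '' (Set.Iio (n ^ (w k + 1)) ×ˢ F), ?_, ?_, ?_⟩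
  · rintro _ ⟨⟨e, f⟩, ⟨he, hf⟩, rfl⟩
    have h2 := mul_mem (pow_mem hxk e) (closure_finTail_le k (hv e (le_of_lt he)))
    rw [mul_inv_cancel_left] at h2
    exact mul_mem h2 (closure_finTail_le k (hFH hf))
  · rintro _ ⟨⟨e, f⟩, ⟨he, hf⟩, rfl⟩
    rw [add_mul, pow_add]
    exact Set.mul_mem_mul (hu e (le_of_lt he)) (hFS hf)
  · rw [Set.InjOn.ncard_image, Set.ncard_prod, pow_add]
    · refine Nat.mul_le_mul (le_of_eq ?_) hF
      rw [← Finset.coe_Iio, Set.ncard_coe_finset, Nat.card_Iio]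
    · rintro ⟨e, f⟩ ⟨he, hf⟩ ⟨e', f'⟩ ⟨he', hf'⟩ heq
      have heq' : u e * f = u e' * f' := heq
      have h2 : x k ^ ((e : ℤ) - e') ∈ H := by
        have h3 := mul_mem (mul_mem (hv e' (le_of_lt he')) (mul_mem (hFH hf') (inv_mem (hFH hf))))
          (inv_mem (hv e (le_of_lt he)))
        have h4 : u e' * (f' * f⁻¹) = u e := by
          rw [← mul_assoc, ← heq', mul_inv_cancel_right]
        have h5 : (x k ^ e')⁻¹ * u e' * (f' * f⁻¹) * ((x k ^ e)⁻¹ * u e)⁻¹ =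
            (x k ^ e')⁻¹ * x k ^ e := by
          rw [mul_assoc _ (u e'), h4]
          group
        rw [mul_assoc ((x k ^ e')⁻¹ * u e')] at h5
        rw [sub_eq_neg_add, zpow_add, zpow_neg, zpow_natCast, zpow_natCast, ← h5]
        simpa only [mul_assoc] using h3
      have h4 : e = e' := by
        by_contra hne
        refine hinf ((e : ℤ) - e').natAbs (by omega) ?_
        rcases Int.natAbs_eq ((e : ℤ) - e') with h5 | h5
        · rwa [h5, zpow_natCast] at h2
        · rw [h5, zpow_neg, zpow_natCast] at h2
          exact inv_mem_iff.mp h2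
      subst h4
      rw [mul_left_cancel heq']

end LCSBasis

/-- **Bass–Guivarc'h**: finitely generated nilpotent groups have growth of integer degree. -/
theorem exists_growth_of_isNilpotent {D : Type*} [Group D] [Group.IsNilpotent D] (hD : Noeth D)
    {S : Set D} (hSf : S.Finite) (h1 : (1 : D) ∈ S) (hS : S⁻¹ = S)
    (hc : Subgroup.closure S = ⊤) : ∃ (d : ℕ) (A B : ℝ), 0 < A ∧ 0 < B ∧ ∀ n : ℕ, 1 ≤ n →
      A * n ^ d ≤ (S ^ n).ncard ∧ ((S ^ n).ncard : ℝ) ≤ B * n ^ d := by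
  obtain ⟨m, x, w, h⟩ := LCSBasis.exists_of_noeth hD
  have key : ∀ j ≤ m, ∃ d, LCSBasis.Upper x w (m - j) d ∧ LCSBasis.Lower x S (m - j) d := by
    intro j
    induction j with
    | zero => exact fun _ => ⟨0, LCSBasis.upper_base, LCSBasis.lower_base S m⟩
    | succ j ih =>
      intro hj
      obtain ⟨d, hu, hl⟩ := ih (by omega)
      obtain ⟨k, hk⟩ : ∃ k, k = m - (j + 1) := ⟨_, rfl⟩
      rw [show m - j = k + 1 by omega] at hu hl
      rw [← hk]
      have hkm : k < m := by omega
      by_cases hinf : ∀ o : ℕ, 0 < o → x ⟨k, hkm⟩ ^ o ∉ Subgroup.closure (x '' finTail m (k + 1))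
      · exact ⟨_, h.upper_succ (k := ⟨k, hkm⟩) hu,
          h.lower_succ (k := ⟨k, hkm⟩) hSf h1 hS hc hinf hl⟩
      · push Not at hinf
        obtain ⟨o, ho, hmem⟩ := hinf
        exact ⟨d, h.upper_succ_of_mem (k := ⟨k, hkm⟩) ho hmem hu, hl.succ⟩
  obtain ⟨d, hu, C, hl⟩ := key m le_rfl
  rw [Nat.sub_self] at hu
  simp only [Nat.sub_self] at hl
  have hT : finTail m 0 = Set.univ := by
    ext l
    simp [finTail]
  have hK : ∃ K : ℝ, 0 ≤ K ∧ ∀ s ∈ S, ∀ ρ : ℝ, 0 ≤ ρ → ρ ≤ 1 →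
      WLe x w ρ (finTail m 0) (K * ρ) s := by
    have : ∀ s : D, ∃ K : ℝ, 0 ≤ K ∧ ∀ ρ : ℝ, 0 ≤ ρ → ρ ≤ 1 →
        WLe x w ρ (finTail m 0) (K * ρ) s := fun s => by
      have hs : s ∈ Subgroup.closure (x '' {l | 0 ≤ w l}) := by
        rw [h.closure]
        trivial
      obtain ⟨K, hK, hK'⟩ := WLe.exists_of_mem_closure (j := 0) (P := finTail m 0) x w
        (fun l _ => hT ▸ trivial) (fun l hl => hl) hs
      exact ⟨K, hK, fun ρ h0 h1 => by simpa using hK' ρ h0 h1⟩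
    choose K hK hK' using this
    refine ⟨∑ s ∈ hSf.toFinset, K s, Finset.sum_nonneg fun s _ => hK s, fun s hs ρ h0 h1 =>
      (hK' s ρ h0 h1).mono ?_⟩
    gcongr
    exact Finset.single_le_sum (fun s _ => hK s) (hSf.mem_toFinset.mpr hs)
  obtain ⟨K, hK0, hK⟩ := hK
  obtain ⟨B, hB0, hB⟩ := hu K hK0
  refine ⟨d, (2 * ((C : ℝ) + 1))⁻¹ ^ d, B + 1, by positivity, by positivity, fun n hn => ⟨?_, ?_⟩⟩
  · have hn1 : (1 : ℝ) ≤ n := by exact_mod_cast hn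
    have hpos : 1 ≤ (S ^ n).ncard := by
      exact (Set.ncard_pos (finite_pow hSf n)).mpr ⟨1, Set.one_mem_pow h1⟩
    rw [← mul_pow, inv_mul_eq_div]
    rcases Nat.lt_or_ge n (C + 1) with hlt | hge
    · have h2 : (n : ℝ) < C + 1 := by exact_mod_cast hlt
      refine (pow_le_one₀ (by positivity) ?_).trans (by exact_mod_cast hpos)
      rw [div_le_one (by positivity)]
      linarith
    · obtain ⟨F, -, hFS, hF⟩ := hl (n / (C + 1)) (Nat.div_pos hge (Nat.succ_pos C))
      have h2 : F ⊆ S ^ n := hFS.trans (Set.pow_subset_pow_right h1 (by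
        refine le_trans ?_ (Nat.mul_div_le n (C + 1))
        exact Nat.mul_le_mul_right _ (Nat.le_succ C)))
      have h3 : (n / (C + 1)) ^ d ≤ (S ^ n).ncard :=
        hF.trans (Set.ncard_le_ncard h2 (finite_pow hSf n))
      have h4 : (n : ℝ) / (2 * (C + 1)) ≤ ((n / (C + 1) : ℕ) : ℝ) := by
        have h5 : n < 2 * (C + 1) * (n / (C + 1)) := by
          have := Nat.lt_div_mul_add (a := n) (Nat.succ_pos C)
          have h6 : C + 1 ≤ n / (C + 1) * (C + 1) :=
            Nat.le_mul_of_pos_left _ (Nat.div_pos hge (Nat.succ_pos C))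
          nlinarith
        rw [div_le_iff₀ (by positivity)]
        have h6 : (n : ℝ) < 2 * (C + 1) * ((n / (C + 1) : ℕ) : ℝ) := by exact_mod_cast h5
        linarith
      calc ((n : ℝ) / (2 * (C + 1))) ^ d ≤ ((n / (C + 1) : ℕ) : ℝ) ^ d :=
            pow_le_pow_left₀ (by positivity) h4 d
        _ ≤ _ := by exact_mod_cast h3
  · obtain ⟨hfin, hle⟩ := hB n hn
    have hn1 : (1 : ℝ) ≤ n := by exact_mod_cast hn
    have hn0 : (0 : ℝ) < n := by linarith
    have hsub : ∀ j : ℕ, ∀ g ∈ S ^ j, WLe x w (n : ℝ)⁻¹ (finTail m 0) (j * (K * (n : ℝ)⁻¹)) g := by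
      intro j
      induction j with
      | zero =>
        intro g hg
        rw [pow_zero, Set.mem_one] at hg
        rw [hg]
        exact .one (by simp)
      | succ j ih =>
        intro g hg
        rw [pow_succ] at hg
        obtain ⟨a, ha, s, hs, rfl⟩ := hg
        refine ((ih a ha).mul (hK s hs _ (by positivity) (inv_le_one_of_one_le₀ hn1))).mono ?_
        push_cast
        linarith
    have hsub' : S ^ n ⊆ {g | WLe x w (n : ℝ)⁻¹ (finTail m 0) K g} := fun g hg =>
      (hsub n g hg).mono (le_of_eq (by field_simp))
    have h2 : ((S ^ n).ncard : ℝ) ≤ _ := Nat.cast_le.mpr (Set.ncard_le_ncard hsub' hfin)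
    have h3 : (0 : ℝ) ≤ n ^ d := by positivity
    linarith [h2.trans hle]

end PolyGrowth

namespace PolyGrowth

open scoped Pointwise

/-- `f` grows like `n ^ d`. -/
def HasDegree (f : ℕ → ℕ) (d : ℕ) : Prop :=
  ∃ A B : ℝ, 0 < A ∧ 0 < B ∧ ∀ n : ℕ, 1 ≤ n → A * n ^ d ≤ f n ∧ (f n : ℝ) ≤ B * n ^ d

theorem HasDegree.of_le {f g : ℕ → ℕ} {d C K : ℕ} (hg : HasDegree g d) (hf : Monotone f)
    (hf1 : ∀ n, 1 ≤ f n) (hC : 1 ≤ C) (hK : 1 ≤ K) (hfg : ∀ n, 1 ≤ n → f n ≤ K * g (C * n))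
    (hgf : ∀ n, 1 ≤ n → g n ≤ K * f (C * n)) : HasDegree f d := by
  obtain ⟨A, B, hA, hB, h⟩ := hg
  have hC0 : (0 : ℝ) < C := by exact_mod_cast hC
  have hK0 : (0 : ℝ) < K := by exact_mod_cast hK
  refine ⟨min 1 (A / K) * (2 * C : ℝ)⁻¹ ^ d, K * B * C ^ d, by positivity, by positivity,
    fun n hn => ⟨?_, ?_⟩⟩
  · have hn1 : (1 : ℝ) ≤ n := by exact_mod_cast hn
    rw [mul_assoc, ← mul_pow, inv_mul_eq_div]
    rcases Nat.lt_or_ge n C with hlt | hge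
    · have h2 : (n : ℝ) < C := by exact_mod_cast hlt
      have h3 : ((n : ℝ) / (2 * C)) ^ d ≤ 1 :=
        pow_le_one₀ (by positivity) ((div_le_one (by positivity)).mpr (by linarith))
      calc min 1 (A / K) * ((n : ℝ) / (2 * C)) ^ d ≤ 1 * 1 :=
            mul_le_mul (min_le_left _ _) h3 (by positivity) zero_le_one
        _ ≤ f n := by
          rw [one_mul]
          exact_mod_cast hf1 n
    · have hpos : 0 < n / C := Nat.div_pos hge hC
      have h4 : (n : ℝ) / (2 * C) ≤ ((n / C : ℕ) : ℝ) := by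
        have h5 : n < 2 * C * (n / C) := by
          have := Nat.lt_div_mul_add (a := n) hC
          have h6 : C ≤ n / C * C := Nat.le_mul_of_pos_left _ hpos
          nlinarith
        rw [div_le_iff₀ (by positivity)]
        have h6 : (n : ℝ) < 2 * C * ((n / C : ℕ) : ℝ) := by exact_mod_cast h5
        linarith
      have h5 : ((g (n / C) : ℕ) : ℝ) ≤ K * f n := by
        exact_mod_cast (hgf _ hpos).trans (Nat.mul_le_mul_left K (hf (Nat.mul_div_le n C)))
      calc min 1 (A / K) * ((n : ℝ) / (2 * C)) ^ d ≤ A / K * ((n / C : ℕ) : ℝ) ^ d :=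
            mul_le_mul (min_le_right _ _) (pow_le_pow_left₀ (by positivity) h4 d) (by positivity)
              (by positivity)
        _ ≤ f n := by
          rw [div_mul_eq_mul_div, div_le_iff₀ hK0, mul_comm _ (K : ℝ)]
          exact ((h _ hpos).1).trans h5
  · have h2 : ((f n : ℕ) : ℝ) ≤ K * g (C * n) := by exact_mod_cast hfg n hn
    have h3 := (h (C * n) (Nat.mul_pos hC hn)).2
    push_cast at h3
    calc (f n : ℝ) ≤ K * g (C * n) := h2
      _ ≤ K * (B * (C * n) ^ d) := by gcongr
      _ = K * B * C ^ d * n ^ d := by ring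

section Groups

variable {D : Type*} [Group D]

theorem exists_subset_pow {S : Set D} (h1 : (1 : D) ∈ S) (hS : S⁻¹ = S)
    (hc : Subgroup.closure S = ⊤) {F : Set D} (hF : F.Finite) : ∃ n, 1 ≤ n ∧ F ⊆ S ^ n := by
  choose a ha using exists_mem_pow_of_closure hS hc
  refine ⟨∑ g ∈ hF.toFinset, a g + 1, Nat.le_add_left _ _, fun g hg => ?_⟩
  exact Set.pow_subset_pow_right h1
    ((Finset.single_le_sum (fun _ _ => Nat.zero_le _) (hF.mem_toFinset.mpr hg)).trans
      (Nat.le_succ _)) (ha g)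

theorem monotone_ncard_pow {S : Set D} (hSf : S.Finite) (h1 : (1 : D) ∈ S) :
    Monotone fun n => (S ^ n).ncard :=
  fun _ n hmn => Set.ncard_le_ncard (Set.pow_subset_pow_right h1 hmn) (finite_pow hSf n)

theorem exists_hasDegree_of_isVirtuallyNilpotent (hD : Noeth D)
    (hvn : Group.IsVirtuallyNilpotent D) {S : Set D} (hSf : S.Finite) (h1 : (1 : D) ∈ S)
    (hS : S⁻¹ = S) (hc : Subgroup.closure S = ⊤) : ∃ d, HasDegree (fun n => (S ^ n).ncard) d := by
  obtain ⟨H, hH, hHi⟩ := hvn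
  obtain ⟨T₀, hT₀⟩ := (hD.subgroup H) ⊤
  obtain ⟨T, hTf, hT1, hTi, hTc⟩ : ∃ T : Set H, T.Finite ∧ 1 ∈ T ∧ T⁻¹ = T ∧
      Subgroup.closure T = ⊤ := by
    refine ⟨insert 1 (T₀ ∪ (T₀ : Set H)⁻¹),
      (T₀.finite_toSet.union T₀.finite_toSet.inv).insert 1, Set.mem_insert _ _, ?_, ?_⟩
    · ext t
      simp [or_comm]
    · rw [eq_top_iff, ← hT₀]
      exact Subgroup.closure_mono (Set.subset_union_left.trans (Set.subset_insert _ _))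
  obtain ⟨d, hd⟩ := exists_growth_of_isNilpotent (hD.subgroup H) hTf hT1 hTi hTc
  obtain ⟨a, ha, hTa⟩ := exists_subset_pow h1 hS hc (hTf.image H.subtype)
  set R : Set D := insert 1 (Set.range fun q : D ⧸ H => q.out) with hR
  have hRf : R.Finite := (Set.finite_range _).insert 1
  obtain ⟨b, hb, hPb⟩ := exists_subset_pow hT1 hTi hTc
    (((hRf.inv.mul (hSf.mul hRf)).preimage H.subtype_injective.injOn))
  have hstep : S * R ⊆ R * (H.subtype '' T) ^ b := by
    intro p hp
    have hq : (QuotientGroup.mk p : D ⧸ H).out ∈ R := Set.mem_insert_of_mem _ ⟨_, rfl⟩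
    have hmem : (QuotientGroup.mk p : D ⧸ H).out⁻¹ * p ∈ H :=
      QuotientGroup.eq.mp (QuotientGroup.out_eq' _)
    have h2 : (⟨_, hmem⟩ : H) ∈ T ^ b := hPb (Set.mul_mem_mul (Set.inv_mem_inv.mpr hq) hp)
    refine ⟨_, hq, _, ?_, mul_inv_cancel_left _ _⟩
    rw [← Set.image_pow]
    exact ⟨_, h2, rfl⟩
  have hpow : ∀ n, S ^ n * R ⊆ R * (H.subtype '' T) ^ (b * n) := by
    intro n
    induction n with
    | zero => simp
    | succ n ih =>
      rw [pow_succ', mul_assoc, mul_add, mul_one, add_comm, pow_add, ← mul_assoc R]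
      refine (Set.mul_subset_mul_left ih).trans ?_
      rw [← mul_assoc]
      exact Set.mul_subset_mul_right hstep
  have hcard : ∀ n, ((H.subtype '' T) ^ n).ncard = (T ^ n).ncard := fun n => by
    rw [← Set.image_pow]
    exact H.subtype_injective.injOn.ncard_image
  have hTfin : ∀ n, ((H.subtype '' T) ^ n).Finite := finite_pow (hTf.image _)
  have hR1 : 1 ≤ R.ncard := (Set.ncard_pos hRf).mpr ⟨1, Set.mem_insert _ _⟩
  refine ⟨d, HasDegree.of_le (C := a * b) (K := R.ncard) hd (monotone_ncard_pow hSf h1)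
    (fun n => (Set.ncard_pos (finite_pow hSf n)).mpr ⟨1, Set.one_mem_pow h1⟩)
    (Nat.mul_pos ha hb) hR1 (fun n _ => ?_) (fun n _ => ?_)⟩
  · calc (S ^ n).ncard ≤ (R * (H.subtype '' T) ^ (b * n)).ncard :=
          Set.ncard_le_ncard (fun g hg => hpow n ⟨g, hg, 1, Set.mem_insert _ _, mul_one g⟩)
            (hRf.mul (hTfin _))
      _ ≤ R.ncard * (T ^ (b * n)).ncard := by
          rw [← hcard]
          exact Set.natCard_mul_le
      _ ≤ R.ncard * (T ^ (a * b * n)).ncard := Nat.mul_le_mul_left _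
          (monotone_ncard_pow hTf hT1 (by
            rw [mul_assoc]
            exact Nat.le_mul_of_pos_left _ ha))
  · calc (T ^ n).ncard ≤ (S ^ (a * n)).ncard := by
          rw [← hcard, pow_mul]
          exact Set.ncard_le_ncard (Set.pow_subset_pow_left hTa) (finite_pow (finite_pow hSf a) n)
      _ ≤ (S ^ (a * b * n)).ncard := monotone_ncard_pow hSf h1 (by
          rw [mul_right_comm]
          exact Nat.le_mul_of_pos_right _ hb)
      _ ≤ R.ncard * (S ^ (a * b * n)).ncard := Nat.le_mul_of_pos_left _ hR1

end Groups

namespace GraphAction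

variable {Γ X : Type*} [Group Γ] [MulAction Γ X] {G : SimpleGraph X} [G.LocallyFinite]
  (A : GraphAction Γ G)
include A

theorem monotone_ncard_ball (o : X) : Monotone fun n => {x | G.dist o x ≤ n}.ncard :=
  fun _ n hmn => Set.ncard_le_ncard (fun _ hx => le_trans hx hmn) (finite_setOf_dist_le A.conn o n)

theorem exists_hasDegree_ball (o : X) (h : Good Γ (len G o)) :
    ∃ d, HasDegree (fun n => {x | G.dist o x ≤ n}.ncard) d := by
  obtain ⟨N, hN, ⟨⟨C, hC⟩, hfin, hnoeth⟩, hvn⟩ := h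
  set π := QuotientGroup.mk' N with hπ
  set S : Set Γ := {g | len G o g ≤ 1} with hS
  have h1 : (1 : Γ) ∈ S := by simp [hS, len_one]
  have hSi : S⁻¹ = S := by
    ext g
    simp [hS, A.len_inv]
  have hSf : (π '' S).Finite := hfin 1
  obtain ⟨d, hd⟩ := exists_hasDegree_of_isVirtuallyNilpotent hnoeth hvn hSf
    ⟨1, h1, map_one π⟩ (by rw [← Set.image_inv, hSi])
    (by rw [← MonoidHom.map_closure, A.closure_len_le_one,
      Subgroup.map_top_of_surjective _ (QuotientGroup.mk'_surjective N)])
  have hball := finite_setOf_dist_le A.conn o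
  have hpos : ∀ n, 1 ≤ {x | G.dist o x ≤ n}.ncard := fun n =>
    (Set.ncard_pos (hball n)).mpr ⟨o, by simp⟩
  set Q := π '' {g | len G o g ≤ 0} with hQ
  refine ⟨d, HasDegree.of_le (C := 1) (K := Q.ncard + {x | G.dist o x ≤ C}.ncard) hd
    (A.monotone_ncard_ball o) hpos le_rfl ((hpos C).trans (Nat.le_add_left _ _))
    (fun n hn => ?_) (fun n _ => ?_)⟩
  · have hsub : {x | G.dist o x ≤ n} ⊆ (fun p : (Γ ⧸ N) × X => p.1.out • p.2) ''
        (((π '' S) ^ n) ×ˢ {x | G.dist o x ≤ C}) := by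
      intro x hx
      obtain ⟨g, rfl⟩ := A.trans o x
      have hg : g ∈ S ^ n := by
        obtain ⟨m, rfl⟩ := Nat.exists_eq_add_of_le' hn
        exact A.mem_pow_of_len_le o hx
      have hν : (π g).out⁻¹ * g ∈ N := QuotientGroup.eq.mp (QuotientGroup.out_eq' _)
      refine ⟨(π g, ((π g).out⁻¹ * g) • o), ⟨?_, hC _ hν⟩, ?_⟩
      · rw [← Set.image_pow]
        exact ⟨g, hg, rfl⟩
      · change (π g).out • ((π g).out⁻¹ * g) • o = g • o
        rw [smul_smul, mul_inv_cancel_left]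
    have hf := (finite_pow hSf n).prod (hball C)
    rw [one_mul]
    calc {x | G.dist o x ≤ n}.ncard ≤ _ := Set.ncard_le_ncard hsub (hf.image _)
      _ ≤ _ := Set.ncard_image_le hf
      _ = {x | G.dist o x ≤ C}.ncard * ((π '' S) ^ n).ncard := by rw [Set.ncard_prod, mul_comm]
      _ ≤ _ := Nat.mul_le_mul_right _ (Nat.le_add_left _ _)
  · choose γ hγ using A.trans o
    have hsub : (π '' S) ^ n ⊆ (π ∘ γ) '' {x | G.dist o x ≤ n} * Q := by
      rw [← Set.image_pow]
      rintro _ ⟨g, hg, rfl⟩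
      have hlen : len G o g ≤ n * 1 := A.len_mem_pow o (fun s hs => hs) n g hg
      rw [mul_one] at hlen
      refine ⟨π (γ (g • o)), ⟨g • o, hlen, rfl⟩, π ((γ (g • o))⁻¹ * g), ⟨_, ?_, rfl⟩, ?_⟩
      · rw [Set.mem_ofPred_eq, ← A.dist_smul_smul, hγ, SimpleGraph.dist_self]
      · simp only [← map_mul, mul_inv_cancel_left]
    rw [one_mul]
    calc ((π '' S) ^ n).ncard ≤ _ :=
          Set.ncard_le_ncard hsub (((hball n).image _).mul (hfin 0))
      _ ≤ ((π ∘ γ) '' {x | G.dist o x ≤ n}).ncard * Q.ncard := Set.natCard_mul_le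
      _ ≤ {x | G.dist o x ≤ n}.ncard * Q.ncard :=
          Nat.mul_le_mul_right _ (Set.ncard_image_le (hball n))
      _ ≤ _ := by
          rw [mul_comm]
          exact Nat.mul_le_mul_right _ (Nat.le_add_right _ _)

end GraphAction

theorem HasDegree.tendsto_log_div_log {f : ℕ → ℕ} {d : ℕ} (hf : HasDegree f d) :
    Tendsto (fun n : ℕ => Real.log (f n) / Real.log n) atTop (nhds (d : ℝ)) := by
  obtain ⟨A, B, hA, hB, h⟩ := hf
  have hlog : Tendsto (fun n : ℕ => Real.log n) atTop atTop :=
    Real.tendsto_log_atTop.comp tendsto_natCast_atTop_atTop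
  have hlim : ∀ a : ℝ, Tendsto (fun n : ℕ => a / Real.log n + d) atTop (nhds (d : ℝ)) := fun a => by
    simpa using (hlog.const_div_atTop a).add_const (d : ℝ)
  refine tendsto_of_tendsto_of_tendsto_of_le_of_le' (hlim (Real.log A)) (hlim (Real.log B)) ?_ ?_
  all_goals
    filter_upwards [eventually_ge_atTop 2] with n hn
    have hn0 : (0 : ℝ) < n := by exact_mod_cast (by omega : 0 < n)
    have hl : 0 < Real.log n := Real.log_pos (by exact_mod_cast (by omega : 1 < n))
    obtain ⟨h1, h2⟩ := h n (by omega)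
    have h0 : 0 < A * (n : ℝ) ^ d := by positivity
    have hlogpow : ∀ a : ℝ, 0 < a →
        Real.log (a * (n : ℝ) ^ d) = (Real.log a / Real.log n + d) * Real.log n := fun a ha => by
      rw [Real.log_mul ha.ne' (by positivity), Real.log_pow]
      field_simp
  · rw [le_div_iff₀ hl, ← hlogpow A hA]
    exact Real.log_le_log h0 h1
  · rw [div_le_iff₀ hl, ← hlogpow B hB]
    exact Real.log_le_log (h0.trans_le h1) h2

end PolyGrowth

/-- A connected, locally finite, vertex-transitive simple graph of polynomial growth
has integer growth degree: there are `d ∈ ℕ` and constants `A, B > 0` and `r₀` with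
`A·r^d ≤ β(G,v,r) ≤ B·r^d` for every vertex `v` and all `r ≥ r₀`; in particular
`log β(G,v,r) / log r → d` as `r → ∞`. -/
theorem growthDegree_integer_of_vertexTransitive
    {V : Type*} (G : SimpleGraph V) [G.LocallyFinite] (hconn : G.Connected)
    (htrans : ∀ u v : V, ∃ φ : G ≃g G, φ u = v)
    (c : ℝ) (hc : 0 < c) (k : ℕ)
    (hpoly : ∀ (v : V) (r : ℕ), 1 ≤ r → (graphGrowth G v r : ℝ) ≤ c * (r : ℝ) ^ k) :
    ∃ (d : ℕ) (A B : ℝ) (_ : 0 < A) (_ : 0 < B) (r₀ : ℕ),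
      (∀ (v : V) (r : ℕ), r₀ ≤ r →
        A * (r : ℝ) ^ d ≤ (graphGrowth G v r : ℝ) ∧
        (graphGrowth G v r : ℝ) ≤ B * (r : ℝ) ^ d) ∧
      (∀ v : V, Tendsto (fun r : ℕ => Real.log (graphGrowth G v r) / Real.log r)
        atTop (nhds (d : ℝ))) := by
  have hact : PolyGrowth.GraphAction (G ≃g G) G :=
    ⟨hconn, fun φ _ _ => φ.map_rel_iff, fun u v => htrans u v⟩
  obtain ⟨o⟩ := hconn.nonempty
  obtain ⟨d, hd⟩ := hact.exists_hasDegree_ball o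
    (PolyGrowth.good_of_polyBound k _ V G hact o ⟨c, hc, hpoly o⟩)
  have heq : ∀ v, graphGrowth G v = fun n => {x | G.dist o x ≤ n}.ncard := fun v => by
    obtain ⟨φ, rfl⟩ := htrans o v
    funext n
    rw [graphGrowth, ← (φ.injective.injOn (s := {x | G.dist o x ≤ n})).ncard_image]
    congr 1
    ext x
    obtain ⟨y, rfl⟩ := φ.surjective x
    have : G.dist (φ o) (φ y) = G.dist o y := hact.dist_smul φ o y
    simp [this]
  obtain ⟨A, B, hA, hB, h⟩ := id hd
  refine ⟨d, A, B, hA, hB, 1, fun v r hr => ?_, fun v => ?_⟩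
  · rw [heq]
    exact h r hr
  · rw [heq]
    exact hd.tendsto_log_div_log
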